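/- For every ε > 0 there exists a constant C = C(q, ε) > 0 such that for every N ∈ ℕ there exist real numbers a₀ and a_{P−1}, indexed by the irreducible polynomials P ∈ 𝔽_q[t] of degree at most N, such that the function T : K_∞ → ℝ defined by T(x) = a₀ + Σ_{P irreducible, deg P ≤ N} a_{P−1} · Re(e(x·(P−1))) satisfies: (1) T(0) = 1; (2) T(x) ≥ 0 for every x ∈ K_∞; (3) 0 < a₀ ≤ C · q^{N(−1/12 + ε)}. -/

import Mathlib

open Polynomial
open scoped Classical

noncomputable section

variable (p : ℕ) [Fact p.Prime] (Fq : Type) [Field Fq] [Fintype Fq] [Algebra (ZMod p) Fq]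

/-- `t` as an element of `K∞ = 𝔽_q((1/t))`; the exponent of the Hahn series variable records
the power of `1/t`, so that `res x = x.coeff 1` and `ord x = -x.order`. -/
def Kt : LaurentSeries Fq := HahnSeries.single (-1 : ℤ) 1

/-- The Laurent expansion at infinity of a polynomial. -/
def toK (f : Polynomial Fq) : LaurentSeries Fq := Polynomial.aeval (Kt Fq) f

/-- The additive character `e(x) = exp(2πi · tr(res x)/p)` on `K∞`. -/
def eC (x : LaurentSeries Fq) : ℂ :=
  Complex.exp (2 * Real.pi * Complex.I *
    ((Algebra.trace (ZMod p) Fq (x.coeff 1)).val : ℂ) / (p : ℂ))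

/-- The norm `⟨x⟩ = q^(ord x)` on `K∞` (with `⟨0⟩ = 0`). -/
def Knorm (x : LaurentSeries Fq) : ℝ :=
  if x = 0 then 0 else (Fintype.card Fq : ℝ) ^ (-x.order)

/-- The norm `⟨f⟩ = q^(deg f)` of a polynomial (with `⟨0⟩ = 0`). -/
def pnorm (f : Polynomial Fq) : ℝ :=
  if f = 0 then 0 else (Fintype.card Fq : ℝ) ^ f.natDegree

/-- Exponential growth of power sums controls every term. -/
theorem norm_le_of_powerSum_le {ι : Type*} [Fintype ι] (w : ι → ℂ) (C T : ℝ) (hT : 0 ≤ T)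
    (h : ∀ r : ℕ, ‖∑ i, w i ^ r‖ ≤ C * T ^ r) (i₀ : ι) : ‖w i₀‖ ≤ T := by
  set L : ℂ[X] := ∏ a ∈ (Finset.univ.image w).erase (w i₀), (X - Polynomial.C a) with hL
  have hL0 : L.eval (w i₀) ≠ 0 := by
    rw [hL, eval_prod, Finset.prod_ne_zero_iff]
    intro a ha
    simp only [eval_sub, eval_X, eval_C]
    exact sub_ne_zero.2 (Finset.ne_of_mem_erase ha).symm
  have hL1 : ∀ i, w i ≠ w i₀ → L.eval (w i) = 0 := by
    intro i hi
    rw [hL, eval_prod]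
    exact Finset.prod_eq_zero
      (Finset.mem_erase.2 ⟨hi, Finset.mem_image_of_mem _ (Finset.mem_univ i)⟩) (by simp)
  set n : ℕ := (Finset.univ.filter fun i => w i = w i₀).card with hn
  have hn1 : 1 ≤ n := Finset.card_pos.2 ⟨i₀, by simp⟩
  have key : ∀ r : ℕ, ∑ j ∈ Finset.range (L.natDegree + 1), L.coeff j * ∑ i, w i ^ (r + j)
      = n * (w i₀ ^ r * L.eval (w i₀)) := by
    intro r
    calc ∑ j ∈ Finset.range (L.natDegree + 1), L.coeff j * ∑ i, w i ^ (r + j)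
        = ∑ i, w i ^ r * L.eval (w i) := by
          simp_rw [Finset.mul_sum]
          rw [Finset.sum_comm]
          refine Finset.sum_congr rfl fun i _ => ?_
          rw [eval_eq_sum_range, Finset.mul_sum]
          refine Finset.sum_congr rfl fun j _ => ?_
          ring
      _ = ∑ i, if w i = w i₀ then w i₀ ^ r * L.eval (w i₀) else 0 := by
          refine Finset.sum_congr rfl fun i _ => ?_
          split_ifs with hi
          · rw [hi]
          · rw [hL1 i hi, mul_zero]
      _ = _ := by
          rw [← Finset.sum_filter, Finset.sum_const, nsmul_eq_mul]
  set B : ℝ := ∑ j ∈ Finset.range (L.natDegree + 1), ‖L.coeff j‖ * (C * T ^ j) with hB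
  have bound : ∀ r : ℕ, ‖w i₀‖ ^ r * ‖L.eval (w i₀)‖ ≤ B * T ^ r := by
    intro r
    have h1 : ‖w i₀‖ ^ r * ‖L.eval (w i₀)‖ ≤ ‖(n : ℂ) * (w i₀ ^ r * L.eval (w i₀))‖ := by
      rw [norm_mul, norm_mul, norm_pow, Complex.norm_natCast]
      have : (1 : ℝ) ≤ n := by exact_mod_cast hn1
      nlinarith [mul_nonneg (pow_nonneg (norm_nonneg (w i₀)) r) (norm_nonneg (L.eval (w i₀)))]
    refine h1.trans ?_
    rw [← key, hB, Finset.sum_mul]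
    refine (norm_sum_le _ _).trans (Finset.sum_le_sum fun j _ => ?_)
    rw [norm_mul]
    calc _ ≤ ‖L.coeff j‖ * (C * T ^ (r + j)) := by gcongr; exact h _
      _ = _ := by ring
  by_contra! hlt
  have hpos : 0 < ‖L.eval (w i₀)‖ := norm_pos_iff.2 hL0
  rcases hT.eq_or_lt with h0 | hTpos
  · have := bound 1
    rw [← h0] at this hlt
    simp only [pow_one, mul_zero] at this
    nlinarith [mul_pos hlt hpos]
  · have h1 : 1 < ‖w i₀‖ / T := by rwa [one_lt_div hTpos]
    obtain ⟨r, hr⟩ := pow_unbounded_of_one_lt (B / ‖L.eval (w i₀)‖) h1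
    rw [div_pow, div_lt_div_iff₀ hpos (by positivity)] at hr
    linarith [bound r]

section Bivariate

variable {F : Type*} [CommRing F] {R : Type*} [CommRing R] [Algebra F R]

/-- Evaluation of a bivariate polynomial: `x` for the inner and `y` for the outer variable. -/
def bev (x y : R) : F[X][X] →ₐ[F] R := aevalAeval x y

@[simp] theorem bev_C (x y : R) (p : F[X]) : bev x y (C p) = aeval x p := by
  simp [bev]

@[simp] theorem bev_X (x y : R) : bev x y (X : F[X][X]) = y := by
  simp [bev]

theorem bev_eq_eval_map (x y : R) (p : F[X][X]) :
    bev x y p = (p.map (aeval x : F[X] →ₐ[F] R).toRingHom).eval y := by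
  induction p using Polynomial.induction_on' with
  | add p q hp hq => simp [hp, hq]
  | monomial n a => simp [← C_mul_X_pow_eq_monomial]

theorem bev_eq_sum (x y : R) {p : F[X][X]} {n : ℕ} (hn : p.natDegree < n) :
    bev x y p = ∑ i ∈ Finset.range n, aeval x (p.coeff i) * y ^ i := by
  conv_lhs => rw [p.as_sum_range_C_mul_X_pow' hn]
  simp

theorem map_bev {S : Type*} [CommRing S] [Algebra F S] (φ : R →ₐ[F] S) (x y : R) (p : F[X][X]) :
    φ (bev x y p) = bev (φ x) (φ y) p := by
  rw [bev_eq_sum x y p.natDegree.lt_succ_self, bev_eq_sum _ _ p.natDegree.lt_succ_self]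
  simp [Polynomial.aeval_algHom_apply]

/-- All coefficients of the bivariate polynomial `p` have degree at most `n`. -/
def XDegLE (p : F[X][X]) (n : ℕ) : Prop := ∀ i, (p.coeff i).natDegree ≤ n

namespace XDegLE

theorem mono {p : F[X][X]} {m n : ℕ} (h : XDegLE p m) (hmn : m ≤ n) : XDegLE p n :=
  fun i => (h i).trans hmn

theorem exists_le (p : F[X][X]) : ∃ n, XDegLE p n := by
  refine ⟨p.support.sup fun i => (p.coeff i).natDegree, fun i => ?_⟩
  by_cases hi : i ∈ p.support
  · exact Finset.le_sup (f := fun i => (p.coeff i).natDegree) hi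
  · simp [notMem_support_iff.1 hi]

theorem sub {p q : F[X][X]} {n : ℕ} (hp : XDegLE p n) (hq : XDegLE q n) : XDegLE (p - q) n :=
  fun i => by rw [coeff_sub]; exact natDegree_sub_le_of_le (hp i) (hq i) |>.trans (by simp)

theorem sum {ι : Type*} (s : Finset ι) {p : ι → F[X][X]} {n : ℕ} (hp : ∀ i ∈ s, XDegLE (p i) n) :
    XDegLE (∑ i ∈ s, p i) n := fun j => by
  rw [finsetSum_coeff]
  exact natDegree_sum_le_of_forall_le _ _ fun i hi => hp i hi j

theorem smul {p : F[X][X]} {n : ℕ} (c : F) (hp : XDegLE p n) : XDegLE (c • p) n := fun i => by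
  rw [coeff_smul]; exact (natDegree_smul_le _ _).trans (hp i)

theorem mul {p q : F[X][X]} {m n : ℕ} (hp : XDegLE p m) (hq : XDegLE q n) :
    XDegLE (p * q) (m + n) := fun i => by
  rw [coeff_mul]
  refine natDegree_sum_le_of_forall_le _ _ fun x _ => ?_
  exact natDegree_mul_le.trans (Nat.add_le_add (hp _) (hq _))

theorem C {p : F[X]} {n : ℕ} (hp : p.natDegree ≤ n) : XDegLE (Polynomial.C p) n := fun i => by
  rw [coeff_C]; split_ifs <;> simp [hp]

theorem X_pow (k : ℕ) : XDegLE (X ^ k : F[X][X]) 0 := fun i => by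
  rw [coeff_X_pow]; split_ifs <;> simp

theorem one : XDegLE (1 : F[X][X]) 0 := by simpa using X_pow (F := F) 0

theorem pow {p : F[X][X]} {n : ℕ} (hp : XDegLE p n) (k : ℕ) : XDegLE (p ^ k) (k * n) := by
  induction k with
  | zero => simpa using one
  | succ k ih => rw [pow_succ, Nat.succ_mul]; exact ih.mul hp

theorem modByMonic [Nontrivial F] {f : F[X][X]} (hf : f.Monic) (hf1 : 1 ≤ f.natDegree) {δ : ℕ}
    (hδ : XDegLE f δ) {p : F[X][X]} {n : ℕ} (hp : XDegLE p n) :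
    XDegLE (p %ₘ f) (n + p.natDegree * δ) := by
  generalize hd : p.natDegree = d
  induction d using Nat.strong_induction_on generalizing p n with
  | _ d ih =>
    by_cases hlt : p.degree < f.degree
    · rw [(modByMonic_eq_self_iff hf).2 hlt]
      exact hp.mono (Nat.le_add_right _ _)
    · have hp0 : p ≠ 0 := by
        rintro rfl
        rw [degree_zero] at hlt
        exact hlt (bot_lt_iff_ne_bot.2 (mt degree_eq_bot.1 (by rintro rfl; simp at hf1)))
      have hle : f.natDegree ≤ d := hd ▸ natDegree_le_natDegree (not_lt.1 hlt)
      set p' := p - f * (Polynomial.C p.leadingCoeff * X ^ (p.natDegree - f.natDegree)) with hp'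
      have hmod : p' %ₘ f = p %ₘ f := by
        rw [hp', sub_modByMonic, (modByMonic_eq_zero_iff_dvd hf).2 (dvd_mul_right _ _), sub_zero]
      have hX : XDegLE p' (n + δ) := by
        refine (hp.mono (Nat.le_add_right _ _)).sub ?_
        have := hδ.mul ((C (hp p.natDegree)).mul (X_pow (p.natDegree - f.natDegree)))
        exact this.mono (by omega)
      have hdeg : p'.degree < p.degree := div_wf_lemma ⟨not_lt.1 hlt, hp0⟩ hf
      have hnd : p'.natDegree < d := by
        rw [← hd]
        by_cases h0 : p' = 0
        · rw [h0, natDegree_zero]; omega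
        · exact natDegree_lt_natDegree h0 hdeg
      rw [← hmod]
      refine (ih _ hnd hX rfl).mono ?_
      have : (p'.natDegree + 1) * δ ≤ d * δ := Nat.mul_le_mul_right _ hnd
      linarith

end XDegLE

end Bivariate

section Frobenius

variable (F : Type*) [Field F] [Fintype F] (R : Type*) [CommRing R] [Algebra F R]

/-- The `q ^ r`-power map as an algebra endomorphism. -/
def frobPow (r : ℕ) : R →ₐ[F] R := FiniteField.frobeniusAlgHom F R ^ r

@[simp] theorem frobPow_apply (r : ℕ) (x : R) : frobPow F R r x = x ^ Fintype.card F ^ r := by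
  rw [frobPow, AlgHom.coe_pow, FiniteField.coe_frobeniusAlgHom, pow_iterate]

end Frobenius

section SeriesPoint

variable {F : Type*} [Field F]

theorem natDegree_det_le {n : ℕ} (M : Matrix (Fin n) (Fin n) F[X]) (d : ℕ)
    (h : ∀ i j, (M i j).natDegree ≤ d) : M.det.natDegree ≤ n * d := by
  rw [Matrix.det_apply]
  refine natDegree_sum_le_of_forall_le _ _ fun σ _ => ?_
  refine (natDegree_smul_le _ _).trans ((natDegree_prod_le _ _).trans ?_)
  refine (Finset.sum_le_card_nsmul _ _ d fun i _ => h _ _).trans ?_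
  simp

/-- `lam` has minimal polynomial `f` over `F[X]`, in a form that only uses evaluation. -/
structure IsSeriesRoot (f : F[X][X]) (lam : PowerSeries F) : Prop where
  monic : f.Monic
  pos : 1 ≤ f.natDegree
  root : bev (PowerSeries.X : PowerSeries F) lam f = 0
  minimal : ∀ p : F[X][X], p.natDegree < f.natDegree →
    bev (PowerSeries.X : PowerSeries F) lam p = 0 → p = 0

theorem aeval_powerSeries_X (p : F[X]) :
    aeval (PowerSeries.X : PowerSeries F) p = (p : PowerSeries F) := by
  rw [Polynomial.aeval_def, Polynomial.eval₂_eq_sum_range]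
  conv_rhs => rw [p.as_sum_range_C_mul_X_pow]
  rw [← Polynomial.coeToPowerSeries.ringHom_apply, map_sum]
  simp

namespace IsSeriesRoot

variable {f : F[X][X]} {lam : PowerSeries F}

theorem bev_modByMonic (h : IsSeriesRoot f lam) (p : F[X][X]) :
    bev (PowerSeries.X : PowerSeries F) lam (p %ₘ f) = bev PowerSeries.X lam p := by
  conv_rhs => rw [← modByMonic_add_div p f]
  rw [map_add, map_mul, h.root, zero_mul, add_zero]

theorem natDegree_modByMonic (h : IsSeriesRoot f lam) (p : F[X][X]) :
    (p %ₘ f).natDegree < f.natDegree :=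
  natDegree_modByMonic_lt p h.monic (by rintro rfl; simpa using h.pos)

theorem le_of_X_pow_dvd (h : IsSeriesRoot f lam) {δ : ℕ} (hδ : XDegLE f δ) {v : F[X][X]} {l Q : ℕ}
    (hv : XDegLE v l) (hvd : v.natDegree < f.natDegree) (hv0 : v ≠ 0)
    (hdvd : (PowerSeries.X : PowerSeries F) ^ Q ∣ bev PowerSeries.X lam v) :
    Q ≤ f.natDegree * (l + 2 * f.natDegree * δ) := by
  set E := f.natDegree with hE
  set M : Matrix (Fin E) (Fin E) F[X] :=
    Matrix.of fun i j => ((v * X ^ (i : ℕ)) %ₘ f).coeff j with hM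
  set ι : F[X] →ₐ[F] PowerSeries F := aeval (PowerSeries.X : PowerSeries F) with hι
  have hrow : ∀ i : Fin E, ∑ j : Fin E, ι (M i j) * lam ^ (j : ℕ)
      = bev PowerSeries.X lam v * lam ^ (i : ℕ) := by
    intro i
    have := h.bev_modByMonic (v * X ^ (i : ℕ))
    rw [bev_eq_sum _ _ (h.natDegree_modByMonic _), Finset.sum_range] at this
    simpa [hM, hι] using this
  have hv1 : bev PowerSeries.X lam v ≠ 0 := fun h0 => hv0 (h.minimal v hvd h0)
  have hdet : M.det ≠ 0 := by
    intro h0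
    obtain ⟨w, hw0, hw⟩ := Matrix.exists_vecMul_eq_zero_iff.2 h0
    apply hw0
    have h1 : ∑ i : Fin E, ι (w i) * (bev PowerSeries.X lam v * lam ^ (i : ℕ)) = 0 := by
      simp_rw [← hrow, Finset.mul_sum]
      rw [Finset.sum_comm]
      refine Finset.sum_eq_zero fun j _ => ?_
      have := congr_arg ι (congr_fun hw j)
      simp only [Matrix.vecMul, dotProduct, map_sum, map_mul, Pi.zero_apply, map_zero] at this
      simp_rw [← mul_assoc]
      rw [← Finset.sum_mul, this, zero_mul]
    have h2 : bev PowerSeries.X lam v *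
        bev PowerSeries.X lam (∑ i : Fin E, C (w i) * X ^ (i : ℕ)) = 0 := by
      rw [← h1, map_sum, Finset.mul_sum]
      refine Finset.sum_congr rfl fun i _ => ?_
      simp only [map_mul, bev_C, map_pow, bev_X]
      ring
    have h3 := h.minimal _ ?_ ((mul_eq_zero.1 h2).resolve_left hv1)
    · ext1 i
      have := congr_arg (fun p => p.coeff (i : ℕ)) h3
      simpa [coeff_C_mul, coeff_X_pow, Fin.val_inj, finsetSum_coeff] using this
    · refine lt_of_le_of_lt (natDegree_sum_le_of_forall_le (n := E - 1) _ _ fun i _ => ?_) ?_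
      · refine (natDegree_C_mul_X_pow_le _ _).trans ?_
        have := i.2
        omega
      · have := h.pos
        omega
  have hdvd' : bev PowerSeries.X lam v ∣ ι M.det := by
    have hE0 : 0 < E := h.pos
    have h1 : ∀ i : Fin E, (M.map ι).mulVec (fun j => lam ^ (j : ℕ)) i
        = bev PowerSeries.X lam v * lam ^ (i : ℕ) := by
      intro i
      rw [← hrow i]
      rfl
    have h2 : (M.map ι).adjugate.mulVec ((M.map ι).mulVec fun j => lam ^ (j : ℕ)) ⟨0, hE0⟩
        = ι M.det := by
      rw [Matrix.mulVec_mulVec, Matrix.adjugate_mul, Matrix.smul_mulVec, Matrix.one_mulVec]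
      have : ι M.det = (M.map ι).det := by
        have := AlgHom.map_det ι M
        simpa using this
      simp [this]
    rw [← h2]
    simp only [Matrix.mulVec, dotProduct] at h1 ⊢
    refine Finset.dvd_sum fun i _ => ?_
    rw [h1 i]
    exact (dvd_mul_right _ _).mul_left _
  have hdvd2 := hdvd.trans hdvd'
  have hnd : M.det.natDegree ≤ E * (l + 2 * E * δ) := by
    refine natDegree_det_le M _ fun i j => ?_
    have h1 : XDegLE (v * X ^ (i : ℕ)) l := by simpa using hv.mul (XDegLE.X_pow (i : ℕ))
    refine (XDegLE.modByMonic h.monic h.pos hδ h1 _).trans ?_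
    gcongr
    refine natDegree_mul_le.trans ?_
    rw [natDegree_X_pow]
    have := i.2
    omega
  refine le_trans ?_ hnd
  rw [hι, aeval_powerSeries_X, PowerSeries.X_pow_dvd_iff] at hdvd2
  by_contra! hlt
  have := hdvd2 _ hlt
  rw [Polynomial.coeff_coe] at this
  exact hdet (leadingCoeff_eq_zero.1 this)

end IsSeriesRoot
end SeriesPoint

section Stepanov

variable {F : Type*} [Field F]

/-- A linear relation modulo `f` exists between sufficiently many bivariate polynomials. -/
theorem exists_relation_modByMonic {ι : Type*} [Fintype ι] {f : F[X][X]} (hf : f.Monic)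
    (g : ι → F[X][X]) (n : ℕ) (hg : ∀ i, XDegLE (g i %ₘ f) n)
    (hcard : f.natDegree * (n + 1) < Fintype.card ι) :
    ∃ s : ι → F, s ≠ 0 ∧ (∑ i, s i • g i) %ₘ f = 0 := by
  set v : ι → (Fin f.natDegree → Fin (n + 1) → F) :=
    fun i a b => ((g i %ₘ f).coeff a).coeff b with hv
  have hnot : ¬ LinearIndependent F v := by
    intro hli
    have := hli.fintype_card_le_finrank
    rw [Module.finrank_pi_fintype] at this
    simp at this
    omega
  obtain ⟨s, hs, i, hi⟩ := Fintype.not_linearIndependent_iff.1 hnot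
  refine ⟨s, fun h0 => hi (by rw [h0]; rfl), ?_⟩
  have hlin : (∑ i, s i • g i) %ₘ f = ∑ i, s i • (g i %ₘ f) := by
    have := map_sum ((Polynomial.modByMonicHom f).restrictScalars F) (fun i => s i • g i)
      Finset.univ
    simpa only [LinearMap.coe_restrictScalars, map_smul, modByMonicHom_apply] using this
  rw [hlin]
  ext a b
  simp only [finsetSum_coeff, coeff_smul, coeff_zero]
  by_cases ha : a < f.natDegree
  · by_cases hb : b < n + 1
    · have := congr_fun (congr_fun hs ⟨a, ha⟩) ⟨b, hb⟩
      simpa [hv, Finset.sum_apply] using this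
    · refine Finset.sum_eq_zero fun i _ => ?_
      rw [coeff_eq_zero_of_natDegree_lt (lt_of_le_of_lt (hg i a) (by omega)), smul_zero]
  · refine Finset.sum_eq_zero fun i _ => ?_
    rw [coeff_eq_zero_of_degree_lt (n := a), coeff_zero, smul_zero]
    refine (degree_modByMonic_lt _ hf).trans_le (degree_le_natDegree.trans ?_)
    exact_mod_cast not_lt.1 ha

variable [Fintype F]

theorem powerSeries_frobPow_sub_dvd (r : ℕ) (u : PowerSeries F) :
    (PowerSeries.X : PowerSeries F) ^ (Fintype.card F ^ r) ∣
      frobPow F (PowerSeries F) r u - algebraMap F _ (PowerSeries.constantCoeff u) := by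
  have h1 : (PowerSeries.X : PowerSeries F) ∣ u - algebraMap F _ (PowerSeries.constantCoeff u) := by
    rw [PowerSeries.X_dvd_iff]
    simp
  obtain ⟨w, hw⟩ := h1
  refine ⟨w ^ (Fintype.card F ^ r), ?_⟩
  rw [← mul_pow, ← hw, ← frobPow_apply F, map_sub, AlgHom.commutes]

/-- The family of polynomials in `lam` with coefficients that are `q ^ r`-th powers is independent
over small polynomials. -/
theorem IsSeriesRoot.frobPow_sum_ne_zero {f : F[X][X]} {lam : PowerSeries F}
    (h : IsSeriesRoot f lam) {δ : ℕ} (hδ : XDegLE f δ) {l r : ℕ}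
    (hord : f.natDegree * (l + 2 * f.natDegree * δ) < Fintype.card F ^ r)
    (u : Fin (l + 1) × Fin f.natDegree → PowerSeries F) (hu : u ≠ 0) :
    ∑ i, (PowerSeries.X ^ (i.1 : ℕ) * lam ^ (i.2 : ℕ)) * frobPow F _ r (u i) ≠ 0 := by
  intro h0
  set Q := Fintype.card F ^ r with hQ
  have hex : ∃ n, ∃ i, ¬ (PowerSeries.X : PowerSeries F) ^ n ∣ u i := by
    obtain ⟨i, hi⟩ := Function.ne_iff.1 hu
    obtain ⟨n, hn⟩ : ∃ n, PowerSeries.coeff n (u i) ≠ 0 := by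
      by_contra! hc
      exact hi (PowerSeries.ext hc)
    exact ⟨n + 1, i, fun hd => hn (PowerSeries.X_pow_dvd_iff.1 hd n n.lt_succ_self)⟩
  obtain ⟨i₀, hi₀⟩ := Nat.find_spec hex
  set d := Nat.find hex - 1 with hd
  have hpos : Nat.find hex ≠ 0 := fun hz => hi₀ (by rw [hz]; simp)
  have hdd : Nat.find hex = d + 1 := by omega
  have hall : ∀ i, (PowerSeries.X : PowerSeries F) ^ d ∣ u i := by
    intro i
    by_contra hc
    exact Nat.find_min hex (m := d) (by omega) ⟨i, hc⟩
  choose w hw using hall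
  have hw0 : PowerSeries.constantCoeff (w i₀) ≠ 0 := by
    intro hz
    obtain ⟨w', hw'⟩ := PowerSeries.X_dvd_iff.2 hz
    exact hi₀ ⟨w', by rw [hw i₀, hw', hdd, pow_succ, mul_assoc]⟩
  have h1 : ∑ i, (PowerSeries.X ^ (i.1 : ℕ) * lam ^ (i.2 : ℕ)) * frobPow F _ r (w i) = 0 := by
    have h2 : (PowerSeries.X : PowerSeries F) ^ (d * Q) *
        ∑ i, (PowerSeries.X ^ (i.1 : ℕ) * lam ^ (i.2 : ℕ)) * frobPow F _ r (w i) = 0 := by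
      rw [← h0, Finset.mul_sum]
      refine Finset.sum_congr rfl fun i _ => ?_
      rw [hw i, map_mul, frobPow_apply F _ r (PowerSeries.X ^ d), ← pow_mul]
      ring
    exact (mul_eq_zero.1 h2).resolve_left (pow_ne_zero _ PowerSeries.X_ne_zero)
  set c : Fin (l + 1) × Fin f.natDegree → F := fun i => PowerSeries.constantCoeff (w i) with hc
  set v : F[X][X] := ∑ i : Fin (l + 1) × Fin f.natDegree,
    C (C (c i) * X ^ (i.1 : ℕ)) * X ^ (i.2 : ℕ) with hv
  have hvlam : bev PowerSeries.X lam v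
      = ∑ i, (PowerSeries.X ^ (i.1 : ℕ) * lam ^ (i.2 : ℕ)) * algebraMap F _ (c i) := by
    rw [hv, map_sum]
    refine Finset.sum_congr rfl fun i _ => ?_
    simp only [map_mul, bev_C, bev_X, map_pow, aeval_C, aeval_X]
    ring
  have hdvd : (PowerSeries.X : PowerSeries F) ^ Q ∣ bev PowerSeries.X lam v := by
    rw [hvlam, ← neg_neg (∑ i, _), dvd_neg, neg_eq_zero_sub, ← h1, ← Finset.sum_sub_distrib]
    refine Finset.dvd_sum fun i _ => ?_
    rw [← mul_sub]
    exact (powerSeries_frobPow_sub_dvd r (w i)).mul_left _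
  have hX : XDegLE v l := by
    refine XDegLE.sum _ fun i _ => ?_
    have : XDegLE (C (C (c i) * X ^ (i.1 : ℕ)) : F[X][X]) l :=
      XDegLE.C ((natDegree_C_mul_X_pow_le _ _).trans (by have := i.1.2; omega))
    simpa using this.mul (XDegLE.X_pow (i.2 : ℕ))
  have hpos' := h.pos
  have hY : v.natDegree < f.natDegree := by
    refine lt_of_le_of_lt (natDegree_sum_le_of_forall_le (n := f.natDegree - 1) _ _
      fun i _ => ?_) (by omega)
    refine (natDegree_C_mul_X_pow_le _ _).trans ?_
    have := i.2.2
    omega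
  have hv0 : v ≠ 0 := by
    intro hz
    have := congr_arg (fun p : F[X][X] => (p.coeff (i₀.2 : ℕ)).coeff (i₀.1 : ℕ)) hz
    simp only [hv, finsetSum_coeff, coeff_C_mul, coeff_X_pow, Fin.val_inj, mul_ite, mul_one,
      mul_zero, coeff_zero] at this
    rw [Finset.sum_eq_single i₀] at this
    · simp only [if_true, coeff_C_mul, coeff_X_pow, mul_one] at this
      exact hw0 this
    · intro i _ hi
      split_ifs with h2
      · rw [coeff_C_mul, coeff_X_pow, if_neg, mul_zero]
        intro h3
        exact hi (Prod.ext (Fin.ext h3.symm) h2.symm)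
      · simp
    · simp
  exact absurd (h.le_of_X_pow_dvd hδ hX hY hv0 hdvd) (not_le.2 hord)

end Stepanov

section StepanovMain

variable {F : Type*} [Field F] {Ω : Type*} [Field Ω] [Algebra F Ω]

theorem card_le_natDegree_of_aeval_eq_zero {c : F[X]} (hc : c ≠ 0) (A : Finset Ω)
    (hA : ∀ α ∈ A, aeval α c = 0) : A.card ≤ c.natDegree := by
  by_contra! hlt
  have h0 : c.map (algebraMap F Ω) = 0 :=
    eq_zero_of_natDegree_lt_card_of_eval_eq_zero' _ A
      (fun α hα => by rw [eval_map_algebraMap]; exact hA α hα) (by rwa [natDegree_map])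
  exact hc ((Polynomial.map_eq_zero _).1 h0)

theorem card_le_of_pow_card_eq (A : Finset Ω) (n : ℕ) (hn : 1 < n) (hA : ∀ α ∈ A, α ^ n = α) :
    A.card ≤ n := by
  have h0 : (X ^ n - X : Polynomial Ω) ≠ 0 := fun h => by
    have := congr_arg natDegree h
    rw [natDegree_sub_eq_left_of_natDegree_lt (by simpa using hn)] at this
    simp at this
    omega
  refine (card_le_natDegree_of_aeval_eq_zero h0 A fun α hα => ?_).trans ?_
  · simp [hA α hα]
  · exact (natDegree_sub_le _ _).trans (by simp; omega)

variable [Fintype F]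

theorem stepanov_aux {f : F[X][X]} {lam : PowerSeries F} (h : IsSeriesRoot f lam)
    {hb : F[X][X]} {D : F[X]} {δ ξ l m r n : ℕ} (hδ : XDegLE f δ) (hξ : XDegLE hb ξ)
    (hn : l * Fintype.card F ^ r + m + f.natDegree * (ξ + D.natDegree) +
      f.natDegree * (Fintype.card F ^ r + hb.natDegree) * δ ≤ n)
    (hcount : f.natDegree * (n + 1) < ((l + 1) * f.natDegree) * ((m + 1) * f.natDegree))
    (hord : f.natDegree * (l + 2 * f.natDegree * δ) < Fintype.card F ^ r)
    (A : Finset Ω) (hA : ∀ α ∈ A, α ^ Fintype.card F ^ (2 * r) = α ∧ aeval α D ≠ 0 ∧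
      ∃ Z : Finset Ω, Z.card = f.natDegree ∧ ∀ z ∈ Z, bev α z f = 0 ∧
        aeval α D * z ^ Fintype.card F ^ (2 * r) = bev α z hb) :
    A.card ≤ l + m * Fintype.card F ^ r + f.natDegree * (1 + Fintype.card F ^ r) * δ := by
  set Q := Fintype.card F ^ r with hQ
  set E := f.natDegree with hE
  have hQQ : Fintype.card F ^ (2 * r) = Q * Q := by rw [hQ, ← pow_add, two_mul]
  rw [hQQ] at hA
  obtain ⟨g₁, hg₁⟩ : ∃ g₁ : (Fin (l + 1) × Fin E) × (Fin (m + 1) × Fin E) → F[X][X],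
      g₁ = fun i =>
    C (X ^ ((i.1.1 : ℕ) * Q + i.2.1) * D ^ (E - 1 - i.2.2)) * X ^ ((i.1.2 : ℕ) * Q) *
      hb ^ (i.2.2 : ℕ) := ⟨_, rfl⟩
  obtain ⟨g, hg⟩ : ∃ g : (Fin (l + 1) × Fin E) × (Fin (m + 1) × Fin E) → F[X][X],
      g = fun i =>
    C (X ^ ((i.1.1 : ℕ) + i.2.1 * Q)) * X ^ ((i.1.2 : ℕ) + i.2.2 * Q) := ⟨_, rfl⟩
  have hEpos : 1 ≤ E := h.pos
  obtain ⟨s, hs0, hs⟩ : ∃ s : _ → F, s ≠ 0 ∧ (∑ i, s i • g₁ i) %ₘ f = 0 := by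
    refine exists_relation_modByMonic h.monic g₁ n (fun i => ?_) ?_
    · obtain ⟨⟨j, a⟩, ⟨j', a'⟩⟩ := i
      have hj := j.2
      have ha := a.2
      have hj' := j'.2
      have ha' := a'.2
      have h1 : XDegLE (g₁ ((j, a), (j', a'))) (l * Q + m + E * (ξ + D.natDegree)) := by
        rw [hg₁]
        have hC : XDegLE (C (X ^ ((j : ℕ) * Q + j') * D ^ (E - 1 - a')) : F[X][X])
            (l * Q + m + E * D.natDegree) := by
          refine XDegLE.C (natDegree_mul_le.trans ?_)
          rw [natDegree_X_pow]
          refine Nat.add_le_add (Nat.add_le_add (Nat.mul_le_mul_right _ (by omega)) (by omega))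
            (natDegree_pow_le.trans (Nat.mul_le_mul_right _ (by omega)))
        refine ((hC.mul (XDegLE.X_pow _)).mul (hξ.pow a')).mono ?_
        have : (a' : ℕ) * ξ ≤ E * ξ := Nat.mul_le_mul_right _ (by omega)
        rw [mul_add]
        omega
      refine (XDegLE.modByMonic h.monic h.pos hδ h1).mono (le_trans ?_ hn)
      refine Nat.add_le_add_left (Nat.mul_le_mul_right _ ?_) _
      rw [hg₁]
      refine natDegree_mul_le.trans ?_
      rw [mul_add]
      refine Nat.add_le_add ((natDegree_C_mul_X_pow_le _ _).trans (Nat.mul_le_mul_right _ ha.le))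
        (natDegree_pow_le.trans (Nat.mul_le_mul_right _ ha'.le))
    · simpa using hcount
  obtain ⟨G, hG⟩ : ∃ G : F[X][X], G = ∑ i, s i • g i := ⟨_, rfl⟩
  have hGX : XDegLE G (l + m * Q) := by
    rw [hG]
    refine XDegLE.sum _ fun i _ => XDegLE.smul _ ?_
    rw [hg]
    have : XDegLE (C (X ^ ((i.1.1 : ℕ) + i.2.1 * Q)) : F[X][X]) (l + m * Q) := by
      refine XDegLE.C ?_
      rw [natDegree_X_pow]
      have h1 := i.1.1.2
      have h2 := i.2.1.2
      exact Nat.add_le_add (by omega) (Nat.mul_le_mul_right _ (by omega))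
    simpa using this.mul (XDegLE.X_pow ((i.1.2 : ℕ) + i.2.2 * Q))
  have hGY : G.natDegree ≤ E * (1 + Q) := by
    rw [hG, hg]
    refine natDegree_sum_le_of_forall_le _ _ fun i _ => (natDegree_smul_le _ _).trans ?_
    refine (natDegree_C_mul_X_pow_le _ _).trans ?_
    have h1 := i.1.2.2
    have h2 := i.2.2.2
    rw [mul_add, mul_one]
    exact Nat.add_le_add (by omega) (Nat.mul_le_mul_right _ (by omega))
  have hGred : XDegLE (G %ₘ f) (l + m * Q + E * (1 + Q) * δ) :=
    (XDegLE.modByMonic h.monic h.pos hδ hGX).mono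
      (Nat.add_le_add_left (Nat.mul_le_mul_right _ hGY) _)
  have hvan : ∀ α ∈ A, ∀ i, aeval α ((G %ₘ f).coeff i) = 0 := by
    intro α hα
    obtain ⟨hα1, hαD, Z, hZc, hZ⟩ := hA α hα
    have hzero : ∀ z ∈ Z, bev α z (G %ₘ f) = 0 := by
      intro z hz
      obtain ⟨hfz, hDz⟩ := hZ z hz
      have h1 : bev α z (∑ i, s i • g₁ i) = 0 := by
        rw [← modByMonic_add_div (∑ i, s i • g₁ i) f, hs, zero_add, map_mul, hfz, zero_mul]
      have h2 : frobPow F Ω r (bev α z G) * aeval α D ^ (E - 1)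
          = bev α z (∑ i, s i • g₁ i) := by
        rw [hG, map_sum, map_sum, map_sum, Finset.sum_mul]
        refine Finset.sum_congr rfl fun i _ => ?_
        obtain ⟨⟨j, a⟩, ⟨j', a'⟩⟩ := i
        rw [map_smul, map_smul, map_smul, smul_mul_assoc]
        congr 1
        rw [frobPow_apply, ← hQ]
        simp only [hg, hg₁, map_mul, bev_C, map_pow, bev_X, aeval_X, ← hDz]
        have hE1 : E - 1 = (E - 1 - a') + a' := by
          have := a'.2
          omega
        conv_lhs => rw [hE1]
        have e1 : (α ^ ((j : ℕ) + j' * Q) * z ^ ((a : ℕ) + a' * Q)) ^ Q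
            = α ^ ((j : ℕ) * Q) * (α ^ (Q * Q)) ^ (j' : ℕ) *
              (z ^ ((a : ℕ) * Q) * (z ^ (Q * Q)) ^ (a' : ℕ)) := by
          rw [mul_pow, ← pow_mul, ← pow_mul, ← pow_mul, ← pow_mul, ← pow_add, ← pow_add]
          congr 2 <;> ring
        rw [e1, hα1]
        ring
      rw [h1, frobPow_apply] at h2
      have h3 := (mul_eq_zero.1 h2).resolve_right (pow_ne_zero _ hαD)
      have h4 : bev α z G = 0 := by
        by_contra hne
        exact pow_ne_zero _ hne h3
      rw [← modByMonic_add_div G f, map_add, map_mul, hfz, zero_mul, add_zero] at h4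
      exact h4
    have hp : (G %ₘ f).map (aeval α : F[X] →ₐ[F] Ω).toRingHom = 0 := by
      refine eq_zero_of_natDegree_lt_card_of_eval_eq_zero' _ Z (fun z hz => ?_) ?_
      · rw [← bev_eq_eval_map]
        exact hzero z hz
      · rw [hZc]
        exact natDegree_map_le.trans_lt (h.natDegree_modByMonic G)
    intro i
    have := congr_arg (fun p => p.coeff i) hp
    simpa using this
  have hne : G %ₘ f ≠ 0 := by
    intro h0
    have h1 : bev PowerSeries.X lam G = 0 := by
      rw [← h.bev_modByMonic, h0, map_zero]
    obtain ⟨w, hw⟩ : ∃ w : Fin (l + 1) × Fin E → F[X][X], w = fun i =>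
      ∑ j : Fin (m + 1) × Fin E, s (i, j) • (C (X ^ (j.1 : ℕ)) * X ^ (j.2 : ℕ)) := ⟨_, rfl⟩
    refine h.frobPow_sum_ne_zero hδ hord (fun i => bev PowerSeries.X lam (w i)) ?_ ?_
    · obtain ⟨⟨i, j⟩, hij⟩ := Function.ne_iff.1 hs0
      intro hz
      have h2 := h.minimal (w i) ?_ (congr_fun hz i)
      · have := congr_arg (fun p : F[X][X] => (p.coeff (j.2 : ℕ)).coeff (j.1 : ℕ)) h2
        simp only [hw, finsetSum_coeff, coeff_smul, coeff_C_mul, coeff_X_pow, Fin.val_inj, mul_ite,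
          mul_one, mul_zero, coeff_zero] at this
        rw [Finset.sum_eq_single j] at this
        · simp only [if_true, coeff_X_pow, smul_eq_mul, mul_one] at this
          exact hij this
        · intro b _ hb'
          split_ifs with h3
          · rw [coeff_X_pow, if_neg, smul_zero]
            intro h4
            exact hb' (Prod.ext (Fin.ext h4.symm) h3.symm)
          · simp
        · simp
      · rw [hw]
        refine lt_of_le_of_lt (natDegree_sum_le_of_forall_le (n := E - 1) _ _
          fun b _ => (natDegree_smul_le _ _).trans ?_) (by omega)
        refine (natDegree_C_mul_X_pow_le _ _).trans ?_
        have := b.2.2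
        omega
    · rw [← h1, hG, map_sum]
      refine Eq.symm ((Fintype.sum_prod_type _).trans (Finset.sum_congr rfl fun i _ => ?_))
      rw [hw, map_sum, map_sum, Finset.mul_sum]
      refine Finset.sum_congr rfl fun j _ => ?_
      rw [map_smul, map_smul, map_smul, mul_smul_comm]
      congr 1
      simp only [hg, frobPow_apply, map_mul, bev_C, map_pow, bev_X, aeval_X, ← hQ]
      ring
  obtain ⟨i, hi⟩ : ∃ i, (G %ₘ f).coeff i ≠ 0 := by
    by_contra! hc
    exact hne (Polynomial.ext hc)
  exact (card_le_natDegree_of_aeval_eq_zero hi A fun α hα => hvan α hα i).trans (hGred i)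

theorem stepanov_count {E Q l m δ ξ d h : ℕ} (hE : 1 ≤ E) (hQ1 : 1 ≤ Q) (hQ : 8 ≤ Q)
    (hl : Q < 4 * (E * (l + 1)))
    (hm : Q + E * (8 * ((E * (1 + h) * δ + E * (ξ + d)) + 2)) < E * (m + 1)) :
    E * (l * Q + m + E * (ξ + d) + E * (Q + h) * δ + 1) <
      ((l + 1) * E) * ((m + 1) * E) := by
  obtain ⟨c₃, hc₃⟩ : ∃ c₃, c₃ = E * (1 + h) * δ + E * (ξ + d) := ⟨_, rfl⟩
  rw [← hc₃] at hm
  have hn : l * Q + m + E * (ξ + d) + E * (Q + h) * δ + 1 ≤ l * Q + c₃ * Q + (m + 1) := by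
    have e1 : E * (ξ + d) ≤ E * (ξ + d) * Q := Nat.le_mul_of_pos_right _ hQ1
    have e2 : E * (Q + h) * δ ≤ E * (1 + h) * δ * Q := by
      have : Q + h ≤ (1 + h) * Q := by nlinarith
      calc E * (Q + h) * δ ≤ E * ((1 + h) * Q) * δ := by gcongr
        _ = _ := by ring
    rw [hc₃, add_mul]
    omega
  have h1 : 1 ≤ E * (l + 1) := Nat.mul_pos hE l.succ_pos
  obtain ⟨a, ha⟩ : ∃ a, E * (l + 1) = a + 1 := ⟨E * (l + 1) - 1, by omega⟩
  have hla : E * l + E = a + 1 := by rw [← ha]; ring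
  have e3 : a * (Q + E * (8 * (c₃ + 2))) ≤ a * (E * (m + 1)) := Nat.mul_le_mul_left _ hm.le
  have e4 : Q * (E * (c₃ + 2)) ≤ 8 * a * (E * (c₃ + 2)) := Nat.mul_le_mul_right _ (by omega)
  have e5 : E * l * Q ≤ a * Q := Nat.mul_le_mul_right _ (by omega)
  have e6 : 1 * 1 ≤ Q * E := Nat.mul_le_mul hQ1 hE
  calc E * (l * Q + m + E * (ξ + d) + E * (Q + h) * δ + 1)
      ≤ E * (l * Q + c₃ * Q + (m + 1)) := Nat.mul_le_mul_left _ hn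
    _ = E * l * Q + Q * (E * c₃) + E * (m + 1) := by ring
    _ < a * Q + 8 * a * (E * (c₃ + 2)) + E * (m + 1) := by
        have : Q * (E * (c₃ + 2)) = Q * (E * c₃) + 2 * (Q * E) := by ring
        omega
    _ = a * (Q + E * (8 * (c₃ + 2))) + E * (m + 1) := by ring
    _ ≤ a * (E * (m + 1)) + E * (m + 1) := Nat.add_le_add_right e3 _
    _ = (E * (l + 1)) * (E * (m + 1)) := by rw [ha]; ring
    _ = (l + 1) * E * ((m + 1) * E) := by ring

/-- Stepanov's method in Bombieri's form: the number of `α` over which all points `z` of the curve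
`f(α, z) = 0` satisfy `D(α) z ^ (q ^ (2 * r)) = h(α, z)` is at most
`(q ^ (2 * r) + O(q ^ r)) / deg f`. -/
theorem stepanov {f : F[X][X]} {lam : PowerSeries F} (h : IsSeriesRoot f lam)
    (hb : F[X][X]) (D : F[X]) :
    ∃ K : ℕ, ∀ (r : ℕ) (A : Finset Ω), 0 < r → (∀ α ∈ A, α ^ Fintype.card F ^ (2 * r) = α ∧
      aeval α D ≠ 0 ∧ ∃ Z : Finset Ω, Z.card = f.natDegree ∧ ∀ z ∈ Z, bev α z f = 0 ∧
        aeval α D * z ^ Fintype.card F ^ (2 * r) = bev α z hb) →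
      A.card * f.natDegree ≤ Fintype.card F ^ (2 * r) + K * Fintype.card F ^ r := by
  obtain ⟨δ, hδ⟩ := XDegLE.exists_le f
  obtain ⟨ξ, hξ⟩ := XDegLE.exists_le hb
  set E := f.natDegree with hE
  have hEpos : 1 ≤ E := h.pos
  set c₃ := E * (1 + hb.natDegree) * δ + E * (ξ + D.natDegree) with hc₃
  set c₅ := 8 * (c₃ + 2) with hc₅
  refine ⟨1 + E * c₅ + 2 * (E * (E * δ)) + (8 * (E * (E * δ)) + 8) * E, fun r A hr hA => ?_⟩
  set Q := Fintype.card F ^ r with hQ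
  have hQ1 : 1 ≤ Q := Nat.one_le_pow _ _ Fintype.card_pos
  have hQQ : Fintype.card F ^ (2 * r) = Q * Q := by rw [hQ, ← pow_add, two_mul]
  by_cases hsmall : Q < 8 * (E * (E * δ)) + 8
  · have h1 : A.card ≤ Q * Q := by
      rw [← hQQ]
      exact card_le_of_pow_card_eq A _
        (Nat.one_lt_pow (by omega) Fintype.one_lt_card) fun α hα => (hA α hα).1
    calc A.card * E ≤ Q * Q * E := Nat.mul_le_mul_right _ h1
      _ = (Q * E) * Q := by ring
      _ ≤ ((8 * (E * (E * δ)) + 8) * E) * Q := by gcongr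
      _ ≤ _ := by
        rw [hQQ]
        nlinarith [Nat.zero_le (Q * Q), Nat.zero_le ((1 + E * c₅ + 2 * (E * (E * δ))) * Q)]
  · rw [not_lt] at hsmall
    set l := Q / (4 * E) with hl
    set m := Q / E + c₅ with hm
    have hl1 : 4 * (E * l) ≤ Q := by
      have := Nat.div_mul_le_self Q (4 * E)
      nlinarith
    have hl2 : Q < 4 * (E * (l + 1)) := by
      have := Nat.lt_div_mul_add (a := Q) (b := 4 * E) (by omega)
      nlinarith
    have hm1 : E * m ≤ Q + E * c₅ := by
      have := Nat.div_mul_le_self Q E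
      nlinarith
    have hm2 : Q + E * c₅ < E * (m + 1) := by
      have := Nat.lt_div_mul_add (a := Q) (b := E) (by omega)
      nlinarith
    have key := stepanov_aux (Ω := Ω) h hδ hξ (l := l) (m := m) (r := r) le_rfl ?_ ?_ A hA
    · rw [hQQ]
      calc A.card * E ≤ (l + m * Q + E * (1 + Q) * δ) * E := Nat.mul_le_mul_right _ key
        _ = E * l + E * m * Q + E * (E * δ) * (1 + Q) := by ring
        _ ≤ Q + (Q + E * c₅) * Q + E * (E * δ) * (2 * Q) := by
          gcongr <;> omega
        _ ≤ _ := by nlinarith [Nat.zero_le ((8 * (E * (E * δ)) + 8) * E * Q)]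
    · exact stepanov_count hEpos hQ1 (by omega) hl2 hm2
    · nlinarith
end StepanovMain

section Torsor

/-- The exponents `1 + q + ⋯ + q ^ (n - 1)`. -/
def geomExp (q : ℕ) : ℕ → ℕ
  | 0 => 0
  | n + 1 => q * geomExp q n + 1

theorem geomExp_mono {q : ℕ} (hq : 1 ≤ q) : Monotone (geomExp q) :=
  monotone_nat_of_le_succ fun n => by
    rw [geomExp]
    nlinarith

theorem le_geomExp {q : ℕ} (hq : 1 ≤ q) (n : ℕ) : n ≤ geomExp q n := by
  induction n with
  | zero => simp
  | succ n ih => rw [geomExp]; nlinarith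

variable (F : Type*) [Field F] [Fintype F]

/-- The cleared-denominator form of the `n`-th iterate of `z ↦ (z - z ^ q) / x`. -/
def iterPoly : ℕ → F[X][X]
  | 0 => X
  | n + 1 => C (X ^ ((Fintype.card F - 1) * geomExp (Fintype.card F) n)) * iterPoly n -
      iterPoly n ^ Fintype.card F

variable {F}

theorem bev_iterPoly {R : Type*} [CommRing R] [Algebra F R] (x : R) (z : ℕ → R)
    (hz : ∀ n, x * z (n + 1) = z n - z n ^ Fintype.card F) (n : ℕ) :
    bev x (z 0) (iterPoly F n) = x ^ geomExp (Fintype.card F) n * z n := by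
  induction n with
  | zero => simp [iterPoly, geomExp]
  | succ n ih =>
    have hq : Fintype.card F = (Fintype.card F - 1) + 1 :=
      (Nat.sub_add_cancel Fintype.card_pos).symm
    have e : Fintype.card F * geomExp (Fintype.card F) n =
        (Fintype.card F - 1) * geomExp (Fintype.card F) n + geomExp (Fintype.card F) n := by
      generalize geomExp (Fintype.card F) n = c
      obtain ⟨m, hm⟩ : ∃ m, Fintype.card F = m + 1 := ⟨_, hq⟩
      rw [hm, Nat.add_sub_cancel]
      ring
    rw [iterPoly, geomExp, map_sub, map_mul, map_pow _ (iterPoly F n), bev_C, map_pow, aeval_X, ih,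
      pow_succ, mul_assoc, hz, mul_sub, mul_pow, ← pow_mul, mul_comm (geomExp _ n) (Fintype.card F),
      ← mul_assoc, ← pow_add, e]

theorem neg_one_pow_pow_card (n : ℕ) :
    (((-1 : F[X]) ^ n) ^ Fintype.card F) = (-1) ^ n := by
  have : (-1 : F[X]) ^ n = C ((-1) ^ n) := by simp
  rw [this, ← C_pow, FiniteField.pow_card]

theorem iterPoly_natDegree_leadingCoeff (n : ℕ) :
    (iterPoly F n).natDegree = Fintype.card F ^ n ∧ (iterPoly F n).leadingCoeff = (-1) ^ n := by
  induction n with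
  | zero => simp [iterPoly]
  | succ n ih =>
    have hdeg : (iterPoly F n ^ Fintype.card F).natDegree = Fintype.card F ^ (n + 1) := by
      rw [natDegree_pow, ih.1, pow_succ, mul_comm]
    have hlt : (C (X ^ ((Fintype.card F - 1) * geomExp (Fintype.card F) n)) *
        iterPoly F n).natDegree < (iterPoly F n ^ Fintype.card F).natDegree := by
      refine (natDegree_C_mul_le _ _).trans_lt ?_
      rw [hdeg, ih.1]
      exact Nat.pow_lt_pow_right Fintype.one_lt_card n.lt_succ_self
    refine ⟨?_, ?_⟩
    · rw [iterPoly, natDegree_sub_eq_right_of_natDegree_lt hlt, hdeg]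
    · rw [iterPoly, leadingCoeff_sub_of_degree_lt' (degree_lt_degree hlt), leadingCoeff_pow, ih.2,
        neg_one_pow_pow_card, pow_succ]
      ring

theorem derivative_iterPoly (n : ℕ) :
    derivative (iterPoly F n) = C (X ^ (geomExp (Fintype.card F) n - n)) := by
  induction n with
  | zero => simp [iterPoly, geomExp]
  | succ n ih =>
    have hq : (Fintype.card F : F[X][X]) = 0 := by
      have : (Fintype.card F : F) = 0 := FiniteField.cast_card_eq_zero F
      rw [← map_natCast (algebraMap F F[X][X]), this, map_zero]
    have h1 := le_geomExp (q := Fintype.card F) Fintype.card_pos n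
    have e : (Fintype.card F - 1) * geomExp (Fintype.card F) n + (geomExp (Fintype.card F) n - n)
        = Fintype.card F * geomExp (Fintype.card F) n + 1 - (n + 1) := by
      obtain ⟨m, hm⟩ : ∃ m, Fintype.card F = m + 1 :=
        ⟨_, (Nat.sub_add_cancel Fintype.card_pos).symm⟩
      rw [hm] at h1 ⊢
      have := add_mul m 1 (geomExp (m + 1) n)
      simp only [Nat.add_sub_cancel]
      omega
    rw [iterPoly, derivative_sub, derivative_C_mul, ih, derivative_pow, ← C_mul, ← pow_add, e]
    simp [hq, geomExp]

/-- The cleared-denominator form of the action of `b` through `z ↦ (z - z ^ q) / x`. -/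
def actPoly (k : ℕ) (b : F[X]) : F[X][X] :=
  ∑ i ∈ Finset.range (k + 1),
    C (C (b.coeff i) * X ^ (geomExp (Fintype.card F) k - geomExp (Fintype.card F) i)) * iterPoly F i

theorem bev_actPoly {R : Type*} [CommRing R] [Algebra F R] (x : R) (z : ℕ → R)
    (hz : ∀ n, x * z (n + 1) = z n - z n ^ Fintype.card F) (k : ℕ) (b : F[X]) :
    bev x (z 0) (actPoly k b) =
      x ^ geomExp (Fintype.card F) k * ∑ i ∈ Finset.range (k + 1), b.coeff i • z i := by
  rw [actPoly, map_sum, Finset.mul_sum]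
  refine Finset.sum_congr rfl fun i hi => ?_
  have hle := geomExp_mono (q := Fintype.card F) Fintype.card_pos
    (Nat.lt_succ_iff.1 (Finset.mem_range.1 hi))
  rw [map_mul, bev_iterPoly x z hz, bev_C, map_mul, map_pow, aeval_C, aeval_X, Algebra.smul_def]
  conv_rhs => rw [← Nat.sub_add_cancel hle, pow_add]
  ring

theorem actPoly_natDegree_leadingCoeff {b : F[X]} (hb : b.Monic) :
    (actPoly b.natDegree b).natDegree = Fintype.card F ^ b.natDegree ∧
      (actPoly b.natDegree b).leadingCoeff = (-1) ^ b.natDegree := by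
  have h1 := iterPoly_natDegree_leadingCoeff (F := F) b.natDegree
  have hlast : C (C (b.coeff b.natDegree) * X ^ (geomExp (Fintype.card F) b.natDegree -
      geomExp (Fintype.card F) b.natDegree)) * iterPoly F b.natDegree
        = iterPoly F b.natDegree := by
    rw [coeff_natDegree, hb.leadingCoeff]; simp
  set s : F[X][X] := ∑ i ∈ Finset.range b.natDegree, C (C (b.coeff i) *
    X ^ (geomExp (Fintype.card F) b.natDegree - geomExp (Fintype.card F) i)) * iterPoly F i with hs
  have hact : actPoly b.natDegree b = s + iterPoly F b.natDegree := by
    rw [actPoly, Finset.sum_range_succ, hlast]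
  have hlt : s.degree < (iterPoly F b.natDegree).degree := by
    have h0 : iterPoly F b.natDegree ≠ 0 := fun h => by
      have := h1.2
      rw [h, leadingCoeff_zero] at this
      exact pow_ne_zero _ (neg_ne_zero.2 one_ne_zero) this.symm
    refine (degree_sum_le _ _).trans_lt ?_
    rw [Finset.sup_lt_iff (bot_lt_iff_ne_bot.2 (mt degree_eq_bot.1 h0))]
    intro i hi
    refine degree_lt_degree ((natDegree_C_mul_le _ _).trans_lt ?_)
    rw [h1.1, (iterPoly_natDegree_leadingCoeff i).1]
    exact Nat.pow_lt_pow_right Fintype.one_lt_card (Finset.mem_range.1 hi)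
  rw [hact]
  exact ⟨by rw [natDegree_add_eq_right_of_degree_lt hlt, h1.1],
    by rw [leadingCoeff_add_of_degree_lt hlt, h1.2]⟩

/-- The derivative of `actPoly`, a polynomial in the inner variable only. -/
def actDisc (k : ℕ) (b : F[X]) : F[X] :=
  ∑ i ∈ Finset.range (k + 1), C (b.coeff i) * X ^ (geomExp (Fintype.card F) k - i)

theorem derivative_actPoly (k : ℕ) (b : F[X]) :
    derivative (actPoly k b) = C (actDisc k b) := by
  rw [actPoly, actDisc, derivative_sum, map_sum]
  refine Finset.sum_congr rfl fun i hi => ?_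
  have hle := geomExp_mono (q := Fintype.card F) Fintype.card_pos
    (Nat.lt_succ_iff.1 (Finset.mem_range.1 hi))
  have hle' := le_geomExp (q := Fintype.card F) Fintype.card_pos i
  rw [derivative_C_mul, derivative_iterPoly, ← C_mul, mul_assoc, ← pow_add]
  congr 4
  omega

/-- The cleared-denominator form of `f` evaluated at the action of `b`. -/
def compPoly (k : ℕ) (f : F[X][X]) (b : F[X]) : F[X][X] :=
  ∑ i ∈ Finset.range (f.natDegree + 1),
    C (f.coeff i * X ^ (geomExp (Fintype.card F) k * (f.natDegree - i))) * actPoly k b ^ i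

theorem bev_compPoly {R : Type*} [CommRing R] [Algebra F R] (x : R) (z : ℕ → R)
    (hz : ∀ n, x * z (n + 1) = z n - z n ^ Fintype.card F) (k : ℕ) (f : F[X][X]) (b : F[X]) :
    bev x (z 0) (compPoly k f b) = x ^ (geomExp (Fintype.card F) k * f.natDegree) *
      bev x (∑ i ∈ Finset.range (k + 1), b.coeff i • z i) f := by
  rw [compPoly, map_sum, bev_eq_sum x _ f.natDegree.lt_succ_self, Finset.mul_sum]
  refine Finset.sum_congr rfl fun i hi => ?_
  have hle := Nat.lt_succ_iff.1 (Finset.mem_range.1 hi)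
  rw [map_mul, map_pow, bev_actPoly x z hz, bev_C, map_mul, map_pow, aeval_X, mul_pow, ← pow_mul]
  have e : geomExp (Fintype.card F) k * f.natDegree =
      geomExp (Fintype.card F) k * (f.natDegree - i) + geomExp (Fintype.card F) k * i := by
    rw [← mul_add, Nat.sub_add_cancel hle]
  rw [e, pow_add]
  ring

end Torsor

section TorsorSeries

variable {F : Type*} [Field F] [Fintype F]

theorem powerSeries_coeff_pow_card (l : PowerSeries F) (m : ℕ) :
    PowerSeries.coeff m (l ^ Fintype.card F) =
      if Fintype.card F ∣ m then PowerSeries.coeff (m / Fintype.card F) l else 0 := by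
  obtain ⟨p, hp⟩ := CharP.exists F
  obtain ⟨n, hpp, hn⟩ := FiniteField.card F p
  have := Fact.mk hpp
  have h0 : Fintype.card F ≠ 0 := Fintype.card_ne_zero
  have key : PowerSeries.expand (Fintype.card F) h0 l = l ^ Fintype.card F := by
    have h1 : iterateFrobenius F p n = RingHom.id F := by
      ext x
      rw [iterateFrobenius_def, ← hn, FiniteField.pow_card, RingHom.id_apply]
    have h2 := MvPowerSeries.map_iterateFrobenius_expand p hpp.ne_zero l (n : ℕ)
    rw [h1, MvPowerSeries.map_id] at h2
    simp only [← hn] at h2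
    exact h2
  rw [← key, PowerSeries.coeff_expand]

/-- The linear form reading off the top coefficient of the residue modulo `Q`. -/
def resForm (Q : F[X]) : F[X] →ₗ[F] F :=
  (lcoeff F (Q.natDegree - 1)).comp (modByMonicHom Q)

theorem resForm_apply (Q b : F[X]) : resForm Q b = (b %ₘ Q).coeff (Q.natDegree - 1) := rfl

theorem dvd_of_resForm_eq_zero {Q : F[X]} (hQ : Q.Monic) (hpos : 1 ≤ Q.natDegree) {b : F[X]}
    (h : ∀ n, resForm Q (X ^ n * b) = 0) : Q ∣ b := by
  rw [← modByMonic_eq_zero_iff_dvd hQ]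
  by_contra hne
  set c := b %ₘ Q with hc
  have hlt : c.natDegree < Q.natDegree :=
    natDegree_modByMonic_lt b hQ (by rintro rfl; simp at hpos)
  have hmod : (X ^ (Q.natDegree - 1 - c.natDegree) * b) %ₘ Q =
      X ^ (Q.natDegree - 1 - c.natDegree) * c := by
    have hself : (X ^ (Q.natDegree - 1 - c.natDegree) * c) %ₘ Q =
        X ^ (Q.natDegree - 1 - c.natDegree) * c := by
      rw [modByMonic_eq_self_iff hQ]
      apply degree_lt_degree
      rw [natDegree_X_pow_mul _ hne]
      omega
    conv_lhs => rw [← modByMonic_add_div b Q, ← hc, mul_add, add_modByMonic, hself]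
    rw [(modByMonic_eq_zero_iff_dvd hQ).2 ⟨X ^ (Q.natDegree - 1 - c.natDegree) * (b /ₘ Q),
      by ring⟩, add_zero]
  have := h (Q.natDegree - 1 - c.natDegree)
  rw [resForm_apply, hmod] at this
  have e : Q.natDegree - 1 = c.natDegree + (Q.natDegree - 1 - c.natDegree) := by omega
  rw [e, Nat.add_sub_cancel_left, coeff_X_pow_mul, coeff_natDegree, leadingCoeff_eq_zero] at this
  exact hne this

variable (F) in
/-- The weights entering the coefficients of the torsion series. -/
def torsorWeight : ℕ → F[X]
  | 0 => 1
  | n + 1 =>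
    have : (n + 1) / Fintype.card F < n + 1 :=
      Nat.div_lt_self (Nat.succ_pos _) Fintype.one_lt_card
    X * torsorWeight n +
      if Fintype.card F ∣ n + 1 then torsorWeight ((n + 1) / Fintype.card F) else 0

/-- Power series solutions of the additive equations attached to `Q`. -/
def torsorSeries (Q : F[X]) : F[X] →ₗ[F] PowerSeries F where
  toFun b := PowerSeries.mk fun n => resForm Q (b * torsorWeight F n)
  map_add' a b := by ext n; simp [add_mul]
  map_smul' c b := by ext n; simp

theorem coeff_torsorSeries (Q b : F[X]) (n : ℕ) :
    PowerSeries.coeff n (torsorSeries Q b) = resForm Q (b * torsorWeight F n) := by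
  simp [torsorSeries]

theorem X_mul_torsorSeries (Q b : F[X]) :
    PowerSeries.X * torsorSeries Q (X * b) =
      torsorSeries Q b - torsorSeries Q b ^ Fintype.card F := by
  ext n
  rw [map_sub, powerSeries_coeff_pow_card]
  cases n with
  | zero => simp
  | succ n =>
    rw [PowerSeries.coeff_succ_X_mul, coeff_torsorSeries, coeff_torsorSeries, coeff_torsorSeries,
      torsorWeight]
    split_ifs with hd
    · rw [mul_add, map_add, add_sub_cancel_right]
      congr 1; ring
    · rw [add_zero, sub_zero]
      congr 1; ring

theorem X_mul_torsorSeries_pow (Q a : F[X]) (n : ℕ) :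
    PowerSeries.X * torsorSeries Q (X ^ (n + 1) * a) =
      torsorSeries Q (X ^ n * a) - torsorSeries Q (X ^ n * a) ^ Fintype.card F := by
  rw [pow_succ', mul_assoc, X_mul_torsorSeries]

theorem torsorSeries_eq_zero_iff {Q : F[X]} (hQ : Q.Monic) (hpos : 1 ≤ Q.natDegree) {b : F[X]} :
    torsorSeries Q b = 0 ↔ Q ∣ b := by
  constructor
  · intro h
    have hn : ∀ n, torsorSeries Q (X ^ n * b) = 0 := by
      intro n
      induction n with
      | zero => simpa using h
      | succ n ih =>
        have := X_mul_torsorSeries_pow Q b n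
        rw [ih, zero_pow Fintype.card_ne_zero, sub_zero] at this
        exact (mul_eq_zero.1 this).resolve_left PowerSeries.X_ne_zero
    refine dvd_of_resForm_eq_zero hQ hpos fun n => ?_
    have := coeff_torsorSeries Q (X ^ n * b) 0
    rw [hn n, torsorWeight, mul_one] at this
    simpa using this.symm
  · rintro ⟨c, rfl⟩
    ext n
    rw [coeff_torsorSeries, resForm_apply, mul_assoc, (modByMonic_eq_zero_iff_dvd hQ).2 ⟨_, rfl⟩]
    simp

theorem sum_coeff_smul_torsorSeries (Q a b : F[X]) {k : ℕ} (hk : b.natDegree ≤ k) :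
    ∑ i ∈ Finset.range (k + 1), b.coeff i • torsorSeries Q (X ^ i * a) =
      torsorSeries Q (b * a) := by
  conv_rhs => rw [b.as_sum_range_C_mul_X_pow' (Nat.lt_succ_of_le hk), Finset.sum_mul, map_sum]
  refine Finset.sum_congr rfl fun i _ => ?_
  rw [← map_smul, smul_eq_C_mul, mul_assoc]

theorem bev_actPoly_torsorSeries (Q a b : F[X]) {k : ℕ} (hk : b.natDegree ≤ k) :
    bev PowerSeries.X (torsorSeries Q a) (actPoly k b) =
      PowerSeries.X ^ geomExp (Fintype.card F) k * torsorSeries Q (b * a) := by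
  have := bev_actPoly (F := F) PowerSeries.X (fun n => torsorSeries Q (X ^ n * a))
    (X_mul_torsorSeries_pow Q a) k b
  simpa [sum_coeff_smul_torsorSeries Q a b hk] using this

theorem bev_compPoly_torsorSeries (Q a b : F[X]) {k : ℕ} (hk : b.natDegree ≤ k) (f : F[X][X]) :
    bev PowerSeries.X (torsorSeries Q a) (compPoly k f b) =
      PowerSeries.X ^ (geomExp (Fintype.card F) k * f.natDegree) *
        bev PowerSeries.X (torsorSeries Q (b * a)) f := by
  have := bev_compPoly (F := F) PowerSeries.X (fun n => torsorSeries Q (X ^ n * a))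
    (X_mul_torsorSeries_pow Q a) k f b
  simpa [sum_coeff_smul_torsorSeries Q a b hk] using this

theorem bev_powerSeries_X_eq_aeval (l : PowerSeries F) (p : F[X][X]) :
    bev PowerSeries.X l p = aeval l p := by
  rw [bev_eq_eval_map, eval_map, aeval_def]
  congr 1
  refine RingHom.ext fun c => ?_
  simp [PowerSeries.algebraMap_apply', aeval_powerSeries_X]

theorem exists_isSeriesRoot_dvd {l : PowerSeries F} {p : F[X][X]} (u : F) (hu : u ≠ 0)
    (hp : p.leadingCoeff = C u) (h0 : bev PowerSeries.X l p = 0) :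
    ∃ f, IsSeriesRoot f l ∧ ∀ g : F[X][X], bev PowerSeries.X l g = 0 ↔ f ∣ g := by
  have h_integral : IsIntegral F[X] l := by
    refine ⟨C (C u⁻¹) * p, ?_, ?_⟩
    · rw [Monic, leadingCoeff_mul, leadingCoeff_C, hp, ← C_mul, inv_mul_cancel₀ hu, C_1]
    · rw [← aeval_def, ← bev_powerSeries_X_eq_aeval, map_mul, h0, mul_zero]
  have : Module.IsTorsionFree F[X] (PowerSeries F) := by
    rw [Module.isTorsionFree_iff_algebraMap_injective]
    intro a b hab
    simpa [PowerSeries.algebraMap_apply'] using hab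
  have hdvd : ∀ g : F[X][X], bev PowerSeries.X l g = 0 ↔ minpoly F[X] l ∣ g := fun g => by
    rw [bev_powerSeries_X_eq_aeval, minpoly.isIntegrallyClosed_dvd_iff h_integral]
  refine ⟨minpoly F[X] l, ⟨minpoly.monic h_integral, minpoly.natDegree_pos h_integral, ?_, ?_⟩,
    hdvd⟩
  · rw [hdvd]
  · intro g hlt hg
    by_contra hne
    exact absurd (natDegree_le_of_dvd ((hdvd g).1 hg) hne) (not_le.2 hlt)

theorem exists_isSeriesRoot_torsorSeries {Q : F[X]} (hQ : Q.Monic) (hpos : 1 ≤ Q.natDegree) :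
    ∃ f, IsSeriesRoot f (torsorSeries Q 1) ∧
      ∀ g : F[X][X], bev PowerSeries.X (torsorSeries Q 1) g = 0 ↔ f ∣ g := by
  refine exists_isSeriesRoot_dvd (p := actPoly Q.natDegree Q) ((-1) ^ Q.natDegree) (by simp) ?_ ?_
  · rw [(actPoly_natDegree_leadingCoeff hQ).2]; simp
  · rw [bev_actPoly_torsorSeries Q 1 Q le_rfl, mul_one,
      (torsorSeries_eq_zero_iff hQ hpos).2 dvd_rfl, mul_zero]

end TorsorSeries

section FixedLift

variable {F : Type*} [Field F] [Fintype F] {Ω : Type*} [Field Ω] [Algebra F Ω]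

theorem exists_algebraMap_eq_of_pow_card_eq {x : Ω} (hx : x ^ Fintype.card F = x) :
    ∃ c : F, algebraMap F Ω c = x := by
  by_contra! h
  have h1 := Fintype.one_lt_card (α := F)
  have hsub : insert x (Finset.univ.image (algebraMap F Ω)) ⊆
      (X ^ Fintype.card F - X : Polynomial Ω).roots.toFinset := by
    intro y hy
    rw [Multiset.mem_toFinset, mem_roots (FiniteField.X_pow_card_sub_X_ne_zero Ω h1)]
    rcases Finset.mem_insert.1 hy with rfl | hy
    · simp [hx]
    · obtain ⟨c, -, rfl⟩ := Finset.mem_image.1 hy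
      simp [← map_pow, FiniteField.pow_card]
  have hle := (Finset.card_le_card hsub).trans
    ((Multiset.toFinset_card_le _).trans (card_roots' _))
  rw [FiniteField.X_pow_card_sub_X_natDegree_eq Ω h1, Finset.card_insert_of_notMem,
    Finset.card_image_of_injective _ (algebraMap F Ω).injective, Finset.card_univ] at hle
  · omega
  · simpa using h

variable (F) in
/-- A descent of a polynomial with coefficients in the finite field `F`. -/
def fixedLift (a : Polynomial Ω) : F[X] :=
  if h : ∃ b : F[X], b.map (algebraMap F Ω) = a then h.choose else 0

theorem map_fixedLift {a : Polynomial Ω} (ha : ∀ i, a.coeff i ^ Fintype.card F = a.coeff i) :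
    (fixedLift F a).map (algebraMap F Ω) = a := by
  have h : ∃ b : F[X], b.map (algebraMap F Ω) = a := by
    have : a ∈ lifts (algebraMap F Ω) := by
      rw [lifts_iff_coeff_lifts]
      exact fun n => exists_algebraMap_eq_of_pow_card_eq (ha n)
    exact (mem_lifts _).1 this
  rw [fixedLift, dif_pos h]
  exact h.choose_spec

theorem map_fixedLift_of_map_eq {a : Polynomial Ω}
    (ha : a.map (frobPow F Ω 1 : Ω →+* Ω) = a) :
    (fixedLift F a).map (algebraMap F Ω) = a :=
  map_fixedLift fun i => by
    conv_rhs => rw [← ha]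
    simp

theorem map_frobPow_map (r : ℕ) (b : F[X]) :
    (b.map (algebraMap F Ω)).map (frobPow F Ω r : Ω →+* Ω) = b.map (algebraMap F Ω) := by
  rw [map_map]
  congr 1
  exact (frobPow F Ω r).comp_algebraMap

variable (F Ω) in
/-- The elements of the extension of degree `r` of `F` inside `Ω`. -/
def fixFinset (r : ℕ) : Finset Ω := (X ^ Fintype.card F ^ r - X : Polynomial Ω).roots.toFinset

theorem mem_fixFinset {r : ℕ} (hr : 0 < r) {x : Ω} :
    x ∈ fixFinset F Ω r ↔ x ^ Fintype.card F ^ r = x := by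
  have h1 : 1 < Fintype.card F ^ r := Nat.one_lt_pow hr.ne' Fintype.one_lt_card
  rw [fixFinset, Multiset.mem_toFinset, mem_roots (FiniteField.X_pow_card_sub_X_ne_zero Ω h1)]
  simp [sub_eq_zero]

theorem card_fixFinset [IsAlgClosed Ω] {r : ℕ} (hr : 0 < r) :
    (fixFinset F Ω r).card = Fintype.card F ^ r := by
  have h1 : 1 < Fintype.card F ^ r := Nat.one_lt_pow hr.ne' Fintype.one_lt_card
  have h2 : (Fintype.card F : Ω) = 0 := by
    rw [← map_natCast (algebraMap F Ω), FiniteField.cast_card_eq_zero, map_zero]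
  have hsep : (X ^ Fintype.card F ^ r - X : Polynomial Ω).Separable := by
    rw [separable_def']
    refine ⟨0, -1, ?_⟩
    simp [derivative_X_pow, h2, hr.ne']
  rw [fixFinset, Multiset.toFinset_card_of_nodup (nodup_roots hsep),
    IsAlgClosed.card_roots_eq_natDegree, FiniteField.X_pow_card_sub_X_natDegree_eq Ω h1]

end FixedLift

section TwistEnd

variable {F : Type*} [Field F] [Fintype F] {Ω : Type*} [Field Ω] [Algebra F Ω]

variable (F) in
/-- The operator `z ↦ (z - z ^ q) / α`. -/
def twistEnd (α : Ω) : Module.End F Ω :=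
  LinearMap.mulLeft F α⁻¹ ∘ₗ (LinearMap.id - (frobPow F Ω 1).toLinearMap)

theorem mul_twistEnd {α : Ω} (hα : α ≠ 0) (z : Ω) :
    α * twistEnd F α z = z - z ^ Fintype.card F := by
  simp [twistEnd, hα]

theorem mul_twistEnd_pow {α : Ω} (hα : α ≠ 0) (z : Ω) (n : ℕ) :
    α * (twistEnd F α ^ (n + 1)) z =
      (twistEnd F α ^ n) z - (twistEnd F α ^ n) z ^ Fintype.card F := by
  rw [pow_succ', Module.End.mul_apply, mul_twistEnd hα]

theorem aeval_twistEnd_apply (α z : Ω) (b : F[X]) {k : ℕ} (hk : b.natDegree ≤ k) :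
    aeval (twistEnd F α) b z = ∑ i ∈ Finset.range (k + 1), b.coeff i • (twistEnd F α ^ i) z := by
  rw [aeval_eq_sum_range' (Nat.lt_succ_of_le hk), LinearMap.sum_apply]
  rfl

theorem bev_actPoly_twistEnd {α : Ω} (hα : α ≠ 0) (z : Ω) (b : F[X]) {k : ℕ}
    (hk : b.natDegree ≤ k) :
    bev α z (actPoly k b) = α ^ geomExp (Fintype.card F) k * aeval (twistEnd F α) b z := by
  have := bev_actPoly (F := F) α (fun n => (twistEnd F α ^ n) z) (mul_twistEnd_pow hα z) k b
  rw [aeval_twistEnd_apply α z b hk]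
  simpa using this

theorem bev_compPoly_twistEnd {α : Ω} (hα : α ≠ 0) (z : Ω) (b : F[X]) {k : ℕ}
    (hk : b.natDegree ≤ k) (f : F[X][X]) :
    bev α z (compPoly k f b) = α ^ (geomExp (Fintype.card F) k * f.natDegree) *
      bev α (aeval (twistEnd F α) b z) f := by
  have := bev_compPoly (F := F) α (fun n => (twistEnd F α ^ n) z) (mul_twistEnd_pow hα z) k f b
  rw [aeval_twistEnd_apply α z b hk]
  simpa using this

/-- The evaluation of a polynomial with coefficients on the left along a sequence. -/
def seqEval (z : ℕ → Ω) (a : Polynomial Ω) : Ω := a.sum fun i c => c * z i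

theorem seqEval_eq_sum (z : ℕ → Ω) (a : Polynomial Ω) {n : ℕ} (hn : a.natDegree < n) :
    seqEval z a = ∑ i ∈ Finset.range n, a.coeff i * z i :=
  sum_over_range' a (by simp) n hn

theorem seqEval_one_sub_mul_map {α : Ω} {z : ℕ → Ω}
    (hz : ∀ n, α * z (n + 1) = z n - z n ^ Fintype.card F) (a : Polynomial Ω) :
    seqEval z ((1 - C α * X) * a.map (frobPow F Ω 1 : Ω →+* Ω)) = seqEval z a ^ Fintype.card F := by
  have hadd : ∀ a b : Polynomial Ω, seqEval z (a + b) = seqEval z a + seqEval z b := fun a b =>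
    sum_add_index a b _ (by simp) (by intros; ring)
  have hpow : ∀ x y : Ω, (x + y) ^ Fintype.card F = x ^ Fintype.card F + y ^ Fintype.card F := by
    intro x y
    simpa using map_add (frobPow F Ω 1) x y
  induction a using Polynomial.induction_on' with
  | add a b ha hb => rw [Polynomial.map_add, mul_add, hadd, hadd, ha, hb, hpow]
  | monomial n c =>
    have e : (1 - C α * X) * (monomial n c).map (frobPow F Ω 1 : Ω →+* Ω) =
        monomial n (c ^ Fintype.card F) + monomial (n + 1) (-(α * c ^ Fintype.card F)) := by
      rw [map_monomial, ← C_mul_X_pow_eq_monomial, ← C_mul_X_pow_eq_monomial,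
        ← C_mul_X_pow_eq_monomial]
      simp
      ring
    rw [e, hadd]
    have hmon : ∀ (m : ℕ) (d : Ω), seqEval z (monomial m d) = d * z m := fun m d =>
      sum_monomial_index _ _ (zero_mul _)
    rw [hmon, hmon, hmon, mul_pow]
    linear_combination (-c ^ Fintype.card F) * hz n

variable (F) in
/-- The product of `1 - α ^ (q ^ j) * X` for `j < r`. -/
def invNormPoly (r : ℕ) (α : Ω) : Polynomial Ω :=
  ∏ j ∈ Finset.range r, (1 - C (α ^ Fintype.card F ^ j) * X)

theorem invNormPoly_succ (r : ℕ) (α : Ω) :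
    invNormPoly F (r + 1) α =
      (1 - C α * X) * (invNormPoly F r α).map (frobPow F Ω 1 : Ω →+* Ω) := by
  rw [invNormPoly, Finset.prod_range_succ', pow_zero, pow_one, mul_comm, invNormPoly,
    Polynomial.map_prod]
  congr 1
  refine Finset.prod_congr rfl fun j _ => ?_
  simp [pow_succ, ← pow_mul, mul_comm]

theorem seqEval_invNormPoly {α : Ω} {z : ℕ → Ω}
    (hz : ∀ n, α * z (n + 1) = z n - z n ^ Fintype.card F) (r : ℕ) :
    seqEval z (invNormPoly F r α) = z 0 ^ Fintype.card F ^ r := by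
  induction r with
  | zero => rw [seqEval_eq_sum z _ (n := 1) (by simp [invNormPoly])]; simp [invNormPoly]
  | succ r ih => rw [invNormPoly_succ, seqEval_one_sub_mul_map hz, ih, ← pow_mul, pow_succ]

theorem map_invNormPoly {α : Ω} {r : ℕ} (hα : α ^ Fintype.card F ^ r = α) :
    (invNormPoly F r α).map (frobPow F Ω 1 : Ω →+* Ω) = invNormPoly F r α := by
  have h0 : (1 - C α * X : Polynomial Ω) ≠ 0 := fun h => by
    have := congrArg (eval 0) h
    simp at this
  refine mul_left_cancel₀ h0 ?_
  rw [← invNormPoly_succ, invNormPoly, Finset.prod_range_succ, hα, mul_comm]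
  rfl

theorem map_fixedLift_invNormPoly {α : Ω} {r : ℕ} (hα : α ^ Fintype.card F ^ r = α) :
    (fixedLift F (invNormPoly F r α)).map (algebraMap F Ω) = invNormPoly F r α :=
  map_fixedLift_of_map_eq (map_invNormPoly hα)

theorem aeval_twistEnd_invNormPoly {α : Ω} (hα : α ≠ 0) {r : ℕ} (hr : α ^ Fintype.card F ^ r = α)
    (z : Ω) :
    aeval (twistEnd F α) (fixedLift F (invNormPoly F r α)) z = z ^ Fintype.card F ^ r := by
  have h := seqEval_invNormPoly (F := F) (z := fun n => (twistEnd F α ^ n) z)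
    (mul_twistEnd_pow hα z) r
  beta_reduce at h
  rw [pow_zero, Module.End.one_apply] at h
  have hm := map_fixedLift_invNormPoly (F := F) hr
  have hd : (fixedLift F (invNormPoly F r α)).natDegree = (invNormPoly F r α).natDegree := by
    conv_rhs => rw [← hm, natDegree_map]
  rw [← h, aeval_twistEnd_apply α z _ hd.le, seqEval_eq_sum _ _ (Nat.lt_succ_self _)]
  refine Finset.sum_congr rfl fun i _ => ?_
  rw [Algebra.smul_def, ← coeff_map, hm]

end TwistEnd

section PolyLT

variable (F : Type*) [Field F] [Fintype F]

/-- The polynomials of degree less than `n`. -/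
def polyLT (n : ℕ) : Finset F[X] :=
  Finset.univ.image fun c : Fin n → F => (((degreeLTEquiv F n).symm c : degreeLT F n) : F[X])

variable {F}

theorem mem_polyLT {n : ℕ} {f : F[X]} : f ∈ polyLT F n ↔ f.degree < n := by
  rw [polyLT, Finset.mem_image]
  constructor
  · rintro ⟨c, -, rfl⟩
    exact mem_degreeLT.1 (((degreeLTEquiv F n).symm c).2)
  · intro h
    refine ⟨degreeLTEquiv F n ⟨f, mem_degreeLT.2 h⟩, Finset.mem_univ _, ?_⟩
    rw [LinearEquiv.symm_apply_apply]

theorem card_polyLT (n : ℕ) : (polyLT F n).card = Fintype.card F ^ n := by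
  rw [polyLT, Finset.card_image_of_injective, Finset.card_univ, Fintype.card_pi_const]
  exact Subtype.val_injective.comp (degreeLTEquiv F n).symm.injective

end PolyLT

section Fibers

variable {F : Type*} [Field F] [Fintype F] {Q : F[X]} {f : F[X][X]}

theorem torsorSeries_modByMonic (hQ : Q.Monic) (hpos : 1 ≤ Q.natDegree) (b : F[X]) :
    torsorSeries Q (b %ₘ Q) = torsorSeries Q b := by
  conv_rhs => rw [← modByMonic_add_div b Q, map_add,
    (torsorSeries_eq_zero_iff hQ hpos).2 (dvd_mul_right Q _), add_zero]

theorem bev_torsorSeries_mul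
    (hfd : ∀ g : F[X][X], bev PowerSeries.X (torsorSeries Q 1) g = 0 ↔ f ∣ g)
    {a b : F[X]} (ha : bev PowerSeries.X (torsorSeries Q a) f = 0)
    (hb : bev PowerSeries.X (torsorSeries Q b) f = 0) :
    bev PowerSeries.X (torsorSeries Q (b * a)) f = 0 := by
  have h1 : f ∣ compPoly b.natDegree f b := by
    rw [← hfd, bev_compPoly_torsorSeries Q 1 b le_rfl, mul_one, hb, mul_zero]
  have h2 : bev PowerSeries.X (torsorSeries Q a) (compPoly b.natDegree f b) = 0 := by
    obtain ⟨g, hg⟩ := h1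
    rw [hg, map_mul, ha, zero_mul]
  rw [bev_compPoly_torsorSeries Q a b le_rfl] at h2
  exact (mul_eq_zero.1 h2).resolve_left (pow_ne_zero _ PowerSeries.X_ne_zero)

theorem dvd_of_dvd_mul_of_bev_torsorSeries (hQ : Q.Monic) (hpos : 1 ≤ Q.natDegree)
    (hf : IsSeriesRoot f (torsorSeries Q 1))
    (hfd : ∀ g : F[X][X], bev PowerSeries.X (torsorSeries Q 1) g = 0 ↔ f ∣ g)
    {a c : F[X]} (ha : bev PowerSeries.X (torsorSeries Q a) f = 0) (h : Q ∣ c * a) : Q ∣ c := by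
  obtain ⟨f₀, h₀, hd₀⟩ := exists_isSeriesRoot_dvd (l := torsorSeries Q a) (p := f) 1 one_ne_zero
    (by rw [hf.monic.leadingCoeff, C_1]) ha
  have hprime : Prime f := by
    refine ⟨hf.monic.ne_zero, fun hu => ?_, fun g g' hgg => ?_⟩
    · have h1 := hf.pos
      rw [hf.monic.isUnit_iff.1 hu] at h1
      simp at h1
    · rw [← hfd, map_mul, mul_eq_zero] at hgg
      rwa [← hfd, ← hfd]
  have hff : f ∣ f₀ := by
    obtain ⟨u, hu⟩ := (hd₀ f).1 ha
    rcases hprime.irreducible.isUnit_or_isUnit hu with hu0 | hu0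
    · have h1 := h₀.pos
      rw [h₀.monic.isUnit_iff.1 hu0] at h1
      simp at h1
    · exact ⟨_, by rw [hu, mul_assoc, IsUnit.mul_val_inv hu0, mul_one]⟩
  have h2 : f₀ ∣ actPoly c.natDegree c := by
    rw [← hd₀, bev_actPoly_torsorSeries Q a c le_rfl, (torsorSeries_eq_zero_iff hQ hpos).2 h,
      mul_zero]
  have h3 := (hfd _).2 (hff.trans h2)
  rw [bev_actPoly_torsorSeries Q 1 c le_rfl, mul_one] at h3
  exact (torsorSeries_eq_zero_iff hQ hpos).1
    ((mul_eq_zero.1 h3).resolve_left (pow_ne_zero _ PowerSeries.X_ne_zero))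

variable (Q f) in
/-- The residues `b` for which the series attached to `b` is conjugate to that of `1`. -/
def conjResidues : Finset F[X] :=
  (polyLT F Q.natDegree).filter fun b => bev PowerSeries.X (torsorSeries Q b) f = 0

theorem card_conjResidues_le (hQ : Q.Monic) (hpos : 1 ≤ Q.natDegree)
    (hf : IsSeriesRoot f (torsorSeries Q 1)) : (conjResidues Q f).card ≤ f.natDegree := by
  set φ : F[X] →+* PowerSeries F :=
    (aeval PowerSeries.X : F[X] →ₐ[F] PowerSeries F).toRingHom with hφ
  have hmon : (f.map φ).Monic := hf.monic.map φ
  have hinj : Set.InjOn (torsorSeries Q) (conjResidues Q f : Set F[X]) := by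
    intro a ha b hb hab
    have ha' := mem_polyLT.1 (Finset.mem_filter.1 ha).1
    have hb' := mem_polyLT.1 (Finset.mem_filter.1 hb).1
    have h0 : Q ∣ a - b := by
      rw [← torsorSeries_eq_zero_iff hQ hpos, map_sub, hab, sub_self]
    refine sub_eq_zero.1 (eq_zero_of_dvd_of_degree_lt h0 ((degree_sub_le _ _).trans_lt ?_))
    rw [degree_eq_natDegree hQ.ne_zero]
    exact max_lt ha' hb'
  rw [← Finset.card_image_of_injOn hinj]
  calc _ ≤ (f.map φ).roots.toFinset.card := by
        refine Finset.card_le_card fun l hl => ?_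
        obtain ⟨b, hb, rfl⟩ := Finset.mem_image.1 hl
        rw [Multiset.mem_toFinset, mem_roots hmon.ne_zero, IsRoot, ← bev_eq_eval_map]
        exact (Finset.mem_filter.1 hb).2
    _ ≤ (f.map φ).natDegree := (Multiset.toFinset_card_le _).trans (card_roots' _)
    _ = f.natDegree := hf.monic.natDegree_map φ

theorem actDisc_ne_zero (hQ : Q.Monic) : actDisc Q.natDegree Q ≠ 0 := by
  intro h
  have hc := le_geomExp (q := Fintype.card F) Fintype.card_pos Q.natDegree
  have := congrArg (fun p => coeff p (geomExp (Fintype.card F) Q.natDegree - Q.natDegree)) h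
  simp only [actDisc, finsetSum_coeff, coeff_C_mul, coeff_X_pow, coeff_zero] at this
  rw [Finset.sum_eq_single Q.natDegree] at this
  · simp [hQ.leadingCoeff] at this
  · intro i hi hne
    have := Finset.mem_range.1 hi
    rw [if_neg (by omega), mul_zero]
  · intro h; simp at h

variable {Ω : Type*} [Field Ω] [Algebra F Ω]

theorem exists_fiber [IsAlgClosed Ω] (hf : f.Monic) (hfQ : f ∣ actPoly Q.natDegree Q) {α : Ω}
    (hα : α ≠ 0) (hδ : aeval α (actDisc Q.natDegree Q) ≠ 0) :
    ∃ Z : Finset Ω, Z.card = f.natDegree ∧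
      ∀ z ∈ Z, bev α z f = 0 ∧ aeval (twistEnd F α) Q z = 0 := by
  set φ : F[X] →+* Ω := (aeval α : F[X] →ₐ[F] Ω).toRingHom with hφ
  have hmon : (f.map φ).Monic := hf.map φ
  have hsep : (f.map φ).Separable := by
    have hd : f.map φ ∣ (actPoly Q.natDegree Q).map φ := by
      obtain ⟨g, hg⟩ := hfQ
      exact ⟨g.map φ, by rw [← Polynomial.map_mul, ← hg]⟩
    refine Separable.of_dvd ?_ hd
    rw [separable_def, derivative_map, derivative_actPoly, map_C]
    have hδ' : φ (actDisc Q.natDegree Q) ≠ 0 := hδ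
    refine ⟨0, C (φ (actDisc Q.natDegree Q))⁻¹, ?_⟩
    rw [zero_mul, zero_add, ← C_mul, inv_mul_cancel₀ hδ', C_1]
  refine ⟨(f.map φ).roots.toFinset, ?_, fun z hz => ?_⟩
  · rw [Multiset.toFinset_card_of_nodup (nodup_roots hsep), IsAlgClosed.card_roots_eq_natDegree,
      hf.natDegree_map]
  · rw [Multiset.mem_toFinset, mem_roots hmon.ne_zero, IsRoot, ← bev_eq_eval_map] at hz
    refine ⟨hz, ?_⟩
    have h1 : bev α z (actPoly Q.natDegree Q) = 0 := by
      obtain ⟨g, hg⟩ := hfQ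
      rw [hg, map_mul, hz, zero_mul]
    rw [bev_actPoly_twistEnd hα z Q le_rfl] at h1
    exact (mul_eq_zero.1 h1).resolve_left (pow_ne_zero _ hα)

variable (Q) in
/-- `α` is a good point of level `r` with residue `b`. -/
def IsGoodPoint (r : ℕ) (b : F[X]) (α : Ω) : Prop :=
  α ^ Fintype.card F ^ r = α ∧ α ≠ 0 ∧ aeval α (actDisc Q.natDegree Q) ≠ 0 ∧
    fixedLift F (invNormPoly F r α) %ₘ Q = b

theorem IsGoodPoint.exists_fiber [IsAlgClosed Ω] (hf : f.Monic)
    (hfQ : f ∣ actPoly Q.natDegree Q) {r : ℕ} {b : F[X]} {α : Ω} (h : IsGoodPoint Q r b α) :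
    ∃ Z : Finset Ω, Z.card = f.natDegree ∧ ∀ z ∈ Z, bev α z f = 0 ∧
      aeval (twistEnd F α) b z = z ^ Fintype.card F ^ r := by
  obtain ⟨hr, hα, hδ, hb⟩ := h
  obtain ⟨Z, hZ, hz⟩ := _root_.exists_fiber hf hfQ hα hδ
  refine ⟨Z, hZ, fun z hzZ => ⟨(hz z hzZ).1, ?_⟩⟩
  rw [← aeval_twistEnd_invNormPoly hα hr, ← hb]
  conv_rhs => rw [← modByMonic_add_div (fixedLift F (invNormPoly F r α)) Q, mul_comm Q, map_add,
    map_mul, LinearMap.add_apply, Module.End.mul_apply, (hz z hzZ).2, map_zero, add_zero]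

theorem card_goodPoints_le [IsAlgClosed Ω] (hf : IsSeriesRoot f (torsorSeries Q 1))
    (hfQ : f ∣ actPoly Q.natDegree Q) {b : F[X]} (hb : b.natDegree ≤ Q.natDegree) :
    ∃ K : ℕ, ∀ (r : ℕ) (A : Finset Ω), 0 < r → (∀ α ∈ A, IsGoodPoint Q (2 * r) b α) →
      A.card * f.natDegree ≤ Fintype.card F ^ (2 * r) + K * Fintype.card F ^ r := by
  obtain ⟨K, hK⟩ := stepanov (Ω := Ω) hf (actPoly Q.natDegree b)
    (X ^ geomExp (Fintype.card F) Q.natDegree)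
  refine ⟨K, fun r A hr hA => hK r A hr fun α hα => ?_⟩
  obtain ⟨Z, hZ, hz⟩ := (hA α hα).exists_fiber hf.monic hfQ
  have h0 := (hA α hα).2.1
  refine ⟨(hA α hα).1, by simp [h0], Z, hZ, fun z hzZ => ⟨(hz z hzZ).1, ?_⟩⟩
  rw [bev_actPoly_twistEnd h0 z b hb, (hz z hzZ).2]
  simp

theorem card_goodPoints_le_of_bev_ne_zero [IsAlgClosed Ω]
    (hf : IsSeriesRoot f (torsorSeries Q 1))
    (hfQ : f ∣ actPoly Q.natDegree Q) {b : F[X]}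
    (hb0 : bev PowerSeries.X (torsorSeries Q b) f ≠ 0) :
    ∃ K : ℕ, ∀ (r : ℕ) (A : Finset Ω), (∀ α ∈ A, IsGoodPoint Q r b α) → A.card ≤ K := by
  set t := compPoly b.natDegree f b %ₘ f with ht
  have ht0 : t ≠ 0 := by
    intro h
    have h1 := hf.bev_modByMonic (compPoly b.natDegree f b)
    rw [← ht, h, map_zero, bev_compPoly_torsorSeries Q 1 b le_rfl, mul_one] at h1
    exact hb0 ((mul_eq_zero.1 h1.symm).resolve_left (pow_ne_zero _ PowerSeries.X_ne_zero))
  obtain ⟨i, hi⟩ : ∃ i, t.coeff i ≠ 0 := by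
    by_contra! h
    exact ht0 (Polynomial.ext (by simpa using h))
  refine ⟨(t.coeff i).natDegree, fun r A hA =>
    card_le_natDegree_of_aeval_eq_zero hi A fun α hα => ?_⟩
  obtain ⟨Z, hZ, hz⟩ := (hA α hα).exists_fiber hf.monic hfQ
  have h0 := (hA α hα).2.1
  set φ : F[X] →+* Ω := (aeval α : F[X] →ₐ[F] Ω).toRingHom with hφ
  have hmap : t.map φ = 0 := by
    refine eq_zero_of_natDegree_lt_card_of_eval_eq_zero' _ Z (fun z hzZ => ?_) ?_
    · rw [← bev_eq_eval_map]
      have h1 : bev α z (compPoly b.natDegree f b) = 0 := by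
        rw [bev_compPoly_twistEnd h0 z b le_rfl, (hz z hzZ).2]
        have h2 := map_bev (frobPow F Ω r) α z f
        rw [(hz z hzZ).1, map_zero, frobPow_apply, frobPow_apply, (hA α hα).1] at h2
        rw [← h2, mul_zero]
      rw [← modByMonic_add_div (compPoly b.natDegree f b) f, map_add, map_mul, (hz z hzZ).1,
        zero_mul, add_zero] at h1
      exact h1
    · rw [hZ]
      exact (natDegree_map_le).trans_lt (hf.natDegree_modByMonic _)
  have := congrArg (fun p => coeff p i) hmap
  rwa [coeff_map, coeff_zero] at this

end Fibers

section Dichotomy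

variable {F : Type*} [Field F] [Fintype F] {Ω : Type*} [Field Ω] [Algebra F Ω]

theorem coeff_zero_fixedLift_invNormPoly {α : Ω} {r : ℕ} (hα : α ^ Fintype.card F ^ r = α) :
    (fixedLift F (invNormPoly F r α)).coeff 0 = 1 := by
  apply (algebraMap F Ω).injective
  rw [← coeff_map, map_fixedLift_invNormPoly hα, map_one, invNormPoly, coeff_zero_prod]
  simp

theorem norm_sum_sub_mul_le {ι : Type*} (s : Finset ι) (a u : ι → ℂ) (c : ℂ) {B : ℝ}
    (ha : ∀ i ∈ s, ‖a i - c‖ ≤ B) (hu : ∀ i ∈ s, ‖u i‖ ≤ 1) :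
    ‖∑ i ∈ s, a i * u i - c * ∑ i ∈ s, u i‖ ≤ s.card * B := by
  rw [Finset.mul_sum, ← Finset.sum_sub_distrib]
  refine (norm_sum_le _ _).trans ?_
  rw [← nsmul_eq_mul, ← Finset.sum_const]
  refine Finset.sum_le_sum fun i hi => ?_
  rw [← sub_mul, norm_mul]
  have := ha i hi
  nlinarith [norm_nonneg (a i - c), norm_nonneg (u i), hu i hi]

/-- The good points of level `r` with residue `b`. -/
def goodPoints (Ω : Type*) [Field Ω] [Algebra F Ω] (Q : F[X]) (r : ℕ) (b : F[X]) : Finset Ω :=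
  (fixFinset F Ω r).filter (IsGoodPoint Q r b)

theorem card_fibers_bounds [IsAlgClosed Ω] {Q : F[X]} (hQ : Q.Monic) (hpos : 1 ≤ Q.natDegree)
    {f : F[X][X]} (hf : IsSeriesRoot f (torsorSeries Q 1))
    (hfd : ∀ g : F[X][X], bev PowerSeries.X (torsorSeries Q 1) g = 0 ↔ f ∣ g) :
    ∃ K : ℕ, ∀ r : ℕ, 0 < r →
      ((fixFinset F Ω (2 * r)).filter fun α => ∀ b ∈ conjResidues Q f,
        ¬ IsGoodPoint Q (2 * r) b α).card ≤ K ∧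
      ∀ b ∈ conjResidues Q f, (goodPoints Ω Q (2 * r) b).card * f.natDegree ≤
        Fintype.card F ^ (2 * r) + K * Fintype.card F ^ r := by
  have hfQ : f ∣ actPoly Q.natDegree Q := by
    rw [← hfd, bev_actPoly_torsorSeries Q 1 Q le_rfl, mul_one,
      (torsorSeries_eq_zero_iff hQ hpos).2 dvd_rfl, mul_zero]
  have h1 : ∀ b : F[X], ∃ K : ℕ, (b ∈ conjResidues Q f → ∀ (r : ℕ), 0 < r →
      (goodPoints Ω Q (2 * r) b).card * f.natDegree ≤
        Fintype.card F ^ (2 * r) + K * Fintype.card F ^ r) ∧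
      (b ∈ polyLT F Q.natDegree → b ∉ conjResidues Q f → ∀ r : ℕ,
        (goodPoints Ω Q (2 * r) b).card ≤ K) := by
    intro b
    by_cases hb : b ∈ conjResidues Q f
    · have hb' := mem_polyLT.1 (Finset.mem_filter.1 hb).1
      obtain ⟨K, hK⟩ := card_goodPoints_le (Ω := Ω) hf hfQ
        (natDegree_le_of_degree_le hb'.le)
      exact ⟨K, fun _ r hr => hK r _ hr fun α hα => (Finset.mem_filter.1 hα).2,
        fun _ h => absurd hb h⟩
    · by_cases hb' : b ∈ polyLT F Q.natDegree
      · obtain ⟨K, hK⟩ := card_goodPoints_le_of_bev_ne_zero (Ω := Ω) hf hfQ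
          (b := b) fun h => hb (Finset.mem_filter.2 ⟨hb', h⟩)
        exact ⟨K, fun h => absurd h hb, fun _ _ r =>
          hK (2 * r) _ fun α hα => (Finset.mem_filter.1 hα).2⟩
      · exact ⟨0, fun h => absurd h hb, fun h => absurd h hb'⟩
  choose K hK1 hK2 using h1
  set S := ∑ b ∈ polyLT F Q.natDegree, K b with hS
  set d := (X * actDisc Q.natDegree Q).natDegree with hd
  have hd0 : X * actDisc Q.natDegree Q ≠ 0 := mul_ne_zero X_ne_zero (actDisc_ne_zero hQ)
  refine ⟨d + S, fun r hr => ⟨?_, fun b hb => ?_⟩⟩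
  · set bad := (fixFinset F Ω (2 * r)).filter fun α =>
      aeval α (X * actDisc Q.natDegree Q) = 0 with hbad
    have hsub : ((fixFinset F Ω (2 * r)).filter fun α => ∀ b ∈ conjResidues Q f,
        ¬ IsGoodPoint Q (2 * r) b α) ⊆ bad ∪
        ((polyLT F Q.natDegree).filter fun b => b ∉ conjResidues Q f).biUnion
          fun b => goodPoints Ω Q (2 * r) b := by
      intro α hα
      obtain ⟨hα1, hα2⟩ := Finset.mem_filter.1 hα
      rw [Finset.mem_union, or_iff_not_imp_left]
      intro hnb
      have hne : aeval α (X * actDisc Q.natDegree Q) ≠ 0 := fun h =>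
        hnb (Finset.mem_filter.2 ⟨hα1, h⟩)
      rw [map_mul, aeval_X] at hne
      have hgood : IsGoodPoint Q (2 * r) (fixedLift F (invNormPoly F (2 * r) α) %ₘ Q) α :=
        ⟨(mem_fixFinset (by omega)).1 hα1, left_ne_zero_of_mul hne, right_ne_zero_of_mul hne, rfl⟩
      refine Finset.mem_biUnion.2 ⟨_, Finset.mem_filter.2 ⟨?_, fun h => hα2 _ h hgood⟩,
        Finset.mem_filter.2 ⟨hα1, hgood⟩⟩
      rw [mem_polyLT, ← degree_eq_natDegree hQ.ne_zero]
      exact degree_modByMonic_lt _ hQ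
    refine (Finset.card_le_card hsub).trans ((Finset.card_union_le _ _).trans (add_le_add ?_ ?_))
    · exact card_le_natDegree_of_aeval_eq_zero hd0 bad fun α hα => (Finset.mem_filter.1 hα).2
    · refine Finset.card_biUnion_le.trans ((Finset.sum_le_sum fun b hb =>
        hK2 b (Finset.mem_filter.1 hb).1 (Finset.mem_filter.1 hb).2 r).trans ?_)
      exact Finset.sum_le_sum_of_subset (Finset.filter_subset _ _)
  · refine (hK1 b hb r hr).trans ?_
    have : K b ≤ S := Finset.single_le_sum (f := K) (fun _ _ => Nat.zero_le _)
      (Finset.mem_filter.1 hb).1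
    gcongr
    omega

theorem abs_card_goodPoints_sub_le [IsAlgClosed Ω] {Q : F[X]} (hQ : Q.Monic)
    (hpos : 1 ≤ Q.natDegree)
    {f : F[X][X]} (hf : IsSeriesRoot f (torsorSeries Q 1))
    (hfd : ∀ g : F[X][X], bev PowerSeries.X (torsorSeries Q 1) g = 0 ↔ f ∣ g) :
    ∃ K : ℝ, 0 ≤ K ∧ ∀ r : ℕ, 0 < r →
      ((((fixFinset F Ω (2 * r)).filter fun α => ∀ b ∈ conjResidues Q f,
        ¬ IsGoodPoint Q (2 * r) b α).card : ℕ) : ℝ) ≤ K ∧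
      ∀ b ∈ conjResidues Q f, |((goodPoints Ω Q (2 * r) b).card : ℝ) * f.natDegree -
        (Fintype.card F : ℝ) ^ (2 * r)| ≤ K * (Fintype.card F : ℝ) ^ r := by
  obtain ⟨K, hK⟩ := card_fibers_bounds (Ω := Ω) hQ hpos hf hfd
  set E := f.natDegree with hE
  refine ⟨(E + 1) * K + E * K, by positivity, fun r hr => ?_⟩
  obtain ⟨h1, h2⟩ := hK r hr
  set q : ℝ := (Fintype.card F : ℝ) with hq
  have hq1 : 1 ≤ q ^ r := one_le_pow₀ (by rw [hq]; exact_mod_cast Fintype.card_pos)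
  have hE1 : (1 : ℝ) ≤ E := by exact_mod_cast hf.pos
  have hK0 : (0 : ℝ) ≤ K := Nat.cast_nonneg K
  have h1' : ((((fixFinset F Ω (2 * r)).filter fun α => ∀ b ∈ conjResidues Q f,
        ¬ IsGoodPoint Q (2 * r) b α).card : ℕ) : ℝ) ≤ K := by exact_mod_cast h1
  have h2' : ∀ b ∈ conjResidues Q f, ((goodPoints Ω Q (2 * r) b).card : ℝ) * E ≤
      q ^ (2 * r) + K * q ^ r := fun b hb => by
    have := h2 b hb
    rw [hq]
    exact_mod_cast this
  refine ⟨h1'.trans (by nlinarith), fun b hb => ?_⟩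
  have htot : q ^ (2 * r) ≤ ∑ b ∈ conjResidues Q f, ((goodPoints Ω Q (2 * r) b).card : ℝ) + K := by
    have h3 : (fixFinset F Ω (2 * r)).card ≤ (((fixFinset F Ω (2 * r)).filter fun α =>
        ∀ b ∈ conjResidues Q f, ¬ IsGoodPoint Q (2 * r) b α) ∪
        (conjResidues Q f).biUnion fun b => goodPoints Ω Q (2 * r) b).card := by
      refine Finset.card_le_card fun α hα => ?_
      rw [Finset.mem_union, or_iff_not_imp_left, Finset.mem_filter, not_and]
      intro h
      have := h hα
      push Not at this
      obtain ⟨b, hb, hg⟩ := this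
      exact Finset.mem_biUnion.2 ⟨b, hb, Finset.mem_filter.2 ⟨hα, hg⟩⟩
    rw [card_fixFinset (by omega)] at h3
    have h4 := h3.trans ((Finset.card_union_le _ _).trans (add_le_add h1 Finset.card_biUnion_le))
    have h5 : ((Fintype.card F ^ (2 * r) : ℕ) : ℝ) ≤
      ((K + ∑ b ∈ conjResidues Q f, (goodPoints Ω Q (2 * r) b).card : ℕ) : ℝ) := by
      exact_mod_cast h4
    push_cast at h5
    linarith
  have hrest : ∑ b' ∈ (conjResidues Q f).erase b, ((goodPoints Ω Q (2 * r) b').card : ℝ) * E ≤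
      ((E : ℝ) - 1) * (q ^ (2 * r) + K * q ^ r) := by
    refine (Finset.sum_le_card_nsmul _ _ _ fun b' hb' =>
      h2' b' (Finset.mem_of_mem_erase hb')).trans ?_
    rw [nsmul_eq_mul]
    refine mul_le_mul_of_nonneg_right ?_ (by positivity)
    rw [Finset.card_erase_of_mem hb, Nat.cast_sub (Finset.card_pos.2 ⟨b, hb⟩), Nat.cast_one]
    have : ((conjResidues Q f).card : ℝ) ≤ E := by
      exact_mod_cast card_conjResidues_le hQ hpos hf
    linarith
  rw [← Finset.sum_mul] at hrest
  have hsplit := Finset.add_sum_erase (conjResidues Q f)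
    (fun b' => ((goodPoints Ω Q (2 * r) b').card : ℝ)) hb
  have hb2 := h2' b hb
  rw [← hsplit] at htot
  set s := ∑ b' ∈ (conjResidues Q f).erase b, ((goodPoints Ω Q (2 * r) b').card : ℝ)
  set a := ((goodPoints Ω Q (2 * r) b).card : ℝ)
  have h6 := mul_le_mul_of_nonneg_left htot (by linarith : (0 : ℝ) ≤ E)
  have h7 : (E : ℝ) * K ≤ E * K * q ^ r := by
    have : 0 ≤ (E : ℝ) * K := by positivity
    nlinarith
  have h8 : 0 ≤ K * q ^ r := by positivity
  have h9 : 0 ≤ E * (K * q ^ r) := by positivity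
  rw [abs_le]
  constructor <;> nlinarith

end Dichotomy

section Dichotomy

variable {F : Type*} [Field F] [Fintype F] {Ω : Type*} [Field Ω] [Algebra F Ω]

/-- The sum of `Ψ` over the norms of the elements of level `r`. -/
def levelSum (Ω : Type*) [Field Ω] [Algebra F Ω] (Ψ : F[X] → ℂ) (r : ℕ) : ℂ :=
  ∑ α ∈ fixFinset F Ω r, Ψ (fixedLift F (invNormPoly F r α))

theorem levelSum_dichotomy [IsAlgClosed Ω] {Q : F[X]} (hQ : Q.Monic) (hpos : 1 ≤ Q.natDegree)
    (Ψ : F[X] → ℂ)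
    (hmul : ∀ g h : F[X], g.coeff 0 = 1 → h.coeff 0 = 1 → Ψ (g * h) = Ψ g * Ψ h)
    (hper : ∀ g h : F[X], g.coeff 0 = 1 → h.coeff 0 = 1 → Q ∣ g - h → Ψ g = Ψ h)
    (hle : ∀ g, ‖Ψ g‖ ≤ 1) :
    ∃ C : ℝ, 0 ≤ C ∧
      ((∀ r : ℕ, 0 < r → ‖levelSum Ω Ψ (2 * r)‖ ≤ C * (Fintype.card F : ℝ) ^ r) ∨
        (∀ r : ℕ, 0 < r → ‖levelSum Ω Ψ (2 * r) - (Fintype.card F : ℂ) ^ (2 * r)‖ ≤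
          C * (Fintype.card F : ℝ) ^ r)) := by
  obtain ⟨f, hf, hfd⟩ := exists_isSeriesRoot_torsorSeries hQ hpos
  obtain ⟨K, hK0, hK⟩ := abs_card_goodPoints_sub_le (Ω := Ω) hQ hpos hf hfd
  set H := conjResidues Q f with hH
  set E := f.natDegree with hE
  set q : ℝ := (Fintype.card F : ℝ) with hq
  have hq2 : 1 < q := by rw [hq]; exact_mod_cast Fintype.one_lt_card
  have hE1 : (1 : ℝ) ≤ E := by exact_mod_cast hf.pos
  -- a level at which every conjugate residue is attained
  obtain ⟨r₀, hr₀⟩ := pow_unbounded_of_one_lt K hq2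
  have hr₀' : K < q ^ (r₀ + 1) := hr₀.trans_le (pow_le_pow_right₀ hq2.le (Nat.le_succ _))
  have hex : ∀ b, b ∈ H → ∃ g : F[X], g.coeff 0 = 1 ∧ g %ₘ Q = b := by
    intro b hb
    have h1 := (hK (r₀ + 1) (Nat.succ_pos _)).2 b hb
    have h2 : 0 < (goodPoints Ω Q (2 * (r₀ + 1)) b).card := by
      by_contra! h
      rw [Nat.le_zero] at h
      rw [h, Nat.cast_zero, zero_mul, zero_sub, abs_neg, abs_of_nonneg (by positivity), two_mul,
        pow_add] at h1
      have : (0 : ℝ) < q ^ (r₀ + 1) := by positivity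
      nlinarith
    obtain ⟨α, hα⟩ := Finset.card_pos.1 h2
    have hg := (Finset.mem_filter.1 hα).2
    exact ⟨_, coeff_zero_fixedLift_invNormPoly hg.1, hg.2.2.2⟩
  choose! g hg0 hgb using hex
  have hperm : ∀ g h : F[X], g.coeff 0 = 1 → h.coeff 0 = 1 → g %ₘ Q = h %ₘ Q → Ψ g = Ψ h := by
    intro g h hg hh e
    refine hper g h hg hh ?_
    rw [← modByMonic_eq_zero_iff_dvd hQ, sub_modByMonic, e, sub_self]
  -- the main decomposition
  have hdec' : ∀ r, 0 < r → ∀ (Θ : Ω → ℂ) (c : F[X] → ℂ), (∀ α, ‖Θ α‖ ≤ 1) →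
      (∀ b ∈ H, ∀ α ∈ goodPoints Ω Q (2 * r) b, Θ α = c b) →
      ‖∑ α ∈ fixFinset F Ω (2 * r), Θ α -
        ∑ b ∈ H, ((goodPoints Ω Q (2 * r) b).card : ℂ) * c b‖ ≤ K := by
    intro r hr Θ c hΘ hc
    have hdisj : Set.PairwiseDisjoint (H : Set F[X]) fun b => goodPoints Ω Q (2 * r) b := by
      intro b hb b' hb' hne
      refine Finset.disjoint_left.2 fun α h1 h2 => hne ?_
      rw [← (Finset.mem_filter.1 h1).2.2.2.2, ← (Finset.mem_filter.1 h2).2.2.2.2]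
    have h1 : ∑ b ∈ H, ((goodPoints Ω Q (2 * r) b).card : ℂ) * c b =
        ∑ α ∈ H.biUnion fun b => goodPoints Ω Q (2 * r) b, Θ α := by
      rw [Finset.sum_biUnion hdisj]
      refine Finset.sum_congr rfl fun b hb => ?_
      rw [← nsmul_eq_mul, ← Finset.sum_const]
      exact Finset.sum_congr rfl fun α hα => (hc b hb α hα).symm
    have hsub : (H.biUnion fun b => goodPoints Ω Q (2 * r) b) ⊆ fixFinset F Ω (2 * r) :=
      Finset.biUnion_subset.2 fun b _ => Finset.filter_subset _ _
    have h2 : fixFinset F Ω (2 * r) \ (H.biUnion fun b => goodPoints Ω Q (2 * r) b) =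
        (fixFinset F Ω (2 * r)).filter fun α => ∀ b ∈ H, ¬ IsGoodPoint Q (2 * r) b α := by
      ext α
      simp only [Finset.mem_sdiff, Finset.mem_biUnion, Finset.mem_filter, goodPoints, not_exists,
        not_and]
      tauto
    rw [h1, ← Finset.sum_sdiff hsub, add_sub_cancel_right, h2]
    refine (norm_sum_le_of_le _ fun α _ => hΘ _).trans ?_
    rw [Finset.sum_const, nsmul_eq_mul, mul_one]
    exact (hK r hr).1
  have hdec : ∀ r, 0 < r → ‖levelSum Ω Ψ (2 * r) -
      ∑ b ∈ H, ((goodPoints Ω Q (2 * r) b).card : ℂ) * Ψ (g b)‖ ≤ K := by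
    intro r hr
    refine hdec' r hr _ _ (fun _ => hle _) fun b hb α hα => ?_
    have h := (Finset.mem_filter.1 hα).2
    exact hperm _ _ (coeff_zero_fixedLift_invNormPoly h.1) (hg0 b hb)
      (h.2.2.2.trans (hgb b hb).symm)
  have hmain : ∀ r, 0 < r → ‖(E : ℂ) * levelSum Ω Ψ (2 * r) -
      (Fintype.card F : ℂ) ^ (2 * r) * ∑ b ∈ H, Ψ (g b)‖ ≤ (2 * E * K) * q ^ r := by
    intro r hr
    have h1 := norm_sum_sub_mul_le H
      (fun b => ((goodPoints Ω Q (2 * r) b).card : ℂ) * E) (fun b => Ψ (g b))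
      ((Fintype.card F : ℂ) ^ (2 * r)) (B := K * q ^ r) (fun b hb => by
        have := (hK r hr).2 b hb
        rw [← Real.norm_eq_abs, ← Complex.norm_real] at this
        simpa [hq] using this) (fun b _ => hle _)
    have h2 : ∑ b ∈ H, ((goodPoints Ω Q (2 * r) b).card : ℂ) * E * Ψ (g b) =
        E * ∑ b ∈ H, ((goodPoints Ω Q (2 * r) b).card : ℂ) * Ψ (g b) := by
      rw [Finset.mul_sum]
      exact Finset.sum_congr rfl fun b _ => by ring
    rw [h2] at h1
    have h3 : ‖(E : ℂ) * levelSum Ω Ψ (2 * r) -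
        E * ∑ b ∈ H, ((goodPoints Ω Q (2 * r) b).card : ℂ) * Ψ (g b)‖ ≤ E * K := by
      rw [← mul_sub, norm_mul, Complex.norm_natCast]
      exact mul_le_mul_of_nonneg_left (hdec r hr) (by linarith)
    have h4 : (H.card : ℝ) ≤ E := by exact_mod_cast card_conjResidues_le hQ hpos hf
    have h5 : (1 : ℝ) ≤ q ^ r := one_le_pow₀ hq2.le
    have h6 : (H.card : ℝ) * (K * q ^ r) ≤ E * (K * q ^ r) :=
      mul_le_mul_of_nonneg_right h4 (by positivity)
    have h7 : (E : ℝ) * K ≤ E * K * q ^ r := le_mul_of_one_le_right (by positivity) h5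
    have h8 := (norm_sub_le_norm_sub_add_norm_sub _ _ _).trans (add_le_add h3 h1)
    linarith
  refine ⟨(2 * E * K), by positivity, ?_⟩
  by_cases hall : ∀ b ∈ H, Ψ (g b) = 1
  · right
    intro r hr
    have h1 := hdec' r hr (fun _ => 1) (fun _ => 1) (fun _ => by simp) (fun _ _ _ _ => rfl)
    have h2 := hdec r hr
    rw [Finset.sum_congr rfl fun b hb => by rw [hall b hb]] at h2
    rw [Finset.sum_const, card_fixFinset (by omega), nsmul_eq_mul, mul_one, norm_sub_rev] at h1
    push_cast at h1
    refine (norm_sub_le_norm_sub_add_norm_sub _ _ _).trans ((add_le_add h2 h1).trans ?_)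
    have h5 : (1 : ℝ) ≤ q ^ r := one_le_pow₀ hq2.le
    have h6 : K ≤ E * K := le_mul_of_one_le_left hK0 hE1
    have h7 : (E : ℝ) * K ≤ E * K * q ^ r := le_mul_of_one_le_right (by positivity) h5
    linarith
  · left
    push Not at hall
    obtain ⟨b₀, hb₀, hne⟩ := hall
    have hz : ∑ b ∈ H, Ψ (g b) = 0 := by
      have hmaps : ∀ b ∈ H, (b₀ * b) %ₘ Q ∈ H := by
        intro b hb
        refine Finset.mem_filter.2 ⟨?_, ?_⟩
        · rw [mem_polyLT, ← degree_eq_natDegree hQ.ne_zero]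
          exact degree_modByMonic_lt _ hQ
        · rw [torsorSeries_modByMonic hQ hpos]
          exact bev_torsorSeries_mul hfd (Finset.mem_filter.1 hb).2 (Finset.mem_filter.1 hb₀).2
      have hinj : Set.InjOn (fun b => (b₀ * b) %ₘ Q) (H : Set F[X]) := by
        intro a ha b hb hab
        have h1 : Q ∣ (a - b) * b₀ := by
          rw [← modByMonic_eq_zero_iff_dvd hQ, sub_mul, sub_modByMonic, mul_comm a, mul_comm b]
          exact sub_eq_zero.2 hab
        have h2 := dvd_of_dvd_mul_of_bev_torsorSeries hQ hpos hf hfd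
          (Finset.mem_filter.1 hb₀).2 h1
        have ha' := mem_polyLT.1 (Finset.mem_filter.1 ha).1
        have hb' := mem_polyLT.1 (Finset.mem_filter.1 hb).1
        refine sub_eq_zero.1 (eq_zero_of_dvd_of_degree_lt h2 ((degree_sub_le _ _).trans_lt ?_))
        rw [degree_eq_natDegree hQ.ne_zero]
        exact max_lt ha' hb'
      have himg : H.image (fun b => (b₀ * b) %ₘ Q) = H :=
        Finset.eq_of_subset_of_card_le (Finset.image_subset_iff.2 hmaps)
          (Finset.card_image_of_injOn hinj).ge
      have hsum : ∑ b ∈ H, Ψ (g b) = Ψ (g b₀) * ∑ b ∈ H, Ψ (g b) := by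
        conv_lhs => rw [← himg, Finset.sum_image hinj]
        rw [Finset.mul_sum]
        refine Finset.sum_congr rfl fun b hb => ?_
        rw [← hmul _ _ (hg0 _ hb₀) (hg0 _ hb)]
        refine hperm _ _ (hg0 _ (hmaps b hb)) (by rw [mul_coeff_zero, hg0 _ hb₀, hg0 _ hb, mul_one])
          ?_
        rw [hgb _ (hmaps b hb), mul_modByMonic (g b₀), hgb _ hb₀, hgb _ hb]
      have : (1 - Ψ (g b₀)) * ∑ b ∈ H, Ψ (g b) = 0 := by
        rw [sub_mul, one_mul, ← hsum, sub_self]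
      exact (mul_eq_zero.1 this).resolve_left (sub_ne_zero.2 (Ne.symm hne))
    intro r hr
    have := hmain r hr
    rw [hz, mul_zero, sub_zero, norm_mul, Complex.norm_natCast] at this
    exact (le_mul_of_one_le_left (norm_nonneg _) hE1).trans this

end Dichotomy

section RayChar

variable {F : Type*} [Field F] [Fintype F]

/-- A character of the monic polynomials of conductor dividing `M ∞ ^ m`. -/
structure RayChar (M : F[X]) (m : ℕ) (ψ : F[X] → ℂ) : Prop where
  map_one : ψ 1 = 1
  map_mul : ∀ f g : F[X], f.Monic → g.Monic → ψ (f * g) = ψ f * ψ g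
  congr : ∀ f g : F[X], f.Monic → g.Monic → f.natDegree = g.natDegree → M ∣ f - g →
    (f - g).degree + m ≤ f.natDegree → ψ f = ψ g
  norm_eq : ∀ f : F[X], f.Monic → IsCoprime f M → ‖ψ f‖ = 1
  norm_le : ∀ f : F[X], ‖ψ f‖ ≤ 1

variable {Ω : Type*} [Field Ω] [Algebra F Ω]

variable (F) in
/-- The product of the first `s` Frobenius twists of a polynomial. -/
def twistProd (s : ℕ) (a : Polynomial Ω) : Polynomial Ω :=
  ∏ j ∈ Finset.range s, a.map (frobPow F Ω j : Ω →+* Ω)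

theorem twistProd_mul (s : ℕ) (a b : Polynomial Ω) :
    twistProd F s (a * b) = twistProd F s a * twistProd F s b := by
  simp [twistProd, Finset.prod_mul_distrib]

theorem twistProd_one (s : ℕ) : twistProd F s (1 : Polynomial Ω) = 1 := by
  simp [twistProd]

theorem frobPow_comp_one (j : ℕ) :
    ((frobPow F Ω 1 : Ω →+* Ω).comp (frobPow F Ω j : Ω →+* Ω)) = frobPow F Ω (j + 1) := by
  ext x
  simp [pow_succ, pow_mul]

theorem map_twistProd {s : ℕ} {a : Polynomial Ω} (ha : a.map (frobPow F Ω s : Ω →+* Ω) = a) :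
    (twistProd F s a).map (frobPow F Ω 1 : Ω →+* Ω) = twistProd F s a := by
  by_cases h0 : a = 0
  · subst h0
    cases s with
    | zero => simp [twistProd]
    | succ s => simp [twistProd]
  refine mul_left_cancel₀ h0 ?_
  have hz : a.map (frobPow F Ω 0 : Ω →+* Ω) = a := by
    ext i
    simp
  have e := Finset.prod_range_succ' (fun j => a.map (frobPow F Ω j : Ω →+* Ω)) s
  rw [Finset.prod_range_succ, hz, ha] at e
  rw [twistProd, Polynomial.map_prod]
  simp_rw [map_map, frobPow_comp_one]
  rw [mul_comm, ← e, mul_comm]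

theorem monic_twistProd {s : ℕ} {a : Polynomial Ω} (ha : a.Monic) : (twistProd F s a).Monic :=
  monic_prod_of_monic _ _ fun _ _ => ha.map _

theorem natDegree_twistProd (s : ℕ) {a : Polynomial Ω} (ha : a.Monic) :
    (twistProd F s a).natDegree = s * a.natDegree := by
  rw [twistProd, natDegree_prod_of_monic _ _ fun _ _ => ha.map _]
  simp [ha.natDegree_map]

theorem degree_prod_sub_prod_le {R : Type*} [CommRing R] {n m s : ℕ} {a b : ℕ → R[X]}
    (ha : ∀ j, (a j).natDegree ≤ n) (hb : ∀ j, (b j).natDegree ≤ n)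
    (h : ∀ j, (a j - b j).degree + m ≤ n) :
    (∏ j ∈ Finset.range s, a j - ∏ j ∈ Finset.range s, b j).degree + m ≤ (s * n : ℕ) := by
  induction s with
  | zero => simp
  | succ s ih =>
    have e : ∏ j ∈ Finset.range (s + 1), a j - ∏ j ∈ Finset.range (s + 1), b j =
        (∏ j ∈ Finset.range s, a j - ∏ j ∈ Finset.range s, b j) * a s +
          (∏ j ∈ Finset.range s, b j) * (a s - b s) := by
      rw [Finset.prod_range_succ, Finset.prod_range_succ]; ring
    have hbp : (∏ j ∈ Finset.range s, b j).degree ≤ (s * n : ℕ) := by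
      refine degree_le_of_natDegree_le ((natDegree_prod_le _ _).trans ?_)
      refine (Finset.sum_le_card_nsmul _ _ n fun j _ => hb j).trans ?_
      simp
    rw [e]
    have h1 : ((∏ j ∈ Finset.range s, a j - ∏ j ∈ Finset.range s, b j) * a s).degree + m ≤
        ((s + 1) * n : ℕ) := by
      calc _ ≤ ((∏ j ∈ Finset.range s, a j - ∏ j ∈ Finset.range s, b j).degree + (a s).degree)
            + m := by gcongr; exact degree_mul_le _ _
        _ = ((∏ j ∈ Finset.range s, a j - ∏ j ∈ Finset.range s, b j).degree + m) +
            (a s).degree := by abel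
        _ ≤ (s * n : ℕ) + (n : ℕ) := add_le_add ih (degree_le_of_natDegree_le (ha s))
        _ = ((s + 1) * n : ℕ) := by push_cast; ring
    have h2 : ((∏ j ∈ Finset.range s, b j) * (a s - b s)).degree + m ≤ ((s + 1) * n : ℕ) := by
      calc _ ≤ ((∏ j ∈ Finset.range s, b j).degree + (a s - b s).degree) + m := by
            gcongr; exact degree_mul_le _ _
        _ = (∏ j ∈ Finset.range s, b j).degree + ((a s - b s).degree + m) := by abel
        _ ≤ (s * n : ℕ) + (n : ℕ) := add_le_add hbp (h s)
        _ = ((s + 1) * n : ℕ) := by push_cast; ring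
    refine (add_le_add_left (degree_add_le _ _) _).trans ?_
    rcases max_cases ((∏ j ∈ Finset.range s, a j - ∏ j ∈ Finset.range s, b j) * a s).degree
      ((∏ j ∈ Finset.range s, b j) * (a s - b s)).degree with ⟨hm, -⟩ | ⟨hm, -⟩ <;> rw [hm]
    · exact h1
    · exact h2

theorem dvd_prod_sub_prod {R : Type*} [CommRing R] {s : ℕ} {a b : ℕ → R} {d : R}
    (h : ∀ j, d ∣ a j - b j) :
    d ∣ ∏ j ∈ Finset.range s, a j - ∏ j ∈ Finset.range s, b j := by
  induction s with
  | zero => simp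
  | succ s ih =>
    have e : ∏ j ∈ Finset.range (s + 1), a j - ∏ j ∈ Finset.range (s + 1), b j =
        (∏ j ∈ Finset.range s, a j - ∏ j ∈ Finset.range s, b j) * a s +
          (∏ j ∈ Finset.range s, b j) * (a s - b s) := by
      rw [Finset.prod_range_succ, Finset.prod_range_succ]; ring
    rw [e]
    exact dvd_add (ih.mul_right _) ((h s).mul_left _)

/-- Norms of polynomials close at a conductor agree under a ray class character. -/
theorem RayChar.apply_fixedLift_eq {M : F[X]} {m : ℕ} {ψ : F[X] → ℂ} (hψ : RayChar M m ψ) {s n : ℕ}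
    {a b : Polynomial Ω} (ha : a.Monic) (hb : b.Monic) (han : a.natDegree = n)
    (hbn : b.natDegree = n) (hfa : a.map (frobPow F Ω s : Ω →+* Ω) = a)
    (hfb : b.map (frobPow F Ω s : Ω →+* Ω) = b) (hM : M.map (algebraMap F Ω) ∣ a - b)
    (hdeg : (a - b).degree + m ≤ n) :
    ψ (fixedLift F (twistProd F s a)) = ψ (fixedLift F (twistProd F s b)) := by
  have ea := map_fixedLift_of_map_eq (map_twistProd hfa)
  have eb := map_fixedLift_of_map_eq (map_twistProd hfb)
  have hinj := (algebraMap F Ω).injective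
  have mon : ∀ {a : Polynomial Ω}, a.Monic →
      (fixedLift F (twistProd F s a)).map (algebraMap F Ω) = twistProd F s a →
      (fixedLift F (twistProd F s a)).Monic ∧
        (fixedLift F (twistProd F s a)).natDegree = s * a.natDegree := by
    intro a ha e
    constructor
    · rw [← monic_map_iff (f := algebraMap F Ω), e]
      exact monic_twistProd ha
    · rw [← natDegree_map (algebraMap F Ω), e, natDegree_twistProd s ha]
  obtain ⟨ma, da⟩ := mon ha ea
  obtain ⟨mb, db⟩ := mon hb eb
  refine hψ.congr _ _ ma mb (by rw [da, db, han, hbn]) ?_ ?_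
  · rw [← map_dvd_map' (algebraMap F Ω), Polynomial.map_sub, ea, eb]
    refine dvd_prod_sub_prod fun j => ?_
    rw [← Polynomial.map_sub, ← map_frobPow_map j M]
    exact Polynomial.map_dvd _ hM
  · rw [← degree_map _ (algebraMap F Ω), Polynomial.map_sub, ea, eb, da, han]
    refine degree_prod_sub_prod_le (fun j => ?_) (fun j => ?_) (fun j => ?_)
    · rw [natDegree_map, han]
    · rw [natDegree_map, hbn]
    · rw [← Polynomial.map_sub, degree_map]
      exact hdeg

end RayChar

section BaseChange

variable {F : Type*} [Field F] [Fintype F] {Ω : Type*} [Field Ω] [Algebra F Ω]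

theorem fixedLift_mul {a b : Polynomial Ω} (ha : a.map (frobPow F Ω 1 : Ω →+* Ω) = a)
    (hb : b.map (frobPow F Ω 1 : Ω →+* Ω) = b) :
    fixedLift F (a * b) = fixedLift F a * fixedLift F b := by
  apply Polynomial.map_injective _ (algebraMap F Ω).injective
  rw [Polynomial.map_mul, map_fixedLift_of_map_eq ha, map_fixedLift_of_map_eq hb,
    map_fixedLift_of_map_eq (by rw [Polynomial.map_mul, ha, hb])]

theorem fixedLift_map (b : F[X]) : fixedLift F (b.map (algebraMap F Ω)) = b := by
  apply Polynomial.map_injective _ (algebraMap F Ω).injective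
  rw [map_fixedLift_of_map_eq (map_frobPow_map 1 b)]

theorem monic_fixedLift {a : Polynomial Ω} (ha : a.map (frobPow F Ω 1 : Ω →+* Ω) = a)
    (hm : a.Monic) : (fixedLift F a).Monic := by
  rw [← monic_map_iff (f := algebraMap F Ω), map_fixedLift_of_map_eq ha]
  exact hm

variable (F) in
/-- The characteristic polynomial over `F` of an element of the degree `n` extension. -/
def normPoly (n : ℕ) (β : Ω) : Polynomial Ω :=
  ∏ j ∈ Finset.range n, (X - C (β ^ Fintype.card F ^ j))

variable {K : Type*} [Field K]

/-- Reversal in degree `n` followed by a translation. -/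
def shiftReflect (a₀ : K) (n : ℕ) (g : K[X]) : K[X] := (reflect n g).comp (X - C a₀)

theorem shiftReflect_mul (a₀ : K) {n n' : ℕ} {g g' : K[X]} (hg : g.natDegree ≤ n)
    (hg' : g'.natDegree ≤ n') :
    shiftReflect a₀ (n + n') (g * g') = shiftReflect a₀ n g * shiftReflect a₀ n' g' := by
  rw [shiftReflect, reflect_mul _ _ hg hg', mul_comp]; rfl

theorem natDegree_reflect_of_coeff_zero {n : ℕ} {g : K[X]} (hg : g.natDegree ≤ n)
    (h0 : g.coeff 0 = 1) : (reflect n g).natDegree = n ∧ (reflect n g).Monic := by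
  have hc : (reflect n g).coeff n = 1 := by
    rw [coeff_reflect, revAt_le le_rfl, Nat.sub_self, h0]
  have hle : (reflect n g).natDegree ≤ n := by
    rw [natDegree_le_iff_coeff_eq_zero]
    intro i hi
    rw [coeff_reflect, revAt_eq_self_of_lt hi]
    exact coeff_eq_zero_of_natDegree_lt (hg.trans_lt hi)
  exact ⟨natDegree_eq_of_le_of_coeff_ne_zero hle (by rw [hc]; exact one_ne_zero),
    monic_of_natDegree_le_of_coeff_eq_one n hle hc⟩

theorem natDegree_shiftReflect (a₀ : K) {n : ℕ} {g : K[X]} (hg : g.natDegree ≤ n)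
    (h0 : g.coeff 0 = 1) : (shiftReflect a₀ n g).natDegree = n := by
  rw [shiftReflect, natDegree_comp, natDegree_X_sub_C, mul_one,
    (natDegree_reflect_of_coeff_zero hg h0).1]

theorem monic_shiftReflect (a₀ : K) {n : ℕ} {g : K[X]} (hg : g.natDegree ≤ n)
    (h0 : g.coeff 0 = 1) : (shiftReflect a₀ n g).Monic :=
  (natDegree_reflect_of_coeff_zero hg h0).2.comp_X_sub_C a₀

variable [Fintype K] [Algebra F K] [Algebra K Ω] [IsScalarTower F K Ω]

theorem card_pow_map_frobPow {s : ℕ} (hs : Fintype.card K = Fintype.card F ^ s) (g : K[X]) :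
    (g.map (algebraMap K Ω)).map (frobPow F Ω s : Ω →+* Ω) = g.map (algebraMap K Ω) := by
  ext i
  simp only [coeff_map, RingHom.coe_coe, frobPow_apply, ← map_pow, ← hs,
    FiniteField.pow_card]

theorem map_frob_twistProd_map {s : ℕ} (hs : Fintype.card K = Fintype.card F ^ s) (g : K[X]) :
    (twistProd F s (g.map (algebraMap K Ω))).map (frobPow F Ω 1 : Ω →+* Ω) =
      twistProd F s (g.map (algebraMap K Ω)) :=
  map_twistProd (card_pow_map_frobPow hs g)

variable (F Ω) in
/-- The norm to `F` of a polynomial over the extension of degree `s`. -/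
def relNorm (s : ℕ) (g : K[X]) : F[X] := fixedLift F (twistProd F s (g.map (algebraMap K Ω)))

theorem relNorm_mul {s : ℕ} (hs : Fintype.card K = Fintype.card F ^ s) (g h : K[X]) :
    relNorm F Ω s (g * h) = relNorm F Ω s g * relNorm F Ω s h := by
  rw [relNorm, Polynomial.map_mul, twistProd_mul, fixedLift_mul (map_frob_twistProd_map hs g)
    (map_frob_twistProd_map hs h)]
  rfl

theorem relNorm_one {s : ℕ} : relNorm F Ω s (1 : K[X]) = 1 := by
  rw [relNorm, Polynomial.map_one, twistProd_one]
  simpa using fixedLift_map (Ω := Ω) (1 : F[X])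

theorem monic_relNorm {s : ℕ} (hs : Fintype.card K = Fintype.card F ^ s) {g : K[X]}
    (hg : g.Monic) : (relNorm F Ω s g).Monic :=
  monic_fixedLift (map_frob_twistProd_map hs g) (monic_twistProd (hg.map _))

theorem isCoprime_relNorm {s : ℕ} (hs : Fintype.card K = Fintype.card F ^ s) {M : F[X]} {a₀ : K}
    (h : aeval a₀ M ≠ 0) : IsCoprime (relNorm F Ω s (X - C a₀)) M := by
  rw [← isCoprime_map (algebraMap F Ω), relNorm,
    map_fixedLift_of_map_eq (map_frob_twistProd_map hs _), twistProd]
  refine IsCoprime.prod_left fun j _ => ?_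
  rw [← map_frobPow_map j M]
  refine IsCoprime.map ?_ (mapRingHom (frobPow F Ω j : Ω →+* Ω))
  rw [IsScalarTower.algebraMap_eq F K Ω, ← map_map]
  refine IsCoprime.map ?_ (mapRingHom (algebraMap K Ω))
  refine (irreducible_X_sub_C a₀).coprime_iff_not_dvd.2 ?_
  rw [dvd_iff_isRoot, IsRoot.def, eval_map_algebraMap]
  exact h

/-- The modulus in reversed coordinates. -/
def revModulus (M : F[X]) (m : ℕ) (a₀ : K) : K[X] :=
  C (aeval a₀ M)⁻¹ * (X ^ m * reflect M.natDegree ((M.map (algebraMap F K)).comp (X + C a₀)))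

theorem coeff_zero_comp (M : F[X]) (a₀ : K) :
    ((M.map (algebraMap F K)).comp (X + C a₀)).coeff 0 = aeval a₀ M := by
  rw [coeff_zero_eq_eval_zero, eval_comp]
  simp

theorem natDegree_comp_shift (M : F[X]) (a₀ : K) :
    ((M.map (algebraMap F K)).comp (X + C a₀)).natDegree = M.natDegree := by
  rw [natDegree_comp, natDegree_X_add_C, mul_one, natDegree_map]

theorem revModulus_eq {M : F[X]} (m : ℕ) {a₀ : K} :
    revModulus M m a₀ = X ^ m * reflect M.natDegree
      (C (aeval a₀ M)⁻¹ * (M.map (algebraMap F K)).comp (X + C a₀)) := by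
  rw [revModulus, reflect_C_mul]; ring

theorem monic_revModulus {M : F[X]} (m : ℕ) {a₀ : K} (h : aeval a₀ M ≠ 0) :
    (revModulus M m a₀).Monic ∧ (revModulus M m a₀).natDegree = m + M.natDegree := by
  have := natDegree_reflect_of_coeff_zero (n := M.natDegree)
    (g := C (aeval a₀ M)⁻¹ * (M.map (algebraMap F K)).comp (X + C a₀))
    ((natDegree_C_mul_le _ _).trans (natDegree_comp_shift M a₀).le)
    (by rw [coeff_C_mul, coeff_zero_comp, inv_mul_cancel₀ h])
  rw [revModulus_eq m]
  refine ⟨(monic_X_pow m).mul this.2, ?_⟩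
  rw [(monic_X_pow m).natDegree_mul this.2, natDegree_X_pow, this.1]

theorem shiftReflect_revModulus {M : F[X]} (m : ℕ) {a₀ : K} (h : aeval a₀ M ≠ 0) :
    shiftReflect a₀ (m + M.natDegree) (revModulus M m a₀) =
      C (aeval a₀ M)⁻¹ * M.map (algebraMap F K) := by
  have e : shiftReflect a₀ m (X ^ m : K[X]) = 1 := by
    rw [shiftReflect, reflect_monomial, revAt_le le_rfl, Nat.sub_self]
    simp
  have e2 : ∀ n : ℕ, ∀ g : K[X], reflect n (reflect n g) = g := by
    intro n g
    ext i
    rw [coeff_reflect, coeff_reflect, revAt_invol]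
  rw [revModulus_eq m, shiftReflect_mul, e, one_mul, shiftReflect, e2, mul_comp, C_comp,
    comp_assoc]
  · simp
  · simp
  · have := natDegree_reflect_of_coeff_zero (n := M.natDegree)
      (g := C (aeval a₀ M)⁻¹ * (M.map (algebraMap F K)).comp (X + C a₀))
      ((natDegree_C_mul_le _ _).trans (natDegree_comp_shift M a₀).le)
      (by rw [coeff_C_mul, coeff_zero_comp, inv_mul_cancel₀ h])
    exact this.1.le

theorem shiftReflect_sub (a₀ : K) (n : ℕ) (g h : K[X]) :
    shiftReflect a₀ n (g - h) = shiftReflect a₀ n g - shiftReflect a₀ n h := by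
  rw [shiftReflect, reflect_sub, sub_comp]; rfl

/-- Congruence modulo the reversed modulus becomes a congruence modulo `M` and at infinity. -/
theorem shiftReflect_sub_of_dvd {M : F[X]} {m : ℕ} {a₀ : K} (ha : aeval a₀ M ≠ 0) {n : ℕ}
    {g h : K[X]} (hg : g.natDegree ≤ n) (hh : h.natDegree ≤ n) (hd : revModulus M m a₀ ∣ g - h) :
    M.map (algebraMap F K) ∣ shiftReflect a₀ n g - shiftReflect a₀ n h ∧
      (shiftReflect a₀ n g - shiftReflect a₀ n h).degree + m ≤ n := by
  rw [← shiftReflect_sub]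
  obtain ⟨w, hw⟩ := hd
  rcases eq_or_ne w 0 with rfl | h0
  · rw [hw, mul_zero, shiftReflect, reflect_zero, zero_comp]
    simp
  obtain ⟨hm, hdm⟩ := monic_revModulus (M := M) m ha
  have h1 : (g - h).natDegree = m + M.natDegree + w.natDegree := by
    rw [hw, hm.natDegree_mul' h0, hdm]
  have h2 : (g - h).natDegree ≤ n := (natDegree_sub_le _ _).trans (max_le hg hh)
  obtain ⟨e, rfl⟩ : ∃ e, n = (m + M.natDegree) + e := ⟨n - (m + M.natDegree), by omega⟩
  have he : w.natDegree ≤ e := by omega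
  rw [hw, shiftReflect_mul a₀ hdm.le he, shiftReflect_revModulus m ha]
  refine ⟨(Dvd.intro_left (C (aeval a₀ M)⁻¹) rfl).mul_right _, ?_⟩
  have h3 : (C (aeval a₀ M)⁻¹ * M.map (algebraMap F K) * shiftReflect a₀ e w).natDegree ≤
      M.natDegree + e := by
    refine natDegree_mul_le.trans (add_le_add ?_ ?_)
    · exact (natDegree_C_mul_le _ _).trans (natDegree_map_le)
    · rw [shiftReflect, natDegree_comp, natDegree_X_sub_C, mul_one]
      rw [natDegree_le_iff_coeff_eq_zero]
      intro i hi
      rw [coeff_reflect, revAt_eq_self_of_lt hi]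
      exact coeff_eq_zero_of_natDegree_lt (he.trans_lt hi)
  calc _ ≤ ((M.natDegree + e : ℕ) : WithBot ℕ) + m := by
        gcongr; exact degree_le_of_natDegree_le h3
    _ = _ := by push_cast; ring

end BaseChange

section BaseChange

theorem shiftReflect_one {K : Type*} [Field K] (a₀ : K) (n : ℕ) :
    shiftReflect a₀ n (1 : K[X]) = (X - C a₀) ^ n := by
  rw [shiftReflect, ← C_1, reflect_C]
  simp

variable {F : Type*} [Field F] [Fintype F] {Ω : Type*} [Field Ω] [Algebra F Ω]
variable {K : Type*} [Field K] [Fintype K] [Algebra F K] [Algebra K Ω] [IsScalarTower F K Ω]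

variable (F Ω) in
/-- The base change of a ray class character, as a function of `g` with `g(0) = 1`. -/
def liftChar (ψ : F[X] → ℂ) (s : ℕ) (a₀ : K) (g : K[X]) : ℂ :=
  if g.coeff 0 = 1 then
    ψ (relNorm F Ω s (shiftReflect a₀ g.natDegree g)) /
      ψ (relNorm F Ω s (X - C a₀)) ^ g.natDegree
  else 0

section

variable {M : F[X]} {m s : ℕ} {a₀ : K} {ψ : F[X] → ℂ}

theorem RayChar.norm_relNorm (hψ : RayChar M m ψ) (hs : Fintype.card K = Fintype.card F ^ s)
    (ha : aeval a₀ M ≠ 0) : ‖ψ (relNorm F Ω s (X - C a₀))‖ = 1 :=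
  hψ.norm_eq _ (monic_relNorm hs (monic_X_sub_C a₀)) (isCoprime_relNorm hs ha)

theorem RayChar.apply_relNorm_pow (hψ : RayChar M m ψ)
    (hs : Fintype.card K = Fintype.card F ^ s) (n : ℕ) :
    ψ (relNorm F Ω s ((X - C a₀) ^ n)) = ψ (relNorm F Ω s (X - C a₀)) ^ n := by
  induction n with
  | zero => rw [pow_zero, pow_zero, relNorm_one, hψ.map_one]
  | succ n ih =>
    rw [pow_succ, pow_succ, relNorm_mul hs, hψ.map_mul _ _
      (monic_relNorm hs ((monic_X_sub_C a₀).pow n)) (monic_relNorm hs (monic_X_sub_C a₀)), ih]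

theorem RayChar.apply_shiftReflect_mul (hψ : RayChar M m ψ)
    (hs : Fintype.card K = Fintype.card F ^ s) {n n' : ℕ} {g g' : K[X]} (hg : g.natDegree ≤ n)
    (hg' : g'.natDegree ≤ n') (h0 : g.coeff 0 = 1) (h0' : g'.coeff 0 = 1) :
    ψ (relNorm F Ω s (shiftReflect a₀ (n + n') (g * g'))) =
      ψ (relNorm F Ω s (shiftReflect a₀ n g)) * ψ (relNorm F Ω s (shiftReflect a₀ n' g')) := by
  rw [shiftReflect_mul a₀ hg hg', relNorm_mul hs, hψ.map_mul _ _
    (monic_relNorm hs (monic_shiftReflect a₀ hg h0))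
    (monic_relNorm hs (monic_shiftReflect a₀ hg' h0'))]

theorem RayChar.liftChar_eq (hψ : RayChar M m ψ) (hs : Fintype.card K = Fintype.card F ^ s)
    (ha : aeval a₀ M ≠ 0) {n : ℕ} {g : K[X]} (hg : g.natDegree ≤ n) (h0 : g.coeff 0 = 1) :
    liftChar F Ω ψ s a₀ g = ψ (relNorm F Ω s (shiftReflect a₀ n g)) /
      ψ (relNorm F Ω s (X - C a₀)) ^ n := by
  obtain ⟨e, rfl⟩ := Nat.exists_eq_add_of_le hg
  have hu : ψ (relNorm F Ω s (X - C a₀)) ≠ 0 := by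
    rw [← norm_ne_zero_iff, hψ.norm_relNorm hs ha]; exact one_ne_zero
  have h := hψ.apply_shiftReflect_mul (Ω := Ω) (a₀ := a₀) hs (le_refl g.natDegree)
    (g' := 1) (n' := e) (by simp) h0 (by simp)
  rw [mul_one, shiftReflect_one, hψ.apply_relNorm_pow hs] at h
  rw [liftChar, if_pos h0, h, pow_add, mul_div_mul_right _ _ (pow_ne_zero _ hu)]

theorem RayChar.liftChar_mul (hψ : RayChar M m ψ) (hs : Fintype.card K = Fintype.card F ^ s)
    (ha : aeval a₀ M ≠ 0) {g h : K[X]} (h0 : g.coeff 0 = 1) (h0' : h.coeff 0 = 1) :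
    liftChar F Ω ψ s a₀ (g * h) = liftChar F Ω ψ s a₀ g * liftChar F Ω ψ s a₀ h := by
  rw [hψ.liftChar_eq hs ha natDegree_mul_le (by rw [mul_coeff_zero, h0, h0', one_mul]),
    hψ.liftChar_eq hs ha le_rfl h0, hψ.liftChar_eq hs ha le_rfl h0',
    hψ.apply_shiftReflect_mul hs le_rfl le_rfl h0 h0', pow_add, div_mul_div_comm]

theorem RayChar.liftChar_congr (hψ : RayChar M m ψ) (hs : Fintype.card K = Fintype.card F ^ s)
    (ha : aeval a₀ M ≠ 0) {g h : K[X]} (h0 : g.coeff 0 = 1) (h0' : h.coeff 0 = 1)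
    (hd : revModulus M m a₀ ∣ g - h) :
    liftChar F Ω ψ s a₀ g = liftChar F Ω ψ s a₀ h := by
  set n := max g.natDegree h.natDegree
  have hg : g.natDegree ≤ n := le_max_left _ _
  have hh : h.natDegree ≤ n := le_max_right _ _
  rw [hψ.liftChar_eq hs ha hg h0, hψ.liftChar_eq hs ha hh h0']
  congr 1
  obtain ⟨h1, h2⟩ := shiftReflect_sub_of_dvd ha hg hh hd
  refine hψ.apply_fixedLift_eq ((monic_shiftReflect a₀ hg h0).map _)
    ((monic_shiftReflect a₀ hh h0').map _) (n := n) ?_ ?_ (card_pow_map_frobPow hs _)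
    (card_pow_map_frobPow hs _) ?_ ?_
  · rw [natDegree_map, natDegree_shiftReflect a₀ hg h0]
  · rw [natDegree_map, natDegree_shiftReflect a₀ hh h0']
  · rw [← Polynomial.map_sub, IsScalarTower.algebraMap_eq F K Ω, ← map_map]
    exact Polynomial.map_dvd _ h1
  · rw [← Polynomial.map_sub, degree_map]
    exact h2

theorem RayChar.norm_liftChar_le (hψ : RayChar M m ψ) (hs : Fintype.card K = Fintype.card F ^ s)
    (ha : aeval a₀ M ≠ 0) (g : K[X]) : ‖liftChar F Ω ψ s a₀ g‖ ≤ 1 := by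
  rw [liftChar]
  split_ifs
  · rw [norm_div, norm_pow, hψ.norm_relNorm hs ha, one_pow, div_one]
    exact hψ.norm_le _
  · simp

theorem map_relNorm_shiftReflect (hs : Fintype.card K = Fintype.card F ^ s) {r : ℕ} {α : Ω}
    (hα : α ^ Fintype.card K ^ r = α) :
    relNorm F Ω s (shiftReflect a₀ r (fixedLift K (invNormPoly K r α))) =
      fixedLift F (normPoly F (s * r) (α + algebraMap K Ω a₀)) := by
  rw [relNorm]
  congr 1
  have h1 : (shiftReflect a₀ r (fixedLift K (invNormPoly K r α))).map (algebraMap K Ω) =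
      normPoly K r (α + algebraMap K Ω a₀) := by
    have e : (shiftReflect a₀ r (fixedLift K (invNormPoly K r α))).map (algebraMap K Ω) =
        shiftReflect (algebraMap K Ω a₀) r (invNormPoly K r α) := by
      rw [shiftReflect, map_comp, ← reflect_map, map_fixedLift_invNormPoly hα, shiftReflect]
      simp
    rw [e]
    clear e hα
    have hq : ∀ j, algebraMap K Ω a₀ ^ Fintype.card K ^ j = algebraMap K Ω a₀ := by
      intro j
      rw [← map_pow, FiniteField.pow_card_pow]
    induction r with
    | zero =>
      rw [invNormPoly, Finset.prod_range_zero, shiftReflect_one]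
      simp [normPoly]
    | succ r ih =>
      have hd : ∀ j : ℕ, (1 - C (α ^ Fintype.card K ^ j) * X).natDegree ≤ 1 := by
        intro j
        compute_degree
      rw [invNormPoly, Finset.prod_range_succ, ← invNormPoly, shiftReflect_mul _ _ (hd r), ih,
        normPoly, normPoly, Finset.prod_range_succ]
      · congr 1
        have e : reflect 1 (1 - C (α ^ Fintype.card K ^ r) * X) =
            X - C (α ^ Fintype.card K ^ r) := by
          rw [reflect_sub, reflect_C_mul, ← C_1, reflect_C]
          have := reflect_monomial (R := Ω) 1 1
          rw [pow_one] at this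
          rw [this]
          simp
        have := map_add (frobPow K Ω r) α (algebraMap K Ω a₀)
        simp only [frobPow_apply] at this
        rw [shiftReflect, e, this, hq]
        simp only [sub_comp, X_comp, C_comp, map_add]
        ring
      · refine (natDegree_prod_le _ _).trans ?_
        refine (Finset.sum_le_card_nsmul _ _ 1 fun j _ => hd j).trans ?_
        simp
  rw [h1, twistProd, normPoly, normPoly]
  simp_rw [Polynomial.map_prod]
  rw [Finset.prod_comm]
  clear hα h1
  generalize α + algebraMap K Ω a₀ = β
  induction r with
  | zero => simp
  | succ r ih =>
    rw [Finset.prod_range_succ, ih, mul_add_one, Finset.prod_range_add]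
    congr 1
    refine Finset.prod_congr rfl fun i _ => ?_
    rw [hs, ← pow_mul (Fintype.card F), pow_add, pow_mul β]
    simp only [Polynomial.map_sub, map_X, map_C, RingHom.coe_coe,
      frobPow_apply]

end

end BaseChange

section BaseChange

variable {F : Type*} [Field F] [Fintype F] {Ω : Type*} [Field Ω] [Algebra F Ω]

variable (Ω) in
/-- The sum of a character over the characteristic polynomials of the elements of the extension
of degree `n`. -/
def normSum (ψ : F[X] → ℂ) (n : ℕ) : ℂ := ∑ β ∈ fixFinset F Ω n, ψ (fixedLift F (normPoly F n β))

theorem RayChar.levelSum_liftChar {K : Type*} [Field K] [Fintype K] [Algebra F K] [Algebra K Ω]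
    [IsScalarTower F K Ω] {M : F[X]} {m s : ℕ} {a₀ : K} {ψ : F[X] → ℂ} (hψ : RayChar M m ψ)
    (hs : Fintype.card K = Fintype.card F ^ s) (hs0 : 0 < s) (ha : aeval a₀ M ≠ 0) {r : ℕ}
    (hr : 0 < r) :
    levelSum Ω (liftChar F Ω ψ s a₀) r * ψ (relNorm F Ω s (X - C a₀)) ^ r =
      normSum Ω ψ (s * r) := by
  have hu : ψ (relNorm F Ω s (X - C a₀)) ≠ 0 := by
    rw [← norm_ne_zero_iff, hψ.norm_relNorm hs ha]; exact one_ne_zero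
  rw [levelSum, Finset.sum_mul, normSum]
  refine Finset.sum_bij (fun α _ => α + algebraMap K Ω a₀) ?_ ?_ ?_ ?_
  · intro α hα
    rw [mem_fixFinset hr] at hα
    rw [mem_fixFinset (by positivity), pow_mul, ← hs]
    have := map_add (frobPow K Ω r) α (algebraMap K Ω a₀)
    simp only [frobPow_apply] at this
    rw [this, hα, ← map_pow, FiniteField.pow_card_pow]
  · intro a _ b _ h
    exact add_right_cancel h
  · intro β hβ
    rw [mem_fixFinset (by positivity), pow_mul, ← hs] at hβ
    refine ⟨β - algebraMap K Ω a₀, ?_, sub_add_cancel _ _⟩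
    rw [mem_fixFinset hr]
    have := map_sub (frobPow K Ω r) β (algebraMap K Ω a₀)
    simp only [frobPow_apply] at this
    rw [this, hβ, ← map_pow, FiniteField.pow_card_pow]
  · intro α hα
    rw [mem_fixFinset hr] at hα
    have hd : (fixedLift K (invNormPoly K r α)).natDegree ≤ r := by
      rw [← natDegree_map (algebraMap K Ω), map_fixedLift_invNormPoly hα, invNormPoly]
      refine (natDegree_prod_le _ _).trans ?_
      refine (Finset.sum_le_card_nsmul _ _ 1 fun j _ => ?_).trans ?_
      · compute_degree
      · simp
    rw [hψ.liftChar_eq hs ha hd (coeff_zero_fixedLift_invNormPoly hα),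
      map_relNorm_shiftReflect hs hα, div_mul_cancel₀ _ (pow_ne_zero _ hu)]

theorem RayChar.normSum_dichotomy_of_field [IsAlgClosed Ω] {K : Type*} [Field K] [Fintype K]
    [Algebra F K] [Algebra K Ω] [IsScalarTower F K Ω] {M : F[X]} {m s : ℕ} {a₀ : K}
    {ψ : F[X] → ℂ} (hψ : RayChar M m ψ) (hs : Fintype.card K = Fintype.card F ^ s) (hs0 : 0 < s)
    (ha : aeval a₀ M ≠ 0) (hm : 1 ≤ m) :
    ∃ u : ℂ, ‖u‖ = 1 ∧ ∃ B : ℝ, 0 ≤ B ∧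
      ((∀ r : ℕ, 0 < r → ‖normSum Ω ψ (2 * s * r)‖ ≤ B * ((Fintype.card F : ℝ) ^ s) ^ r) ∨
        ∀ r : ℕ, 0 < r → ‖normSum Ω ψ (2 * s * r) -
          (u * (Fintype.card F : ℂ) ^ (2 * s)) ^ r‖ ≤ B * ((Fintype.card F : ℝ) ^ s) ^ r) := by
  obtain ⟨hmon, hdeg⟩ := monic_revModulus (M := M) m ha
  obtain ⟨B, hB, h⟩ := levelSum_dichotomy (Ω := Ω) hmon (by omega) (liftChar F Ω ψ s a₀)
    (fun g h => hψ.liftChar_mul hs ha) (fun g h => hψ.liftChar_congr hs ha)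
    (hψ.norm_liftChar_le hs ha)
  have hv1 : ‖ψ (relNorm F Ω s (X - C a₀))‖ = 1 := hψ.norm_relNorm hs ha
  have hkey : ∀ r, 0 < r → normSum Ω ψ (2 * s * r) =
      levelSum Ω (liftChar F Ω ψ s a₀) (2 * r) * ψ (relNorm F Ω s (X - C a₀)) ^ (2 * r) := by
    intro r hr
    rw [hψ.levelSum_liftChar hs hs0 ha (by omega)]
    congr 1
    ring
  generalize ψ (relNorm F Ω s (X - C a₀)) = v at hv1 hkey
  refine ⟨v ^ 2, by rw [norm_pow, hv1, one_pow], B, hB, ?_⟩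
  refine h.imp (fun h r hr => ?_) (fun h r hr => ?_)
  · rw [hkey r hr, norm_mul, norm_pow, hv1, one_pow, mul_one]
    have := h r hr
    rwa [hs, Nat.cast_pow] at this
  · have e : (v ^ 2 * (Fintype.card F : ℂ) ^ (2 * s)) ^ r =
        (Fintype.card K : ℂ) ^ (2 * r) * v ^ (2 * r) := by
      rw [hs, Nat.cast_pow, mul_pow]
      ring
    have := h r hr
    rw [hkey r hr, e, ← sub_mul, norm_mul, norm_pow, hv1, one_pow, mul_one]
    have hs' : (Fintype.card K : ℝ) = (Fintype.card F : ℝ) ^ s := by rw [hs, Nat.cast_pow]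
    rwa [← hs']

theorem RayChar.normSum_dichotomy {M : F[X]} {m : ℕ} {ψ : F[X] → ℂ} (hψ : RayChar M m ψ)
    (hM : M ≠ 0) (hm : 1 ≤ m) :
    ∃ s : ℕ, 0 < s ∧ ∃ u : ℂ, ‖u‖ = 1 ∧ ∃ B : ℝ, 0 ≤ B ∧
      ((∀ r : ℕ, 0 < r → ‖normSum (AlgebraicClosure F) ψ (2 * s * r)‖ ≤
          B * ((Fintype.card F : ℝ) ^ s) ^ r) ∨
        ∀ r : ℕ, 0 < r → ‖normSum (AlgebraicClosure F) ψ (2 * s * r) -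
          (u * (Fintype.card F : ℂ) ^ (2 * s)) ^ r‖ ≤ B * ((Fintype.card F : ℝ) ^ s) ^ r) := by
  obtain ⟨α, hα⟩ : ∃ α : AlgebraicClosure F, aeval α M ≠ 0 := by
    by_contra! h
    have h2 : M.map (algebraMap F (AlgebraicClosure F)) = 0 := by
      refine Polynomial.funext fun x => ?_
      rw [eval_map_algebraMap, h x, eval_zero]
    exact hM ((Polynomial.map_eq_zero _).1 h2)
  have h_integral : IsIntegral F α := Algebra.IsIntegral.isIntegral α
  have : FiniteDimensional F (IntermediateField.adjoin F {α}) :=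
    IntermediateField.adjoin.finiteDimensional h_integral
  have : Finite (IntermediateField.adjoin F {α}) := Module.finite_of_finite F
  let : Fintype (IntermediateField.adjoin F {α}) := Fintype.ofFinite _
  have ha : aeval (IntermediateField.AdjoinSimple.gen F α) M ≠ 0 := by
    intro h
    apply hα
    have := congrArg (algebraMap (IntermediateField.adjoin F {α}) (AlgebraicClosure F)) h
    rw [map_zero, ← aeval_algebraMap_apply] at this
    exact this
  exact ⟨_, Module.finrank_pos, hψ.normSum_dichotomy_of_field
    (Module.card_eq_pow_finrank (K := F) (V := IntermediateField.adjoin F {α}))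
    Module.finrank_pos ha hm⟩

end BaseChange

section FrobeniusNorm

open UniqueFactorizationMonoid

variable {F : Type*} [Field F] [Fintype F] {Ω : Type*} [Field Ω] [Algebra F Ω]

variable (F) in
/-- The characteristic polynomial of `β ∈ F_{q^j}` as a polynomial over `F`. -/
def charPolyOver (j : ℕ) (β : Ω) : F[X] := fixedLift F (normPoly F j β)

variable {j : ℕ} {β : Ω}

theorem normPoly_eq_twistProd : normPoly F j β = twistProd F j (X - C β) := by
  simp [normPoly, twistProd]

theorem map_charPolyOver (hβ : β ^ Fintype.card F ^ j = β) :
    (charPolyOver F j β).map (algebraMap F Ω) = normPoly F j β := by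
  refine map_fixedLift_of_map_eq ?_
  rw [normPoly_eq_twistProd]
  exact map_twistProd (by simp [hβ])

theorem monic_charPolyOver (hβ : β ^ Fintype.card F ^ j = β) : (charPolyOver F j β).Monic := by
  rw [← monic_map_iff (f := algebraMap F Ω), map_charPolyOver hβ]
  exact monic_prod_of_monic _ _ fun _ _ => monic_X_sub_C _

theorem natDegree_charPolyOver (hβ : β ^ Fintype.card F ^ j = β) :
    (charPolyOver F j β).natDegree = j := by
  rw [← natDegree_map (algebraMap F Ω), map_charPolyOver hβ, normPoly,
    natDegree_prod_of_monic _ _ fun _ _ => monic_X_sub_C _]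
  simp_rw [natDegree_X_sub_C]
  simp

theorem isIntegral_of_pow_card_eq (hj : 0 < j) (hβ : β ^ Fintype.card F ^ j = β) :
    IsIntegral F β := by
  refine ⟨charPolyOver F j β, monic_charPolyOver hβ, ?_⟩
  rw [← aeval_def, aeval_def, eval₂_eq_eval_map, map_charPolyOver hβ, normPoly, eval_prod]
  exact Finset.prod_eq_zero (i := 0) (by simpa using hj) (by simp)

theorem charPolyOver_eq_pow [IsAlgClosed Ω] (hj : 0 < j) (hβ : β ^ Fintype.card F ^ j = β) :
    ∃ k, charPolyOver F j β = minpoly F β ^ k ∧ k * (minpoly F β).natDegree = j := by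
  have hm := monic_charPolyOver hβ
  have h_integral := isIntegral_of_pow_card_eq hj hβ
  have hall : ∀ R ∈ normalizedFactors (charPolyOver F j β), R = minpoly F β := by
    intro R hR
    have hirr := irreducible_of_normalized_factor R hR
    have hRm : R.Monic := by
      have := normalize_normalized_factor R hR
      rw [← this]
      exact monic_normalize hirr.ne_zero
    have hdvd := dvd_of_mem_normalizedFactors hR
    obtain ⟨x, hx⟩ := IsAlgClosed.exists_aeval_eq_zero Ω R hirr.degree_pos.ne'
    have h1 : aeval x (charPolyOver F j β) = 0 := by
      obtain ⟨w, hw⟩ := hdvd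
      rw [hw, map_mul, hx, zero_mul]
    rw [aeval_def, eval₂_eq_eval_map, map_charPolyOver hβ, normPoly, eval_prod,
      Finset.prod_eq_zero_iff] at h1
    obtain ⟨i, -, hi⟩ := h1
    rw [eval_sub, eval_X, eval_C, sub_eq_zero] at hi
    rw [minpoly.eq_of_irreducible_of_monic hirr hx hRm, hi, ← frobPow_apply (F := F)]
    exact minpoly.algHom_eq _ (frobPow F Ω i).injective β
  have hprod := prod_normalizedFactors_eq hm.ne_zero
  rw [hm.normalize_eq_self] at hprod
  rw [Multiset.eq_replicate.2 ⟨rfl, hall⟩, Multiset.prod_replicate] at hprod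
  refine ⟨_, hprod.symm, ?_⟩
  rw [← (minpoly.monic h_integral).natDegree_pow, hprod, natDegree_charPolyOver hβ]

theorem pow_card_natDegree_minpoly {β : Ω} (hβ : IsIntegral F β) :
    β ^ Fintype.card F ^ (minpoly F β).natDegree = β := by
  have := IntermediateField.adjoin.finiteDimensional hβ
  have : Finite (IntermediateField.adjoin F {β}) := Module.finite_of_finite F
  let _ : Fintype (IntermediateField.adjoin F {β}) := Fintype.ofFinite _
  have h := FiniteField.pow_card (IntermediateField.AdjoinSimple.gen F β)
  rw [Module.card_eq_pow_finrank (K := F) (V := IntermediateField.adjoin F {β}),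
    IntermediateField.adjoin.finrank hβ] at h
  exact congrArg (algebraMap _ Ω) h

/-- The elements of `F_{q^j}` with a given minimal polynomial. -/
theorem card_filter_minpoly_eq [IsAlgClosed Ω] (hj : 0 < j) {P : F[X]} (hP : Irreducible P)
    (hm : P.Monic) :
    ((fixFinset F Ω j).filter fun β => minpoly F β = P).card =
      if P.natDegree ∣ j then P.natDegree else 0 := by
  split_ifs with hd
  · have h1 := card_rootSet_eq_natDegree (K := Ω) (PerfectField.separable_of_irreducible hP)
      (IsAlgClosed.splits _)
    rw [← h1, ← Set.toFinset_card]
    congr 1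
    ext β
    rw [Finset.mem_filter, Set.mem_toFinset, mem_rootSet, mem_fixFinset hj]
    constructor
    · rintro ⟨-, h⟩
      exact ⟨hP.ne_zero, h ▸ minpoly.aeval F β⟩
    · rintro ⟨-, h⟩
      have e := minpoly.eq_of_irreducible_of_monic hP h hm
      refine ⟨?_, e.symm⟩
      obtain ⟨k, rfl⟩ := hd
      have h2 := pow_card_natDegree_minpoly (F := F) (β := β) ⟨P, hm, by rwa [← aeval_def]⟩
      rw [← e] at h2
      clear h1 e hj
      induction k with
      | zero => simp
      | succ k ih => rw [mul_add_one, pow_add, pow_mul, ih, h2]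
  · rw [Finset.card_eq_zero, Finset.filter_eq_empty_iff]
    intro β hβ h
    rw [mem_fixFinset hj] at hβ
    obtain ⟨k, -, hk⟩ := charPolyOver_eq_pow hj hβ
    exact hd ⟨k, by rw [← hk, h, mul_comm]⟩

theorem charPolyOver_eq [IsAlgClosed Ω] (hj : 0 < j) (hβ : β ^ Fintype.card F ^ j = β) :
    charPolyOver F j β = minpoly F β ^ (j / (minpoly F β).natDegree) := by
  obtain ⟨k, h1, h2⟩ := charPolyOver_eq_pow hj hβ
  rw [h1]
  congr 1
  have := minpoly.natDegree_pos (isIntegral_of_pow_card_eq hj hβ)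
  rw [← h2, Nat.mul_div_cancel _ this]

/-- The von Mangoldt identity `deg f = ∑ Λ(h)` over the divisors `h` of `f`. -/
theorem sum_card_charPolyOver_dvd [IsAlgClosed Ω] {f : F[X]} (hf : f.Monic) :
    ∑ j ∈ Finset.Icc 1 f.natDegree,
      ((fixFinset F Ω j).filter fun β => charPolyOver F j β ∣ f).card = f.natDegree := by
  have hprod := prod_normalizedFactors_eq hf.ne_zero
  rw [hf.normalize_eq_self] at hprod
  have hmon : ∀ P ∈ normalizedFactors f, P.Monic ∧ Irreducible P := by
    intro P hP
    have hirr := irreducible_of_normalized_factor P hP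
    refine ⟨?_, hirr⟩
    have := normalize_normalized_factor P hP
    rw [← this]
    exact monic_normalize hirr.ne_zero
  have hdeg : f.natDegree = ∑ P ∈ (normalizedFactors f).toFinset,
      (normalizedFactors f).count P * P.natDegree := by
    conv_lhs => rw [← hprod]
    rw [natDegree_multiset_prod_of_monic _ fun P hP => (hmon P hP).1,
      Finset.sum_multiset_map_count]
    rfl
  have hcount : ∀ P ∈ normalizedFactors f, ∀ i : ℕ,
      P ^ i ∣ f ↔ i ≤ (normalizedFactors f).count P := by
    intro P hP i
    have := emultiplicity_eq_count_normalizedFactors (hmon P hP).2 hf.ne_zero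
    rw [(hmon P hP).1.normalize_eq_self] at this
    rw [pow_dvd_iff_le_emultiplicity, this, Nat.cast_le]
  have hfib : ∀ j ∈ Finset.Icc 1 f.natDegree,
      ((fixFinset F Ω j).filter fun β => charPolyOver F j β ∣ f).card =
      ∑ P ∈ (normalizedFactors f).toFinset,
        if P.natDegree ∣ j ∧ j / P.natDegree ≤ (normalizedFactors f).count P then P.natDegree
        else 0 := by
    intro j hj
    have hj0 : 0 < j := (Finset.mem_Icc.1 hj).1
    rw [Finset.card_eq_sum_card_fiberwise (f := fun β => minpoly F β)
      (t := (normalizedFactors f).toFinset)]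
    · refine Finset.sum_congr rfl fun P hP => ?_
      rw [Multiset.mem_toFinset] at hP
      rw [Finset.filter_filter]
      have e : ((fixFinset F Ω j).filter fun β => charPolyOver F j β ∣ f ∧ minpoly F β = P) =
          if j / P.natDegree ≤ (normalizedFactors f).count P then
            (fixFinset F Ω j).filter fun β => minpoly F β = P else ∅ := by
        split_ifs with h
        · refine Finset.filter_congr fun β hβ => ?_
          rw [mem_fixFinset hj0] at hβ
          refine ⟨fun h => h.2, fun h' => ⟨?_, h'⟩⟩
          rw [charPolyOver_eq hj0 hβ, h', hcount P hP]
          exact h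
        · rw [Finset.filter_eq_empty_iff]
          rintro β hβ ⟨h1, h2⟩
          rw [mem_fixFinset hj0] at hβ
          rw [charPolyOver_eq hj0 hβ, h2, hcount P hP] at h1
          exact h h1
      rw [e]
      by_cases h : j / P.natDegree ≤ (normalizedFactors f).count P
      · rw [if_pos h, card_filter_minpoly_eq hj0 (hmon P hP).2 (hmon P hP).1]
        simp [h]
      · rw [if_neg h, if_neg (fun h' => h h'.2), Finset.card_empty]
    · intro β hβ
      rw [Finset.mem_coe, Finset.mem_filter, mem_fixFinset hj0] at hβ
      rw [Finset.mem_coe, Multiset.mem_toFinset]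
      have h_integral := isIntegral_of_pow_card_eq hj0 hβ.1
      have hirr := minpoly.irreducible h_integral
      have hd : minpoly F β ∣ f := by
        refine dvd_trans ?_ hβ.2
        obtain ⟨k, h1, h2⟩ := charPolyOver_eq_pow hj0 hβ.1
        rw [h1]
        refine dvd_pow_self _ fun h => ?_
        rw [h, zero_mul] at h2
        omega
      obtain ⟨P, hP, hass⟩ := exists_mem_normalizedFactors_of_dvd hf.ne_zero hirr hd
      have e := eq_of_monic_of_associated (minpoly.monic h_integral) (hmon P hP).1 hass
      beta_reduce
      rwa [e]
  rw [Finset.sum_congr rfl hfib, Finset.sum_comm]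
  conv_rhs => rw [hdeg]
  refine Finset.sum_congr rfl fun P hP => ?_
  rw [Multiset.mem_toFinset] at hP
  have hpos : 0 < P.natDegree := (hmon P hP).2.natDegree_pos
  rw [← Finset.sum_filter, Finset.sum_const, smul_eq_mul]
  congr 1
  have hle : (normalizedFactors f).count P * P.natDegree ≤ f.natDegree := by
    conv_rhs => rw [hdeg]
    exact Finset.single_le_sum (f := fun P => (normalizedFactors f).count P * P.natDegree)
      (fun _ _ => Nat.zero_le _) (Multiset.mem_toFinset.2 hP)
  generalize (normalizedFactors f).count P = k at hle
  generalize P.natDegree = d at hle hpos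
  have e : (Finset.Icc 1 f.natDegree).filter (fun a => d ∣ a ∧ a / d ≤ k) =
      (Finset.Icc 1 k).image (fun i => d * i) := by
    ext a
    simp only [Finset.mem_filter, Finset.mem_image, Finset.mem_Icc]
    constructor
    · rintro ⟨⟨h1, -⟩, ⟨i, rfl⟩, h2⟩
      rw [Nat.mul_div_cancel_left _ hpos] at h2
      exact ⟨i, ⟨Nat.pos_of_mul_pos_left h1, h2⟩, rfl⟩
    · rintro ⟨i, ⟨h1, h2⟩, rfl⟩
      refine ⟨⟨Nat.mul_pos hpos h1, ?_⟩, dvd_mul_right _ _, ?_⟩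
      · refine le_trans ?_ hle
        rw [mul_comm]
        exact Nat.mul_le_mul_right _ h2
      · rwa [Nat.mul_div_cancel_left _ hpos]
  rw [e, Finset.card_image_of_injective _ fun a b h => Nat.eq_of_mul_eq_mul_left hpos h,
    Nat.card_Icc, Nat.add_sub_cancel]

end FrobeniusNorm

section LFunction

variable {F : Type*} [Field F] [Fintype F]

variable (F) in
/-- The monic polynomials of degree `n`. -/
def monicFinset (n : ℕ) : Finset F[X] :=
  (polyLT F (n + 1)).filter fun f => f.Monic ∧ f.natDegree = n

theorem mem_monicFinset {n : ℕ} {f : F[X]} :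
    f ∈ monicFinset F n ↔ f.Monic ∧ f.natDegree = n := by
  rw [monicFinset, Finset.mem_filter, mem_polyLT, and_iff_right_iff_imp]
  rintro ⟨-, rfl⟩
  exact degree_le_natDegree.trans_lt (by exact_mod_cast Nat.lt_succ_self _)

theorem monicFinset_zero : monicFinset F 0 = {1} := by
  ext f
  rw [mem_monicFinset, Finset.mem_singleton]
  constructor
  · rintro ⟨h1, h2⟩
    exact h1.natDegree_eq_zero.1 h2
  · rintro rfl
    exact ⟨monic_one, natDegree_one⟩

/-- The coefficients of the `L`-function of a character. -/
def charSum (ψ : F[X] → ℂ) (n : ℕ) : ℂ := ∑ f ∈ monicFinset F n, ψ f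

variable {M : F[X]} {m : ℕ} {ψ : F[X] → ℂ}

theorem RayChar.sum_filter_dvd (hψ : RayChar M m ψ) {j n : ℕ} (hjn : j ≤ n) {h : F[X]}
    (hh : h.Monic) (hj : h.natDegree = j) :
    ∑ f ∈ (monicFinset F n).filter (fun f => h ∣ f), ψ f = ψ h * charSum ψ (n - j) := by
  rw [charSum, Finset.mul_sum]
  symm
  refine Finset.sum_bij (fun g _ => h * g) ?_ ?_ ?_ ?_
  · intro g hg
    rw [mem_monicFinset] at hg
    rw [Finset.mem_filter, mem_monicFinset, hh.natDegree_mul hg.1, hj, hg.2]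
    exact ⟨⟨hh.mul hg.1, by omega⟩, dvd_mul_right _ _⟩
  · intro a _ b _ e
    exact mul_left_cancel₀ hh.ne_zero e
  · intro f hf
    rw [Finset.mem_filter, mem_monicFinset] at hf
    obtain ⟨⟨h1, h2⟩, g, rfl⟩ := hf
    have hg := hh.of_mul_monic_left h1
    refine ⟨g, ?_, rfl⟩
    rw [mem_monicFinset]
    rw [hh.natDegree_mul hg] at h2
    exact ⟨hg, by omega⟩
  · intro g hg
    rw [hψ.map_mul _ _ hh (mem_monicFinset.1 hg).1]

variable {Ω : Type*} [Field Ω] [Algebra F Ω] [IsAlgClosed Ω]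

theorem RayChar.mul_charSum (hψ : RayChar M m ψ) (n : ℕ) :
    (n : ℂ) * charSum ψ n =
      ∑ j ∈ Finset.Icc 1 n, normSum Ω ψ j * charSum ψ (n - j) := by
  have h1 : ∀ f ∈ monicFinset F n, (n : ℂ) * ψ f = ∑ j ∈ Finset.Icc 1 n,
      ∑ β ∈ fixFinset F Ω j, if charPolyOver F j β ∣ f then ψ f else 0 := by
    intro f hf
    rw [mem_monicFinset] at hf
    have h := sum_card_charPolyOver_dvd (Ω := Ω) hf.1
    rw [hf.2] at h
    conv_lhs => rw [← h]
    rw [Nat.cast_sum, Finset.sum_mul]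
    refine Finset.sum_congr rfl fun j _ => ?_
    rw [← Finset.sum_filter, Finset.sum_const, nsmul_eq_mul]
  rw [charSum, Finset.mul_sum, Finset.sum_congr rfl h1, Finset.sum_comm]
  refine Finset.sum_congr rfl fun j hj => ?_
  rw [Finset.mem_Icc] at hj
  rw [Finset.sum_comm, normSum, Finset.sum_mul]
  refine Finset.sum_congr rfl fun β hβ => ?_
  rw [mem_fixFinset hj.1] at hβ
  rw [← Finset.sum_filter, hψ.sum_filter_dvd hj.2 (monic_charPolyOver hβ)
    (natDegree_charPolyOver hβ)]
  rfl

theorem RayChar.derivative_mk_charSum (hψ : RayChar M m ψ) :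
    PowerSeries.derivative ℂ (PowerSeries.mk (charSum ψ)) =
      PowerSeries.mk (fun n => normSum Ω ψ (n + 1)) * PowerSeries.mk (charSum ψ) := by
  ext n
  rw [PowerSeries.coeff_derivative, PowerSeries.coeff_mk, PowerSeries.coeff_mul, mul_comm]
  have := hψ.mul_charSum (Ω := Ω) (n + 1)
  push_cast at this
  have e := Finset.sum_Ico_add' (fun j => normSum Ω ψ j * charSum ψ (n + 1 - j)) 0 (n + 1) 1
  have e2 : Finset.Icc 1 (n + 1) = Finset.Ico (0 + 1) (n + 1 + 1) := by
    ext
    simp only [Finset.mem_Icc, Finset.mem_Ico]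
    omega
  rw [this, e2, ← e, Finset.Nat.sum_antidiagonal_eq_sum_range_succ_mk, Finset.range_eq_Ico]
  refine Finset.sum_congr rfl fun j _ => ?_
  rw [PowerSeries.coeff_mk, PowerSeries.coeff_mk, Nat.add_sub_add_right]

/-- A complex polynomial with constant term one is a product of factors `1 - ρ X`. -/
theorem exists_eq_prod_one_sub (L : ℂ[X]) (h0 : L.coeff 0 = 1) :
    ∃ (k : ℕ) (ρ : Fin k → ℂ), k ≤ L.natDegree ∧ L = ∏ i, (1 - C (ρ i) * X) := by
  obtain ⟨n, hn⟩ : ∃ n, L.natDegree = n := ⟨_, rfl⟩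
  induction n generalizing L with
  | zero =>
    refine ⟨0, Fin.elim0, Nat.zero_le _, ?_⟩
    rw [eq_C_of_natDegree_eq_zero hn, h0]
    simp
  | succ n ih =>
    obtain ⟨z, hz⟩ := IsAlgClosed.exists_root L (by
      intro h
      rw [natDegree, h] at hn
      simp at hn)
    have hz0 : z ≠ 0 := by
      rintro rfl
      rw [IsRoot.def, ← coeff_zero_eq_eval_zero, h0] at hz
      exact one_ne_zero hz
    obtain ⟨L', rfl⟩ := dvd_iff_isRoot.2 hz
    have e : (X - C z) * L' = (1 - C z⁻¹ * X) * (C (-z) * L') := by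
      have : (C z⁻¹ * C z : ℂ[X]) = 1 := by rw [← C_mul, inv_mul_cancel₀ hz0, C_1]
      rw [C_neg]
      linear_combination X * L' * this.symm
    have hL : L' ≠ 0 := by rintro rfl; simp at h0
    have h0' : (C (-z) * L').coeff 0 = 1 := by
      rw [e, mul_coeff_zero] at h0
      simpa using h0
    have hd : (C (-z) * L').natDegree = n := by
      rw [natDegree_C_mul (neg_ne_zero.2 hz0)]
      rw [natDegree_mul (X_sub_C_ne_zero z) hL, natDegree_X_sub_C] at hn
      omega
    obtain ⟨k, ρ, hk, hρ⟩ := ih _ h0' hd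
    refine ⟨k + 1, Fin.cons z⁻¹ ρ, by omega, ?_⟩
    rw [Fin.prod_univ_succ, e]
    simp only [Fin.cons_zero, Fin.cons_succ]
    rw [← hρ]

theorem derivative_prod_one_sub {k : ℕ} (ρ : Fin k → ℂ) :
    PowerSeries.derivative ℂ ((∏ i, (1 - C (ρ i) * X) : ℂ[X]) : PowerSeries ℂ) =
      PowerSeries.mk (fun n => -∑ i, ρ i ^ (n + 1)) *
        ((∏ i, (1 - C (ρ i) * X) : ℂ[X]) : PowerSeries ℂ) := by
  induction k with
  | zero =>
    simp only [Finset.univ_eq_empty, Finset.prod_empty, Finset.sum_empty, neg_zero]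
    have : (PowerSeries.mk fun _ => (0 : ℂ)) = 0 := by ext; simp
    rw [this]
    simp
  | succ k ih =>
    have hg : PowerSeries.mk (fun n => ρ 0 ^ (n + 1)) * (1 - PowerSeries.C (ρ 0) * PowerSeries.X) =
        PowerSeries.C (ρ 0) := by
      ext n
      rw [mul_sub, mul_one, map_sub, mul_comm (PowerSeries.C (ρ 0)), ← mul_assoc,
        PowerSeries.coeff_mul_C, PowerSeries.coeff_C]
      cases n with
      | zero => simp
      | succ n => simp [PowerSeries.coeff_succ_mul_X, pow_succ]
    have hs : PowerSeries.mk (fun n => -∑ i, ρ i ^ (n + 1)) =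
        PowerSeries.mk (fun n => -∑ i : Fin k, ρ i.succ ^ (n + 1)) -
          PowerSeries.mk (fun n => ρ 0 ^ (n + 1)) := by
      ext n
      simp [Fin.sum_univ_succ]
      ring
    have hc : ((1 - C (ρ 0) * X : ℂ[X]) : PowerSeries ℂ) =
        1 - PowerSeries.C (ρ 0) * PowerSeries.X := by simp
    have hd : PowerSeries.derivative ℂ ((1 - C (ρ 0) * X : ℂ[X]) : PowerSeries ℂ) =
        -PowerSeries.C (ρ 0) := by
      rw [PowerSeries.derivative_coe]
      simp
    rw [Fin.prod_univ_succ, Polynomial.coe_mul, Derivation.leibniz, ih, hd, hs, hc]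
    simp only [smul_eq_mul]
    linear_combination ((∏ i : Fin k, (1 - C (ρ i.succ) * X) : ℂ[X]) : PowerSeries ℂ) * hg

theorem RayChar.exists_normSum_eq (hψ : RayChar M m ψ) {K : ℕ}
    (hK : ∀ n, K ≤ n → charSum ψ n = 0) :
    ∃ (k : ℕ) (ρ : Fin k → ℂ), k ≤ K ∧ ∀ n, 0 < n → normSum Ω ψ n = -∑ i, ρ i ^ n := by
  set L : ℂ[X] := PowerSeries.trunc K (PowerSeries.mk (charSum ψ)) with hL
  have hLA : (L : PowerSeries ℂ) = PowerSeries.mk (charSum ψ) := by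
    ext n
    rw [Polynomial.coeff_coe, hL, PowerSeries.coeff_trunc, PowerSeries.coeff_mk]
    split_ifs with h
    · rfl
    · exact (hK n (not_lt.1 h)).symm
  have h0 : L.coeff 0 = 1 := by
    rw [← Polynomial.coeff_coe, hLA, PowerSeries.coeff_mk, charSum, monicFinset_zero,
      Finset.sum_singleton, hψ.map_one]
  obtain ⟨k, ρ, hk, hρ⟩ := exists_eq_prod_one_sub L h0
  refine ⟨k, ρ, hk.trans ?_, ?_⟩
  · rw [natDegree_le_iff_coeff_eq_zero]
    intro n hn
    rw [hL, PowerSeries.coeff_trunc, if_neg (by omega)]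
  · have h1 := derivative_prod_one_sub ρ
    rw [← hρ, hLA, hψ.derivative_mk_charSum (Ω := Ω)] at h1
    have hne : PowerSeries.mk (charSum ψ) ≠ 0 := by
      intro h
      rw [h] at hLA
      rw [← Polynomial.coeff_coe, hLA, map_zero] at h0
      exact zero_ne_one h0
    have h2 := mul_right_cancel₀ hne h1
    intro n hn
    obtain ⟨n, rfl⟩ := Nat.exists_eq_succ_of_ne_zero hn.ne'
    simpa using congrArg (PowerSeries.coeff n) h2

/-- The Riemann hypothesis for a ray class character whose `L`-function is a polynomial. -/
theorem RayChar.norm_normSum_le (hψ : RayChar M m ψ) (hM : M ≠ 0) (hm : 1 ≤ m) {K : ℕ}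
    (hK : ∀ n, K ≤ n → charSum ψ n = 0) {n : ℕ} (hn : 0 < n) :
    ‖normSum (AlgebraicClosure F) ψ n‖ ≤ K * √(Fintype.card F) ^ n := by
  obtain ⟨k, ρ, hk, hρ⟩ := hψ.exists_normSum_eq (Ω := AlgebraicClosure F) hK
  obtain ⟨s, hs, u, hu, B, hB, h⟩ := hψ.normSum_dichotomy hM hm
  set q : ℝ := ((Fintype.card F : ℕ) : ℝ) with hq
  have hq1 : 1 < q := by
    rw [hq]; exact_mod_cast Fintype.one_lt_card
  have hqs : 1 < q ^ s := one_lt_pow₀ hq1 hs.ne'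
  have hroot : ∀ i, ‖ρ i‖ ≤ √q := by
    intro i
    rcases h with h | h
    · have h1 := norm_le_of_powerSum_le (fun i => ρ i ^ (2 * s)) (max B k) (q ^ s) (by positivity)
        (fun r => ?_) i
      · beta_reduce at h1
        rw [norm_pow, pow_mul] at h1
        have h2 := (pow_le_pow_iff_left₀ (by positivity) (by positivity) hs.ne').1 h1
        exact Real.le_sqrt_of_sq_le h2
      · rcases Nat.eq_zero_or_pos r with rfl | hr
        · simp
        · have h1 := h r hr
          rw [hρ _ (by positivity), norm_neg] at h1
          simp_rw [← pow_mul] at h1 ⊢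
          refine h1.trans ?_
          gcongr
          exact le_max_left _ _
    · exfalso
      have h1 := norm_le_of_powerSum_le
        (fun i : Option (Fin k) => i.elim (u * (Fintype.card F : ℂ) ^ (2 * s))
          fun i => ρ i ^ (2 * s)) (max B (k + 1)) (q ^ s) (by positivity) (fun r => ?_) none
      · simp only [Option.elim_none, norm_mul, hu, one_mul, norm_pow, Complex.norm_natCast] at h1
        rw [← hq, mul_comm, pow_mul] at h1
        nlinarith
      · rw [Fintype.sum_option]
        simp only [Option.elim_none, Option.elim_some]
        rcases Nat.eq_zero_or_pos r with rfl | hr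
        · simp only [pow_zero, Finset.sum_const, Finset.card_univ, Fintype.card_fin, nsmul_eq_mul,
            mul_one]
          refine le_trans ?_ (le_max_right _ _)
          refine (norm_add_le _ _).trans ?_
          simp [add_comm]
        · have h1 := h r hr
          rw [hρ _ (by positivity), ← norm_neg] at h1
          simp_rw [← pow_mul] at h1 ⊢
          refine le_trans (le_of_eq ?_) (h1.trans ?_)
          · congr 1
            ring
          · gcongr
            exact le_max_left _ _
  rw [hρ n hn, norm_neg]
  refine (norm_sum_le _ _).trans ?_
  refine (Finset.sum_le_card_nsmul _ _ (√q ^ n) fun i _ => ?_).trans ?_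
  · rw [norm_pow]
    exact pow_le_pow_left₀ (norm_nonneg _) (hroot i) n
  · rw [Finset.card_univ, Fintype.card_fin, nsmul_eq_mul]
    gcongr

end LFunction

section PrimeSums

variable {F : Type*} [Field F] [Fintype F]

variable (F) in
/-- The monic irreducible polynomials of degree `n`. -/
def monicIrr (n : ℕ) : Finset F[X] := (monicFinset F n).filter Irreducible

theorem mem_monicIrr {n : ℕ} {f : F[X]} :
    f ∈ monicIrr F n ↔ f.Monic ∧ f.natDegree = n ∧ Irreducible f := by
  rw [monicIrr, Finset.mem_filter, mem_monicFinset, and_assoc]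

variable {Ω : Type*} [Field Ω] [Algebra F Ω] [IsAlgClosed Ω]

theorem sum_filter_natDegree_minpoly_eq (ψ : F[X] → ℂ) {n : ℕ} (hn : 0 < n) :
    ∑ β ∈ (fixFinset F Ω n).filter (fun β => (minpoly F β).natDegree = n),
      ψ (charPolyOver F n β) = ∑ P ∈ monicIrr F n, (n : ℂ) * ψ P := by
  rw [← Finset.sum_fiberwise_of_maps_to (g := fun β => minpoly F β) (t := monicIrr F n)]
  · refine Finset.sum_congr rfl fun P hP => ?_
    rw [mem_monicIrr] at hP
    rw [Finset.filter_filter]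
    have e : ((fixFinset F Ω n).filter fun β => (minpoly F β).natDegree = n ∧ minpoly F β = P) =
        (fixFinset F Ω n).filter fun β => minpoly F β = P := by
      refine Finset.filter_congr fun β _ => ⟨fun h => h.2, fun h => ⟨by rw [h, hP.2.1], h⟩⟩
    rw [e]
    have hc : ∀ β ∈ (fixFinset F Ω n).filter (fun β => minpoly F β = P),
        ψ (charPolyOver F n β) = ψ P := by
      intro β hβ
      rw [Finset.mem_filter, mem_fixFinset hn] at hβ
      rw [charPolyOver_eq hn hβ.1, hβ.2, hP.2.1, Nat.div_self hn, pow_one]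
    rw [Finset.sum_congr rfl hc, Finset.sum_const, card_filter_minpoly_eq hn hP.2.2 hP.1, hP.2.1,
      if_pos dvd_rfl, nsmul_eq_mul]
  · intro β hβ
    rw [Finset.mem_filter, mem_fixFinset hn] at hβ
    have h_integral := isIntegral_of_pow_card_eq hn hβ.1
    exact mem_monicIrr.2 ⟨minpoly.monic h_integral, hβ.2, minpoly.irreducible h_integral⟩

theorem card_filter_natDegree_minpoly_ne_le {n : ℕ} (hn : 0 < n) :
    (((fixFinset F Ω n).filter fun β => (minpoly F β).natDegree ≠ n).card : ℝ) ≤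
      2 * √(Fintype.card F) ^ n := by
  have h2 : 2 ≤ Fintype.card F := Fintype.one_lt_card
  have hsub : ((fixFinset F Ω n).filter fun β => (minpoly F β).natDegree ≠ n) ⊆
      (Finset.Icc 1 (n / 2)).biUnion fun d => fixFinset F Ω d := by
    intro β hβ
    rw [Finset.mem_filter, mem_fixFinset hn] at hβ
    have h_integral := isIntegral_of_pow_card_eq hn hβ.1
    have hpos := minpoly.natDegree_pos h_integral
    obtain ⟨k, -, hk⟩ := charPolyOver_eq_pow hn hβ.1
    rw [Finset.mem_biUnion]
    refine ⟨_, Finset.mem_Icc.2 ⟨hpos, ?_⟩, (mem_fixFinset hpos).2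
      (pow_card_natDegree_minpoly h_integral)⟩
    rw [Nat.le_div_iff_mul_le two_pos]
    have : 2 ≤ k := by
      rcases k with _ | _ | k
      · omega
      · exact absurd (by simpa using hk) hβ.2
      · omega
    nlinarith
  have hgeom : ∀ k : ℕ, ∑ d ∈ Finset.Icc 1 k, Fintype.card F ^ d ≤ 2 * Fintype.card F ^ k := by
    intro k
    induction k with
    | zero => simp
    | succ k ih =>
      rw [Finset.sum_Icc_succ_top (by omega), two_mul]
      gcongr
      refine ih.trans ?_
      rw [pow_succ, mul_comm]
      gcongr
  have h3 : ((fixFinset F Ω n).filter fun β => (minpoly F β).natDegree ≠ n).card ≤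
      2 * Fintype.card F ^ (n / 2) := by
    refine (Finset.card_le_card hsub).trans (Finset.card_biUnion_le.trans ?_)
    refine le_trans (le_of_eq ?_) (hgeom _)
    refine Finset.sum_congr rfl fun d hd => card_fixFinset (Finset.mem_Icc.1 hd).1
  have h1 : (1 : ℝ) ≤ √(Fintype.card F) := by
    rw [Real.one_le_sqrt]
    exact_mod_cast Fintype.card_pos
  calc _ ≤ ((2 * Fintype.card F ^ (n / 2) : ℕ) : ℝ) := by exact_mod_cast h3
    _ = 2 * √(Fintype.card F) ^ (2 * (n / 2)) := by
      rw [pow_mul, Real.sq_sqrt (Nat.cast_nonneg _)]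
      push_cast
      rfl
    _ ≤ _ := by
      gcongr
      omega

theorem norm_normSum_sub_le {ψ : F[X] → ℂ} (hψ : ∀ f, ‖ψ f‖ ≤ 1) {n : ℕ} (hn : 0 < n) :
    ‖normSum Ω ψ n - ∑ P ∈ monicIrr F n, (n : ℂ) * ψ P‖ ≤ 2 * √(Fintype.card F) ^ n := by
  rw [← sum_filter_natDegree_minpoly_eq (Ω := Ω) ψ hn, normSum,
    ← Finset.sum_filter_add_sum_filter_not _ (fun β => (minpoly F β).natDegree = n)]
  have e : ∀ A B : ℂ, A + B - A = B := fun A B => add_sub_cancel_left _ _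
  refine (congrArg norm (e _ _)).le.trans ?_
  refine (norm_sum_le _ _).trans ((Finset.sum_le_card_nsmul _ _ 1 fun β _ => hψ _).trans ?_)
  simpa using card_filter_natDegree_minpoly_ne_le (F := F) (Ω := Ω) hn

/-- The prime number theorem. -/
theorem norm_card_monicIrr_sub_le {n : ℕ} (hn : 0 < n) :
    ‖∑ _P ∈ monicIrr F n, (n : ℂ) - (Fintype.card F : ℂ) ^ n‖ ≤ 2 * √(Fintype.card F) ^ n := by
  have h := norm_normSum_sub_le (F := F) (Ω := AlgebraicClosure F) (ψ := fun _ => 1) (by simp) hn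
  rw [normSum, Finset.sum_const, card_fixFinset hn, norm_sub_rev] at h
  simpa using h

/-- The prime number theorem for a nontrivial character. -/
theorem RayChar.norm_sum_monicIrr_le {M : F[X]} {m : ℕ} {ψ : F[X] → ℂ} (hψ : RayChar M m ψ)
    (hM : M ≠ 0) (hm : 1 ≤ m) {K : ℕ} (hK : ∀ n, K ≤ n → charSum ψ n = 0) {n : ℕ} (hn : 0 < n) :
    ‖∑ P ∈ monicIrr F n, (n : ℂ) * ψ P‖ ≤ (K + 2) * √(Fintype.card F) ^ n := by
  have h1 := norm_normSum_sub_le (Ω := AlgebraicClosure F) hψ.norm_le hn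
  have h2 := hψ.norm_normSum_le hM hm hK hn
  rw [add_mul]
  refine le_trans ?_ (add_le_add h2 h1)
  refine le_trans (le_of_eq ?_) (norm_sub_le _ _)
  congr 1
  ring

end PrimeSums

section FiniteFourier

/-- The average of `h ∘ L` over a finite group equals the average of `h`, for surjective `L`. -/
theorem card_mul_sum_comp {A B : Type*} [AddCommGroup A] [AddCommGroup B] [Fintype B]
    {V : Finset A} (hadd : ∀ x ∈ V, ∀ y ∈ V, x + y ∈ V) (hneg : ∀ x ∈ V, -x ∈ V)
    (L : A →+ B) (hL : ∀ b, ∃ v ∈ V, L v = b) (h : B → ℂ) :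
    (Fintype.card B : ℂ) * ∑ v ∈ V, h (L v) = V.card * ∑ b, h b := by
  have key : ∀ b, ∑ v ∈ V, h (L v) = ∑ v ∈ V, h (L v + b) := by
    intro b
    obtain ⟨w, hw, rfl⟩ := hL b
    symm
    refine Finset.sum_bij (fun v _ => v + w) (fun v hv => hadd v hv w hw)
      (fun a _ c _ e => add_right_cancel e) (fun v hv => ⟨v + -w, hadd v hv _ (hneg w hw), ?_⟩)
      (fun v _ => ?_)
    · exact neg_add_cancel_right v w
    · rw [map_add]
  calc (Fintype.card B : ℂ) * ∑ v ∈ V, h (L v) = ∑ b : B, ∑ v ∈ V, h (L v) := by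
        rw [Finset.sum_const, Finset.card_univ, nsmul_eq_mul]
    _ = ∑ b : B, ∑ v ∈ V, h (L v + b) := Finset.sum_congr rfl fun b _ => key b
    _ = ∑ v ∈ V, ∑ b : B, h (L v + b) := Finset.sum_comm
    _ = ∑ v ∈ V, ∑ b : B, h b :=
        Finset.sum_congr rfl fun v _ => Fintype.sum_equiv (Equiv.addLeft (L v)) _ _ fun _ => rfl
    _ = _ := by rw [Finset.sum_const, nsmul_eq_mul]

/-- Parseval's identity on a finite abelian group. -/
theorem sum_norm_sq_sum_mul_addChar {A : Type*} [AddCommGroup A] [Fintype A] (E : A → ℂ) :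
    ∑ χ : AddChar A ℂ, ‖∑ a, E a * χ a‖ ^ 2 = Fintype.card A * ∑ a, ‖E a‖ ^ 2 := by
  have h : (∑ χ : AddChar A ℂ, ((‖∑ a, E a * χ a‖ ^ 2 : ℝ) : ℂ)) =
      Fintype.card A * ∑ a, ((‖E a‖ ^ 2 : ℝ) : ℂ) := by
    have e1 : ∀ χ : AddChar A ℂ, ((‖∑ a, E a * χ a‖ ^ 2 : ℝ) : ℂ) =
        ∑ a, ∑ b, E a * starRingEnd ℂ (E b) * χ (a - b) := by
      intro χ
      rw [← Complex.normSq_eq_norm_sq, ← Complex.mul_conj, map_sum, Finset.sum_mul_sum]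
      refine Finset.sum_congr rfl fun a _ => Finset.sum_congr rfl fun b _ => ?_
      rw [map_mul, sub_eq_add_neg, AddChar.map_add_eq_mul, AddChar.map_neg_eq_conj]
      ring
    simp_rw [e1]
    rw [Finset.sum_comm, Finset.mul_sum]
    refine Finset.sum_congr rfl fun a _ => ?_
    rw [Finset.sum_comm, Finset.sum_eq_single a]
    · rw [← Finset.mul_sum, AddChar.sum_apply_eq_ite, if_pos (sub_self a),
        ← Complex.normSq_eq_norm_sq, ← Complex.mul_conj]
      ring
    · intro b _ hb
      rw [← Finset.mul_sum, AddChar.sum_apply_eq_ite, if_neg (sub_ne_zero.2 (Ne.symm hb)), mul_zero]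
    · simp
  exact_mod_cast h

theorem norm_sum_mul_le_of_addChar {A : Type*} [AddCommGroup A] [Fintype A] {E φ : A → ℂ}
    {B K : ℝ} (hB : 0 ≤ B) (hE : ∀ χ : AddChar A ℂ, ‖∑ a, E a * χ a‖ ≤ B) (hφ : ∀ a, ‖φ a‖ ≤ K) :
    ‖∑ a, E a * φ a‖ ≤ K * √(Fintype.card A) * B := by
  have hK : 0 ≤ K := (norm_nonneg _).trans (hφ 0)
  have hcard : (0 : ℝ) < Fintype.card A := by exact_mod_cast Fintype.card_pos
  have h1 : ∑ a, ‖E a‖ ^ 2 ≤ B ^ 2 := by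
    have := sum_norm_sq_sum_mul_addChar E
    have h2 : ∑ χ : AddChar A ℂ, ‖∑ a, E a * χ a‖ ^ 2 ≤ ∑ _χ : AddChar A ℂ, B ^ 2 :=
      Finset.sum_le_sum fun χ _ => by
        have := hE χ
        gcongr
    rw [this, Finset.sum_const, Finset.card_univ, AddChar.card_eq, nsmul_eq_mul] at h2
    exact le_of_mul_le_mul_left h2 hcard
  have h3 : ∑ a, ‖E a‖ ≤ √(Fintype.card A) * B := by
    refine le_of_sq_le_sq ?_ (by positivity)
    rw [mul_pow, Real.sq_sqrt hcard.le]
    refine (sq_sum_le_card_mul_sum_sq (s := Finset.univ) (f := fun a => ‖E a‖)).trans ?_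
    rw [Finset.card_univ]
    gcongr
  calc ‖∑ a, E a * φ a‖ ≤ ∑ a, ‖E a * φ a‖ := norm_sum_le _ _
    _ ≤ ∑ a, ‖E a‖ * K := Finset.sum_le_sum fun a _ => by
        rw [norm_mul]
        gcongr
        exact hφ a
    _ = K * ∑ a, ‖E a‖ := by rw [← Finset.sum_mul, mul_comm]
    _ ≤ K * (√(Fintype.card A) * B) := by gcongr
    _ = _ := by ring

end FiniteFourier

section RayClass

variable {F : Type*} [Field F] [Fintype F]

variable (F) in
/-- The polynomials of degree exactly `n`. -/
def degFinset (n : ℕ) : Finset F[X] := (polyLT F (n + 1)).filter fun f => f.degree = n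

theorem mem_degFinset {n : ℕ} {f : F[X]} : f ∈ degFinset F n ↔ f.degree = n := by
  rw [degFinset, Finset.mem_filter, mem_polyLT, and_iff_right_iff_imp]
  intro h
  rw [h]
  exact_mod_cast n.lt_succ_self

variable (F) in
/-- The irreducible polynomials of degree `n`. -/
def irrFinset (n : ℕ) : Finset F[X] := (degFinset F n).filter Irreducible

theorem mem_irrFinset {n : ℕ} {f : F[X]} : f ∈ irrFinset F n ↔ f.degree = n ∧ Irreducible f := by
  rw [irrFinset, Finset.mem_filter, mem_degFinset]

theorem degree_C_unit_mul (c : Fˣ) (f : F[X]) : (C (c : F) * f).degree = f.degree := by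
  rw [degree_mul, degree_C c.ne_zero, zero_add]

theorem irreducible_C_unit_mul (c : Fˣ) {f : F[X]} : Irreducible (C (c : F) * f) ↔ Irreducible f :=
  irreducible_isUnit_mul (isUnit_C.2 c.isUnit)

theorem sum_degFinset_filter {E : Type*} [AddCommMonoid E] (n : ℕ) (p : F[X] → Prop)
    (hp : ∀ (c : Fˣ) f, p (C (c : F) * f) ↔ p f) (h : F[X] → E) :
    ∑ f ∈ (degFinset F n).filter p, h f =
      ∑ c : Fˣ, ∑ f ∈ (monicFinset F n).filter p, h (C (c : F) * f) := by
  rw [← Finset.sum_product']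
  symm
  refine Finset.sum_bij (fun x _ => C (x.1 : F) * x.2) ?_ ?_ ?_ (fun _ _ => rfl)
  · rintro ⟨c, f⟩ hx
    simp only [Finset.mem_product, Finset.mem_filter, mem_monicFinset] at hx
    rw [Finset.mem_filter, mem_degFinset, degree_C_unit_mul, degree_eq_natDegree hx.2.1.1.ne_zero,
      hx.2.1.2, hp]
    exact ⟨rfl, hx.2.2⟩
  · rintro ⟨c, f⟩ hx ⟨d, g⟩ hy hxy
    simp only [Finset.mem_product, Finset.mem_filter, mem_monicFinset] at hx hy
    have h1 := congrArg leadingCoeff hxy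
    simp only [leadingCoeff_mul, leadingCoeff_C, hx.2.1.1.leadingCoeff, hy.2.1.1.leadingCoeff,
      mul_one] at h1
    have h2 : c = d := Units.ext h1
    subst h2
    have h3 := mul_left_cancel₀ (C_ne_zero.2 c.ne_zero) hxy
    exact Prod.ext rfl h3
  · intro f hf
    rw [Finset.mem_filter, mem_degFinset] at hf
    have h0 : f ≠ 0 := by
      rintro rfl
      simp at hf
    have hlc : f.leadingCoeff ≠ 0 := leadingCoeff_ne_zero.2 h0
    have e : C f.leadingCoeff * (C (f.leadingCoeff)⁻¹ * f) = f := by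
      rw [← mul_assoc, ← C_mul, mul_inv_cancel₀ hlc, C_1, one_mul]
    have hd : (C (f.leadingCoeff)⁻¹ * f).degree = n := by
      have := degree_C_unit_mul (Units.mk0 _ hlc)⁻¹ f
      rw [hf.1] at this
      simpa using this
    refine ⟨⟨Units.mk0 _ hlc, C (f.leadingCoeff)⁻¹ * f⟩, ?_, e⟩
    simp only [Finset.mem_product, Finset.mem_univ, true_and, Finset.mem_filter, mem_monicFinset]
    refine ⟨⟨?_, natDegree_eq_of_degree_eq_some hd⟩, ?_⟩
    · rw [mul_comm]
      exact monic_mul_leadingCoeff_inv h0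
    · rw [← hp (Units.mk0 _ hlc), Units.val_mk0, e]
      exact hf.2

theorem sum_degFinset {E : Type*} [AddCommMonoid E] (n : ℕ) (h : F[X] → E) :
    ∑ f ∈ degFinset F n, h f = ∑ c : Fˣ, ∑ f ∈ monicFinset F n, h (C (c : F) * f) := by
  have := sum_degFinset_filter n (fun _ => True) (fun _ _ => Iff.rfl) h
  simpa using this

theorem sum_irrFinset {E : Type*} [AddCommMonoid E] (n : ℕ) (h : F[X] → E) :
    ∑ f ∈ irrFinset F n, h f = ∑ c : Fˣ, ∑ f ∈ monicIrr F n, h (C (c : F) * f) :=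
  sum_degFinset_filter n Irreducible (fun c _ => irreducible_C_unit_mul c) h

/-- The ring of residues modulo `M` and of leading coefficients modulo `X ^ m`. -/
abbrev RayRing (M : F[X]) (m : ℕ) : Type _ := AdjoinRoot M × AdjoinRoot (X ^ m : F[X])

/-- The residue modulo `M` and the first `m` leading coefficients of a polynomial of degree at
most `n`. -/
def rayClass (M : F[X]) (m n : ℕ) : F[X] →+ RayRing M m where
  toFun f := (AdjoinRoot.mk M f, AdjoinRoot.mk (X ^ m) (reflect n f))
  map_zero' := by simp
  map_add' f g := by simp [reflect_add]

theorem rayClass_apply (M : F[X]) (m n : ℕ) (f : F[X]) :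
    rayClass M m n f = (AdjoinRoot.mk M f, AdjoinRoot.mk (X ^ m) (reflect n f)) := rfl

theorem rayClass_mul (M : F[X]) (m : ℕ) {a b : ℕ} {f g : F[X]} (hf : f.natDegree ≤ a)
    (hg : g.natDegree ≤ b) :
    rayClass M m (a + b) (f * g) = rayClass M m a f * rayClass M m b g := by
  simp [rayClass_apply, reflect_mul f g hf hg]

theorem rayClass_one (M : F[X]) (m : ℕ) : rayClass M m 0 1 = 1 := by
  rw [rayClass_apply, reflect_one, pow_zero, map_one, map_one]
  rfl

theorem X_pow_dvd_reflect_iff {m n : ℕ} {f : F[X]} (hf : f.natDegree ≤ n) :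
    X ^ m ∣ reflect n f ↔ f.degree + m ≤ n ∨ f = 0 := by
  by_cases h0 : f = 0
  · simp [h0]
  rw [or_iff_left h0, X_pow_dvd_iff, degree_eq_natDegree h0]
  have e : ((f.natDegree : WithBot ℕ) + m ≤ n) ↔ f.natDegree + m ≤ n := by norm_cast
  rw [e]
  constructor
  · intro h
    by_contra hlt
    have h1 := h (n - f.natDegree) (by omega)
    rw [coeff_reflect, revAt_le (by omega), Nat.sub_sub_self hf] at h1
    exact h0 (leadingCoeff_eq_zero.1 h1)
  · intro h d hd
    rw [coeff_reflect, revAt_le (by omega)]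
    exact coeff_eq_zero_of_natDegree_lt (by omega)

theorem rayClass_eq_zero_of {M : F[X]} {m n : ℕ} {f : F[X]} (hM : M ∣ f)
    (hf : f.degree + m ≤ n) : rayClass M m n f = 0 := by
  have hn : f.natDegree ≤ n := by
    by_cases h0 : f = 0
    · simp [h0]
    rw [degree_eq_natDegree h0] at hf
    have : f.natDegree + m ≤ n := by exact_mod_cast hf
    omega
  rw [rayClass_apply, AdjoinRoot.mk_eq_zero.2 hM,
    AdjoinRoot.mk_eq_zero.2 ((X_pow_dvd_reflect_iff hn).2 (Or.inl hf))]
  rfl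

theorem rayClass_eq_zero_iff {M : F[X]} {m n : ℕ} {f : F[X]} (hf : f.degree ≤ n) :
    rayClass M m n f = 0 ↔ M ∣ f ∧ f.degree + m ≤ n := by
  refine ⟨fun h => ?_, fun h => rayClass_eq_zero_of h.1 h.2⟩
  rw [rayClass_apply, Prod.mk_eq_zero, AdjoinRoot.mk_eq_zero, AdjoinRoot.mk_eq_zero,
    X_pow_dvd_reflect_iff (natDegree_le_iff_degree_le.2 hf)] at h
  refine ⟨h.1, h.2.elim id ?_⟩
  rintro rfl
  simp

theorem AdjoinRoot.isUnit_mk_iff {M f : F[X]} : IsUnit (AdjoinRoot.mk M f) ↔ IsCoprime f M := by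
  constructor
  · intro h
    obtain ⟨b, hb⟩ := h.exists_right_inv
    obtain ⟨g, rfl⟩ := AdjoinRoot.mk_surjective b
    rw [← map_mul, ← map_one (AdjoinRoot.mk M), AdjoinRoot.mk_eq_mk] at hb
    obtain ⟨w, hw⟩ := hb
    exact ⟨g, -w, by linear_combination hw⟩
  · rintro ⟨a, b, h⟩
    refine IsUnit.of_mul_eq_one (AdjoinRoot.mk M a) ?_
    rw [← map_mul, ← map_one (AdjoinRoot.mk M), AdjoinRoot.mk_eq_mk]
    exact ⟨-b, by linear_combination h⟩

theorem isUnit_rayClass_iff {M : F[X]} {m n : ℕ} (hm : 1 ≤ m) {f : F[X]} (hf : f.degree ≤ n) :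
    IsUnit (rayClass M m n f) ↔ f.degree = n ∧ IsCoprime f M := by
  rw [rayClass_apply, Prod.isUnit_iff, AdjoinRoot.isUnit_mk_iff, AdjoinRoot.isUnit_mk_iff,
    IsCoprime.pow_right_iff hm, and_comm, isCoprime_comm (y := (X : F[X])),
    Irreducible.coprime_iff_not_dvd irreducible_X, X_dvd_iff, coeff_reflect,
    revAt_le (Nat.zero_le _),
    Nat.sub_zero]
  refine and_congr_left fun _ => ⟨fun h => le_antisymm hf (le_degree_of_ne_zero h), fun h => ?_⟩
  exact coeff_ne_zero_of_eq_degree h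

theorem exists_rayClass_eq {M : F[X]} (hM : M ≠ 0) {m n : ℕ} (hn : M.natDegree + m ≤ n)
    (b : RayRing M m) : ∃ f ∈ polyLT F (n + 1), rayClass M m n f = b := by
  obtain ⟨b₁, b₂⟩ := b
  obtain ⟨u, rfl⟩ := AdjoinRoot.mk_surjective b₁
  obtain ⟨v, rfl⟩ := AdjoinRoot.mk_surjective b₂
  have hX : (X ^ m : F[X]) ≠ 0 := pow_ne_zero _ X_ne_zero
  set v' := v % X ^ m with hv'
  have hv : v'.degree < m := by
    refine (EuclideanDomain.mod_lt v hX).trans_le ?_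
    rw [degree_X_pow]
  set f₀ := reflect n v' with hf₀
  set r := (u - f₀) % M with hr
  have hrd : r.degree < M.degree := EuclideanDomain.mod_lt _ hM
  have hv'n : v'.natDegree ≤ n := natDegree_le_iff_degree_le.2
    (hv.le.trans (by exact_mod_cast (by omega : m ≤ n)))
  have hf₀n : f₀.natDegree ≤ n := by
    refine natDegree_reflect_le.trans ?_
    simp [hv'n]
  have hrm : r.degree + m ≤ n := by
    by_cases h0 : r = 0
    · simp [h0]
    rw [degree_eq_natDegree h0, degree_eq_natDegree hM] at *
    have : r.natDegree < M.natDegree := by exact_mod_cast hrd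
    exact_mod_cast (by omega : r.natDegree + m ≤ n)
  have hrn : r.natDegree ≤ n := by
    by_cases h0 : r = 0
    · simp [h0]
    rw [degree_eq_natDegree h0] at hrm
    have : r.natDegree + m ≤ n := by exact_mod_cast hrm
    omega
  have hrefl : reflect n f₀ = v' := by rw [hf₀, reflect_reflect]
  refine ⟨f₀ + r, ?_, ?_⟩
  · rw [mem_polyLT]
    refine (degree_le_of_natDegree_le ((natDegree_add_le _ _).trans (max_le hf₀n hrn))).trans_lt ?_
    exact_mod_cast n.lt_succ_self
  · rw [rayClass_apply, Prod.mk.injEq, AdjoinRoot.mk_eq_mk, AdjoinRoot.mk_eq_mk, reflect_add, hrefl]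
    constructor
    · have h2 := EuclideanDomain.div_add_mod (u - f₀) M
      rw [← hr] at h2
      exact ⟨-((u - f₀) / M), by linear_combination h2⟩
    · have h2 := EuclideanDomain.div_add_mod v (X ^ m)
      rw [← hv'] at h2
      have h3 : X ^ m ∣ reflect n r := (X_pow_dvd_reflect_iff hrn).2 (Or.inl hrm)
      have h4 : v' + reflect n r - v = reflect n r - X ^ m * (v / X ^ m) := by
        linear_combination h2
      rw [h4]
      exact dvd_sub h3 (dvd_mul_right _ _)

instance rayRing_finite (M : F[X]) (m : ℕ) [NeZero M] : Finite (RayRing M m) := by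
  have h1 : Module.Finite F (AdjoinRoot M) := (AdjoinRoot.powerBasis (NeZero.ne M)).finite
  have h2 : Module.Finite F (AdjoinRoot (X ^ m : F[X])) :=
    (AdjoinRoot.powerBasis (pow_ne_zero m X_ne_zero)).finite
  have := Module.finite_of_finite F (M := AdjoinRoot M)
  have := Module.finite_of_finite F (M := AdjoinRoot (X ^ m : F[X]))
  infer_instance

theorem card_rayRing (M : F[X]) (m : ℕ) [NeZero M] :
    Nat.card (RayRing M m) = Fintype.card F ^ (M.natDegree + m) := by
  have h1 : Module.Finite F (AdjoinRoot M) := (AdjoinRoot.powerBasis (NeZero.ne M)).finite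
  have h2 : Module.Finite F (AdjoinRoot (X ^ m : F[X])) :=
    (AdjoinRoot.powerBasis (pow_ne_zero m X_ne_zero)).finite
  rw [Nat.card_prod, Module.natCard_eq_pow_finrank (K := F),
    Module.natCard_eq_pow_finrank (K := F) (V := AdjoinRoot (X ^ m : F[X])),
    (AdjoinRoot.powerBasis (NeZero.ne M)).finrank,
    (AdjoinRoot.powerBasis (pow_ne_zero m (X_ne_zero (R := F)))).finrank,
    AdjoinRoot.powerBasis_dim, AdjoinRoot.powerBasis_dim, natDegree_X_pow, ← pow_add,
    Nat.card_eq_fintype_card]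

theorem card_mul_sum_rayClass {M : F[X]} (hM : M ≠ 0) {m n : ℕ} (hn : M.natDegree + m ≤ n)
    [Fintype (RayRing M m)] (h : RayRing M m → ℂ) :
    (Fintype.card (RayRing M m) : ℂ) * ∑ f ∈ polyLT F (n + 1), h (rayClass M m n f) =
      (Fintype.card F : ℂ) ^ (n + 1) * ∑ b, h b := by
  rw [card_mul_sum_comp (V := polyLT F (n + 1)) _ _ (rayClass M m n)
    (fun b => exists_rayClass_eq hM hn b) h, card_polyLT, Nat.cast_pow]
  · intro x hx y hy
    rw [mem_polyLT] at *
    exact (degree_add_le _ _).trans_lt (max_lt hx hy)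
  · intro x hx
    rw [mem_polyLT, degree_neg]
    rwa [mem_polyLT] at hx

end RayClass

section RayCharacters

variable {F : Type*} [Field F] [Fintype F] {M : F[X]} {m : ℕ}

theorem MulChar.norm_apply_eq_one {B : Type*} [CommRing B] [Finite B] (χ : MulChar B ℂ) {b : B}
    (hb : IsUnit b) : ‖χ b‖ = 1 := by
  obtain ⟨u, rfl⟩ := hb
  refine Complex.norm_eq_one_of_pow_eq_one (n := Nat.card Bˣ) ?_ Nat.card_pos.ne'
  rw [← map_pow, ← Units.val_pow_eq_pow_val, pow_card_eq_one', Units.val_one, map_one]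

theorem rayChar_of_mulChar (hm : 1 ≤ m) [Finite (RayRing M m)] (χ : MulChar (RayRing M m) ℂ) :
    RayChar M m fun f => χ (rayClass M m f.natDegree f) where
  map_one := by
    rw [natDegree_one, rayClass_one, map_one]
  map_mul f g hf hg := by
    rw [hf.natDegree_mul hg, rayClass_mul M m le_rfl le_rfl, map_mul]
  congr f g _ _ hfg hM hd := by
    have := rayClass_eq_zero_of hM hd
    rw [map_sub, sub_eq_zero] at this
    rw [this, hfg]
  norm_eq f hf hM :=
    χ.norm_apply_eq_one ((isUnit_rayClass_iff hm degree_le_natDegree).2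
      ⟨degree_eq_natDegree hf.ne_zero, hM⟩)
  norm_le f := by
    by_cases h : IsUnit (rayClass M m f.natDegree f)
    · exact (χ.norm_apply_eq_one h).le
    · simp [χ.map_nonunit h]

theorem rayClass_C_mul (M : F[X]) (m : ℕ) {n : ℕ} {f : F[X]} (hf : f.natDegree ≤ n) (c : F) :
    rayClass M m n (C c * f) = rayClass M m 0 (C c) * rayClass M m n f := by
  have := rayClass_mul M m (a := 0) (natDegree_C c).le hf
  rwa [zero_add] at this

theorem sum_polyLT_eq_sum_degFinset {n : ℕ} {h : F[X] → ℂ}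
    (h0 : ∀ f ∈ polyLT F (n + 1), f ∉ degFinset F n → h f = 0) :
    ∑ f ∈ polyLT F (n + 1), h f = ∑ f ∈ degFinset F n, h f :=
  (Finset.sum_subset (Finset.filter_subset _ _) h0).symm

theorem degree_le_of_mem_polyLT {n : ℕ} {f : F[X]} (hf : f ∈ polyLT F (n + 1)) : f.degree ≤ n := by
  rw [mem_polyLT] at hf
  refine natDegree_le_iff_degree_le.1 ?_
  by_cases h0 : f = 0
  · simp [h0]
  rw [degree_eq_natDegree h0] at hf
  exact Nat.le_of_lt_succ (by exact_mod_cast hf)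

theorem charSum_mulChar_eq_zero (hM : M ≠ 0) (hm : 1 ≤ m) [Finite (RayRing M m)]
    {χ : MulChar (RayRing M m) ℂ} (hχ : χ ≠ 1) (hc : ∀ c : Fˣ, χ (rayClass M m 0 (C (c : F))) = 1)
    {n : ℕ} (hn : M.natDegree + m ≤ n) :
    charSum (fun f => χ (rayClass M m f.natDegree f)) n = 0 := by
  have := Fintype.ofFinite (RayRing M m)
  have h1 := card_mul_sum_rayClass hM hn (fun b => χ b)
  rw [MulChar.sum_eq_zero_of_ne_one hχ, mul_zero, mul_eq_zero,
    or_iff_right (by exact_mod_cast Fintype.card_ne_zero), sum_polyLT_eq_sum_degFinset,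
    sum_degFinset] at h1
  · have h2 : ∀ c : Fˣ, ∑ f ∈ monicFinset F n, χ (rayClass M m n (C (c : F) * f)) =
        charSum (fun f => χ (rayClass M m f.natDegree f)) n := by
      intro c
      refine Finset.sum_congr rfl fun f hf => ?_
      rw [mem_monicFinset] at hf
      rw [rayClass_C_mul M m hf.2.le, map_mul, hc, one_mul]
      simp only [hf.2]
    rw [Finset.sum_congr rfl fun c _ => h2 c, Finset.sum_const, nsmul_eq_mul, mul_eq_zero,
      Finset.card_univ, or_iff_right (by exact_mod_cast Fintype.card_ne_zero)] at h1
    exact h1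
  · intro f hf hf'
    refine χ.map_nonunit fun hu => hf' ?_
    exact mem_degFinset.2 ((isUnit_rayClass_iff hm (degree_le_of_mem_polyLT hf)).1 hu).1

theorem isCoprime_of_mem_irrFinset (hM : M ≠ 0) {n : ℕ} (hn : M.natDegree < n) {P : F[X]}
    (hP : P ∈ irrFinset F n) : IsCoprime P M := by
  rw [mem_irrFinset] at hP
  rw [hP.2.coprime_iff_not_dvd]
  intro h
  have := natDegree_le_of_dvd h hM
  rw [natDegree_eq_of_degree_eq_some hP.1] at this
  omega

theorem norm_sum_irrFinset_mulChar_le (hM : M ≠ 0) (hm : 1 ≤ m) [Finite (RayRing M m)]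
    {χ : MulChar (RayRing M m) ℂ} (hχ : χ ≠ 1) {n : ℕ} (hn : M.natDegree + m ≤ n) :
    ‖∑ P ∈ irrFinset F n, (n : ℂ) * χ (rayClass M m n P)‖ ≤
      Fintype.card F * ((M.natDegree + m + 2) * √(Fintype.card F) ^ n) := by
  have e : ∑ P ∈ irrFinset F n, (n : ℂ) * χ (rayClass M m n P) =
      (∑ c : Fˣ, χ (rayClass M m 0 (C (c : F)))) *
        ∑ P ∈ monicIrr F n, (n : ℂ) * χ (rayClass M m P.natDegree P) := by
    rw [sum_irrFinset, Finset.sum_mul]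
    refine Finset.sum_congr rfl fun c _ => ?_
    rw [Finset.mul_sum]
    refine Finset.sum_congr rfl fun P hP => ?_
    rw [mem_monicIrr] at hP
    rw [rayClass_C_mul M m hP.2.1.le, map_mul, hP.2.1]
    ring
  rw [e]
  have hu : ∀ c : Fˣ, IsUnit (rayClass M m 0 (C (c : F))) := by
    intro c
    exact (isUnit_rayClass_iff (n := 0) hm (by exact_mod_cast degree_C_le)).2
      ⟨by simp [degree_C c.ne_zero], C ((c⁻¹ : Fˣ) : F), 0, by
        rw [← C_mul, Units.inv_mul, C_1, zero_mul, add_zero]⟩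
  by_cases hc : ∀ c : Fˣ, χ (rayClass M m 0 (C (c : F))) = 1
  · rw [norm_mul]
    have h1 := (rayChar_of_mulChar hm χ).norm_sum_monicIrr_le hM hm
      (fun n hn => charSum_mulChar_eq_zero hM hm hχ hc hn) (n := n) (by omega)
    gcongr
    · refine (norm_sum_le _ _).trans ?_
      rw [Finset.sum_congr rfl fun c _ => χ.norm_apply_eq_one (hu c), Finset.sum_const,
        Finset.card_univ, nsmul_eq_mul, mul_one, Fintype.card_units]
      exact_mod_cast Nat.sub_le _ _
    · simpa using h1
  · push Not at hc
    obtain ⟨d, hd⟩ := hc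
    have h2 : ∑ c : Fˣ, χ (rayClass M m 0 (C (c : F))) = 0 := by
      have h3 : χ (rayClass M m 0 (C (d : F))) * ∑ c : Fˣ, χ (rayClass M m 0 (C (c : F))) =
          ∑ c : Fˣ, χ (rayClass M m 0 (C (c : F))) := by
        rw [Finset.mul_sum]
        refine Fintype.sum_equiv (Equiv.mulLeft d) _ _ fun c => ?_
        rw [← map_mul, ← rayClass_C_mul M m (natDegree_C _).le, ← C_mul]
        rfl
      have h4 : (χ (rayClass M m 0 (C (d : F))) - 1) *
          ∑ c : Fˣ, χ (rayClass M m 0 (C (c : F))) = 0 := by linear_combination h3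
      exact (mul_eq_zero.1 h4).resolve_left (sub_ne_zero.2 hd)
    rw [h2, zero_mul, norm_zero]
    positivity

theorem norm_sum_irrFinset_sub_le {n : ℕ} (hn : 0 < n) :
    ‖∑ _P ∈ irrFinset F n, (n : ℂ) - ((Fintype.card F : ℂ) - 1) * (Fintype.card F : ℂ) ^ n‖ ≤
      Fintype.card F * (2 * √(Fintype.card F) ^ n) := by
  have h := norm_card_monicIrr_sub_le (F := F) hn
  have hc : (Fintype.card Fˣ : ℂ) = (Fintype.card F : ℂ) - 1 := by
    rw [Fintype.card_units, Nat.cast_sub Fintype.card_pos, Nat.cast_one]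
  rw [sum_irrFinset, Finset.sum_const, Finset.card_univ, nsmul_eq_mul, hc, ← mul_sub, norm_mul,
    ← hc, Complex.norm_natCast]
  gcongr
  rw [Fintype.card_units]
  exact Nat.sub_le _ _

end RayCharacters

section PrimesInClasses

variable {F : Type*} [Field F] [Fintype F] {M : F[X]} {m : ℕ}

/-- The multiplicative character attached to an additive character of the unit group. -/
def AddChar.toMulChar {B : Type*} [CommRing B] (χ : AddChar (Additive Bˣ) ℂ) : MulChar B ℂ :=
  MulChar.ofUnitHom (MonoidHom.toHomUnits
    { toFun := fun u => χ (Additive.ofMul u)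
      map_one' := χ.map_zero_eq_one
      map_mul' := fun u v => χ.map_add_eq_mul (Additive.ofMul u) (Additive.ofMul v) })

theorem AddChar.toMulChar_coe {B : Type*} [CommRing B] (χ : AddChar (Additive Bˣ) ℂ) (u : Bˣ) :
    χ.toMulChar (u : B) = χ (Additive.ofMul u) := by
  rw [AddChar.toMulChar, MulChar.ofUnitHom_coe]
  rfl

/-- The polynomials of degree `n` coprime to `M`. -/
def copFinset (M : F[X]) (n : ℕ) : Finset F[X] := (degFinset F n).filter fun f => IsCoprime f M

theorem mem_copFinset {n : ℕ} {f : F[X]} :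
    f ∈ copFinset M n ↔ f.degree = n ∧ IsCoprime f M := by
  rw [copFinset, Finset.mem_filter, mem_degFinset]

theorem card_mul_sum_copFinset (hM : M ≠ 0) (hm : 1 ≤ m) {n : ℕ} (hn : M.natDegree + m ≤ n)
    [Fintype (RayRing M m)] {Φ : F[X] → ℂ} {φ : (RayRing M m)ˣ → ℂ}
    (h : ∀ f ∈ copFinset M n, ∀ u : (RayRing M m)ˣ, u = rayClass M m n f → Φ f = φ u) :
    (Fintype.card (RayRing M m) : ℂ) * ∑ f ∈ copFinset M n, Φ f =
      (Fintype.card F : ℂ) ^ (n + 1) * ∑ u, φ u := by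
  have h1 := card_mul_sum_rayClass hM hn
    (fun b => ∑ u : (RayRing M m)ˣ, if (u : RayRing M m) = b then φ u else 0)
  rw [Finset.sum_comm (s := Finset.univ)] at h1
  simp only [Finset.sum_ite_eq, Finset.mem_univ, if_true] at h1
  rw [← h1]
  congr 1
  have hsub : copFinset M n ⊆ polyLT F (n + 1) :=
    (Finset.filter_subset _ _).trans (Finset.filter_subset _ _)
  rw [← Finset.sum_subset hsub]
  · refine Finset.sum_congr rfl fun f hf => ?_
    have hf' := mem_copFinset.1 hf
    obtain ⟨u, hu⟩ := (isUnit_rayClass_iff (M := M) hm hf'.1.le).2 hf'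
    rw [Finset.sum_eq_single u, if_pos hu, h f hf u hu]
    · intro v _ hv
      rw [if_neg]
      exact fun e => hv (Units.ext (e.trans hu.symm))
    · simp
  · intro f hf hf'
    refine Finset.sum_eq_zero fun u _ => if_neg fun e => hf' ?_
    exact mem_copFinset.2 ((isUnit_rayClass_iff hm (degree_le_of_mem_polyLT hf)).1 ⟨u, e⟩)

/-- The prime number theorem for functions of the class modulo `M` and of the leading
coefficients. -/
theorem norm_sum_irrFinset_class_le (hM : M ≠ 0) (hm : 1 ≤ m) {n : ℕ} (hn : M.natDegree + m ≤ n)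
    {Φ : F[X] → ℂ} {K : ℝ}
    (hΦ : ∀ f ∈ degFinset F n, ∀ g ∈ degFinset F n, M ∣ f - g → (f - g).degree + m ≤ n → Φ f = Φ g)
    (hK : ∀ f ∈ degFinset F n, ‖Φ f‖ ≤ K) {κ : ℂ}
    (hκ : κ * (copFinset M n).card = ((Fintype.card F : ℂ) - 1) * (Fintype.card F : ℂ) ^ n) :
    ‖∑ P ∈ irrFinset F n, (n : ℂ) * Φ P - κ * ∑ f ∈ copFinset M n, Φ f‖ ≤
      K * √((Fintype.card F : ℝ) ^ (M.natDegree + m)) *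
        (Fintype.card F * ((M.natDegree + m + 2) * √(Fintype.card F) ^ n)) := by
  have : NeZero M := ⟨hM⟩
  have := Fintype.ofFinite (RayRing M m)
  have hex : ∀ u : (RayRing M m)ˣ, ∃ f : F[X], f.degree = (n : WithBot ℕ) ∧
      rayClass M m n f = u := by
    intro u
    obtain ⟨f, hf, hfu⟩ := exists_rayClass_eq hM hn (u : RayRing M m)
    exact ⟨f, ((isUnit_rayClass_iff hm (degree_le_of_mem_polyLT hf)).1 (hfu ▸ u.isUnit)).1, hfu⟩
  choose rep hdeg hrep using hex
  set φ : (RayRing M m)ˣ → ℂ := fun u => Φ (rep u) with hφ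
  have hΦφ : ∀ f ∈ degFinset F n, ∀ u : (RayRing M m)ˣ, (u : RayRing M m) = rayClass M m n f →
      Φ f = φ u := by
    intro f hf u hu
    have h0 : rayClass M m n (f - rep u) = 0 := by rw [map_sub, hrep, hu, sub_self]
    have h1 := (rayClass_eq_zero_iff
      ((degree_sub_le _ _).trans (max_le (mem_degFinset.1 hf).le (hdeg u).le))).1 h0
    exact hΦ f hf _ (mem_degFinset.2 (hdeg u)) h1.1 h1.2
  have hcq : (Fintype.card F : ℂ) ^ (n + 1) ≠ 0 :=
    pow_ne_zero _ (by exact_mod_cast Fintype.card_ne_zero)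
  have hcB : (Fintype.card (RayRing M m) : ℂ) ≠ 0 := by exact_mod_cast Fintype.card_ne_zero
  have hcU : (Fintype.card (RayRing M m)ˣ : ℂ) ≠ 0 := by exact_mod_cast Fintype.card_ne_zero
  have e1 := card_mul_sum_copFinset hM hm hn (Φ := Φ) (φ := φ)
    fun f hf => hΦφ f (Finset.mem_filter.1 hf).1
  have e2 := card_mul_sum_copFinset hM hm hn (Φ := fun _ => 1) (φ := fun _ => 1) fun f _ u _ => rfl
  simp only [Finset.sum_const, nsmul_eq_mul, mul_one, Finset.card_univ] at e2
  have e3 : κ * ∑ f ∈ copFinset M n, Φ f = ((Fintype.card F : ℂ) - 1) * (Fintype.card F : ℂ) ^ n /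
      Fintype.card (RayRing M m)ˣ * ∑ u, φ u := by
    rw [← hκ, div_mul_eq_mul_div, eq_div_iff hcU]
    refine mul_left_cancel₀ (mul_ne_zero hcq hcB) ?_
    linear_combination κ * (Fintype.card F : ℂ) ^ (n + 1) * Fintype.card (RayRing M m)ˣ * e1 -
      κ * (Fintype.card F : ℂ) ^ (n + 1) * (∑ u, φ u) * e2
  have hunit : ∀ P ∈ irrFinset F n, IsUnit (rayClass M m n P) := by
    intro P hP
    exact (isUnit_rayClass_iff hm (mem_irrFinset.1 hP).1.le).2 ⟨(mem_irrFinset.1 hP).1,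
      isCoprime_of_mem_irrFinset hM (by omega) hP⟩
  set E : Additive (RayRing M m)ˣ → ℂ := fun u =>
    ∑ P ∈ (irrFinset F n).filter (fun P =>
        rayClass M m n P = ((Additive.toMul u : (RayRing M m)ˣ) : RayRing M m)),
      (n : ℂ) - ((Fintype.card F : ℂ) - 1) * (Fintype.card F : ℂ) ^ n /
        Fintype.card (RayRing M m)ˣ with hE
  have hsum : ∀ (Ψ : F[X] → ℂ) (h : Additive (RayRing M m)ˣ → ℂ),
      (∀ P ∈ irrFinset F n, ∀ u : (RayRing M m)ˣ, (u : RayRing M m) = rayClass M m n P →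
        Ψ P = h (Additive.ofMul u)) →
      ∑ u, E u * h u = ∑ P ∈ irrFinset F n, (n : ℂ) * Ψ P - ((Fintype.card F : ℂ) - 1) *
        (Fintype.card F : ℂ) ^ n / Fintype.card (RayRing M m)ˣ * ∑ u, h u := by
    intro Ψ h hΨ
    simp only [hE, sub_mul, Finset.sum_sub_distrib, Finset.mul_sum]
    congr 1
    simp only [Finset.sum_mul, Finset.sum_filter]
    rw [Finset.sum_comm]
    refine Finset.sum_congr rfl fun P hP => ?_
    obtain ⟨u, hu⟩ := hunit P hP
    rw [Finset.sum_eq_single (Additive.ofMul u)]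
    · rw [hΨ P hP u hu, toMul_ofMul, if_pos hu.symm]
    · intro v _ hv
      rw [if_neg, zero_mul]
      intro e
      exact hv (Units.ext (by exact (e.symm.trans hu.symm)))
    · simp
  have hmain := hsum Φ (fun u => φ (Additive.toMul u)) fun P hP u hu =>
    hΦφ P (Finset.mem_filter.1 hP).1 u hu
  have hre : ∑ u : Additive (RayRing M m)ˣ, φ (Additive.toMul u) = ∑ u, φ u :=
    Fintype.sum_equiv Additive.toMul _ _ fun _ => rfl
  rw [hre] at hmain
  rw [e3, ← hmain]
  have hK0 : 0 ≤ K := (norm_nonneg _).trans (hK _ (mem_degFinset.2 (hdeg 1)))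
  refine (norm_sum_mul_le_of_addChar
    (B := Fintype.card F * ((M.natDegree + m + 2) * √(Fintype.card F) ^ n)) (by positivity) ?_
    (fun u => hK _ (mem_degFinset.2 (hdeg _)))).trans ?_
  · intro χ
    have hχ := hsum (fun f => χ.toMulChar (rayClass M m n f)) χ fun P _ u hu => by
      rw [← hu, AddChar.toMulChar_coe]
    rw [hχ]
    by_cases h1 : χ.toMulChar = 1
    · have h2 : ∀ u, χ u = 1 := by
        intro u
        rw [← ofMul_toMul u, ← AddChar.toMulChar_coe, h1]
        exact MulChar.one_apply_coe _
      have h3 : ∑ P ∈ irrFinset F n, (n : ℂ) * χ.toMulChar (rayClass M m n P) =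
          ∑ _P ∈ irrFinset F n, (n : ℂ) := by
        refine Finset.sum_congr rfl fun P hP => ?_
        rw [h1, MulChar.one_apply (hunit P hP), mul_one]
      have h4 : (∑ u, χ u) = Fintype.card (RayRing M m)ˣ := by
        rw [Finset.sum_congr rfl fun u _ => h2 u]
        simp
      rw [h3, h4, div_mul_cancel₀ _ hcU]
      refine (norm_sum_irrFinset_sub_le (by omega)).trans ?_
      gcongr
      have : (0 : ℝ) ≤ M.natDegree + m := by positivity
      linarith
    · have h2 : ∑ u, χ u = 0 := by
        rw [AddChar.sum_eq_zero_iff_ne_zero]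
        rintro rfl
        refine h1 (MulChar.ext fun u => ?_)
        rw [AddChar.toMulChar_coe, MulChar.one_apply_coe, AddChar.zero_apply]
      rw [h2, mul_zero, sub_zero]
      exact norm_sum_irrFinset_mulChar_le hM hm h1 hn
  · gcongr
    rw [← Nat.cast_pow, ← card_rayRing M m, Nat.card_eq_fintype_card]
    exact_mod_cast Fintype.card_le_of_injective (fun u : Additive (RayRing M m)ˣ =>
      ((Additive.toMul u : (RayRing M m)ˣ) : RayRing M m)) fun a b h => Units.ext h

end PrimesInClasses

section Averages

variable {F : Type*} [Field F] [Fintype F]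

/-- The average of a function over the polynomials of degree less than `n`. -/
def polyAvg (n : ℕ) (h : F[X] → ℂ) : ℂ := (∑ f ∈ polyLT F n, h f) / (Fintype.card F : ℂ) ^ n

theorem sum_polyLT_eq (n : ℕ) (h : F[X] → ℂ) :
    ∑ f ∈ polyLT F n, h f = (Fintype.card F : ℂ) ^ n * polyAvg n h := by
  rw [polyAvg, mul_div_cancel₀]
  exact pow_ne_zero _ (by exact_mod_cast Fintype.card_ne_zero)

theorem polyAvg_one (n : ℕ) : polyAvg n (fun _ : F[X] => (1 : ℂ)) = 1 := by
  rw [polyAvg, Finset.sum_const, card_polyLT, nsmul_eq_mul, mul_one, Nat.cast_pow, div_self]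
  exact pow_ne_zero _ (by exact_mod_cast Fintype.card_ne_zero)

theorem polyAvg_const_mul (n : ℕ) (c : ℂ) (h : F[X] → ℂ) :
    polyAvg n (fun f => c * h f) = c * polyAvg n h := by
  rw [polyAvg, ← Finset.mul_sum, mul_div_assoc, polyAvg]

theorem polyAvg_sub (n : ℕ) (h h' : F[X] → ℂ) :
    polyAvg n (fun f => h f - h' f) = polyAvg n h - polyAvg n h' := by
  rw [polyAvg, Finset.sum_sub_distrib, sub_div, polyAvg, polyAvg]

theorem add_mem_polyLT {n : ℕ} : ∀ x ∈ polyLT F n, ∀ y ∈ polyLT F n, x + y ∈ polyLT F n := by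
  intro x hx y hy
  rw [mem_polyLT] at *
  exact (degree_add_le _ _).trans_lt (max_lt hx hy)

theorem neg_mem_polyLT {n : ℕ} : ∀ x ∈ polyLT F n, -x ∈ polyLT F n := by
  intro x hx
  rw [mem_polyLT] at *
  rwa [degree_neg]

/-- Reduction modulo two polynomials. -/
def pairMk (a b : F[X]) : F[X] →+ AdjoinRoot a × AdjoinRoot b :=
  ((AdjoinRoot.mk a).prod (AdjoinRoot.mk b)).toAddMonoidHom

theorem pairMk_apply (a b f : F[X]) :
    pairMk a b f = (AdjoinRoot.mk a f, AdjoinRoot.mk b f) := rfl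

theorem exists_pairMk_eq {a b : F[X]} (ha : a ≠ 0) (hb : b ≠ 0) (hab : IsCoprime a b) {n : ℕ}
    (hn : a.natDegree + b.natDegree ≤ n) (x : AdjoinRoot a × AdjoinRoot b) :
    ∃ f ∈ polyLT F n, pairMk a b f = x := by
  obtain ⟨x, y⟩ := x
  obtain ⟨x, rfl⟩ := AdjoinRoot.mk_surjective x
  obtain ⟨y, rfl⟩ := AdjoinRoot.mk_surjective y
  obtain ⟨u, v, huv⟩ := hab
  have hab0 := mul_ne_zero ha hb
  set z := v * b * x + u * a * y with hz
  refine ⟨z % (a * b), ?_, ?_⟩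
  · rw [mem_polyLT]
    refine (EuclideanDomain.mod_lt z hab0).trans_le ?_
    rw [degree_eq_natDegree hab0, natDegree_mul ha hb]
    exact_mod_cast hn
  · have h := EuclideanDomain.div_add_mod z (a * b)
    rw [pairMk_apply, Prod.mk.injEq, AdjoinRoot.mk_eq_mk, AdjoinRoot.mk_eq_mk]
    constructor
    · refine ⟨u * (y - x) - b * (z / (a * b)), ?_⟩
      linear_combination h + hz + x * huv
    · refine ⟨v * (x - y) - a * (z / (a * b)), ?_⟩
      linear_combination h + hz + y * huv

theorem finite_adjoinRoot {a : F[X]} (ha : a ≠ 0) : Finite (AdjoinRoot a) := by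
  have h1 : Module.Finite F (AdjoinRoot a) := (AdjoinRoot.powerBasis ha).finite
  exact Module.finite_of_finite F (M := AdjoinRoot a)

/-- A function periodic modulo `a` as a function of residues. -/
def liftMk (a : F[X]) (h : F[X] → ℂ) (x : AdjoinRoot a) : ℂ :=
  h (Function.surjInv AdjoinRoot.mk_surjective x)

theorem liftMk_mk {a : F[X]} {h : F[X] → ℂ} (hp : ∀ f g, a ∣ f - g → h f = h g) (f : F[X]) :
    liftMk a h (AdjoinRoot.mk a f) = h f := by
  refine hp _ _ ?_
  rw [← AdjoinRoot.mk_eq_mk]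
  exact Function.surjInv_eq AdjoinRoot.mk_surjective _

theorem polyAvg_mul_eq {a b : F[X]} (ha : a ≠ 0) (hb : b ≠ 0) (hab : IsCoprime a b) {n : ℕ}
    (hn : a.natDegree + b.natDegree ≤ n) [Fintype (AdjoinRoot a)] [Fintype (AdjoinRoot b)]
    {h h' : F[X] → ℂ} (hh : ∀ f g, a ∣ f - g → h f = h g) (hh' : ∀ f g, b ∣ f - g → h' f = h' g) :
    polyAvg n (fun f => h f * h' f) = (∑ x, liftMk a h x) / Fintype.card (AdjoinRoot a) *
      ((∑ x, liftMk b h' x) / Fintype.card (AdjoinRoot b)) := by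
  have e := card_mul_sum_comp (V := polyLT F n) add_mem_polyLT neg_mem_polyLT (pairMk a b)
    (exists_pairMk_eq ha hb hab hn) (fun x => liftMk a h x.1 * liftMk b h' x.2)
  simp only [pairMk_apply, liftMk_mk hh, liftMk_mk hh', Fintype.sum_prod_type,
    ← Finset.sum_mul_sum, card_polyLT, Fintype.card_prod, Nat.cast_mul, Nat.cast_pow] at e
  have h1 : (Fintype.card (AdjoinRoot a) : ℂ) ≠ 0 := by exact_mod_cast Fintype.card_ne_zero
  have h2 : (Fintype.card (AdjoinRoot b) : ℂ) ≠ 0 := by exact_mod_cast Fintype.card_ne_zero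
  have h3 : (Fintype.card F : ℂ) ^ n ≠ 0 := pow_ne_zero _ (by exact_mod_cast Fintype.card_ne_zero)
  rw [polyAvg]
  field_simp
  linear_combination e

theorem polyAvg_eq_sum_liftMk {a : F[X]} (ha : a ≠ 0) {n : ℕ} (hn : a.natDegree ≤ n)
    [Fintype (AdjoinRoot a)] {h : F[X] → ℂ} (hh : ∀ f g, a ∣ f - g → h f = h g) :
    polyAvg n h = (∑ x, liftMk a h x) / Fintype.card (AdjoinRoot a) := by
  have := finite_adjoinRoot (one_ne_zero (α := F[X]))
  have := Fintype.ofFinite (AdjoinRoot (1 : F[X]))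
  have e := polyAvg_mul_eq (h' := fun _ => 1) ha one_ne_zero isCoprime_one_right
    (n := n) (by simpa using hn) hh (fun _ _ _ => rfl)
  have h2 : (Fintype.card (AdjoinRoot (1 : F[X])) : ℂ) ≠ 0 := by exact_mod_cast Fintype.card_ne_zero
  simp only [liftMk, mul_one, Finset.sum_const, Finset.card_univ, nsmul_eq_mul, div_self h2] at e
  exact e

theorem polyAvg_eq_polyAvg {a : F[X]} (ha : a ≠ 0) {n : ℕ} (hn : a.natDegree ≤ n)
    {h : F[X] → ℂ} (hh : ∀ f g, a ∣ f - g → h f = h g) : polyAvg n h = polyAvg a.natDegree h := by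
  have := finite_adjoinRoot ha
  have := Fintype.ofFinite (AdjoinRoot a)
  rw [polyAvg_eq_sum_liftMk ha hn hh, polyAvg_eq_sum_liftMk ha le_rfl hh]

theorem polyAvg_mul {a b : F[X]} (ha : a ≠ 0) (hb : b ≠ 0) (hab : IsCoprime a b) {n : ℕ}
    (hn : a.natDegree + b.natDegree ≤ n) {h h' : F[X] → ℂ}
    (hh : ∀ f g, a ∣ f - g → h f = h g) (hh' : ∀ f g, b ∣ f - g → h' f = h' g) :
    polyAvg n (fun f => h f * h' f) = polyAvg n h * polyAvg n h' := by
  have := finite_adjoinRoot ha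
  have := Fintype.ofFinite (AdjoinRoot a)
  have := finite_adjoinRoot hb
  have := Fintype.ofFinite (AdjoinRoot b)
  rw [polyAvg_mul_eq ha hb hab hn hh hh', polyAvg_eq_sum_liftMk ha (by omega) hh,
    polyAvg_eq_sum_liftMk hb (by omega) hh']

/-- A finite set of monic irreducible polynomials. -/
def IsPrimeSet (S : Finset F[X]) : Prop := ∀ l ∈ S, l.Monic ∧ Irreducible l

theorem IsPrimeSet.mono {S T : Finset F[X]} (hS : IsPrimeSet S) (h : T ⊆ S) : IsPrimeSet T :=
  fun l hl => hS l (h hl)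

theorem isCoprime_of_monic_irreducible {a b : F[X]} (ha : a.Monic) (hb : b.Monic)
    (hia : Irreducible a) (hib : Irreducible b) (hab : a ≠ b) : IsCoprime a b := by
  rw [hia.coprime_iff_not_dvd]
  intro h
  exact hab (eq_of_monic_of_associated ha hb ((hia.associated_of_dvd hib) h))

theorem IsPrimeSet.isCoprime_prod {S : Finset F[X]} {l : F[X]} (hS : IsPrimeSet (insert l S))
    (hl : l ∉ S) : IsCoprime l (∏ a ∈ S, a) := by
  refine IsCoprime.prod_right fun a ha => ?_
  obtain ⟨h1, h2⟩ := hS l (Finset.mem_insert_self _ _)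
  obtain ⟨h3, h4⟩ := hS a (Finset.mem_insert_of_mem ha)
  exact isCoprime_of_monic_irreducible h1 h3 h2 h4 fun e => hl (e ▸ ha)

theorem IsPrimeSet.monic_prod {S : Finset F[X]} (hS : IsPrimeSet S) : (∏ a ∈ S, a).Monic :=
  monic_prod_of_monic _ _ fun a ha => (hS a ha).1

theorem IsPrimeSet.natDegree_prod {S : Finset F[X]} (hS : IsPrimeSet S) :
    (∏ a ∈ S, a).natDegree = ∑ a ∈ S, a.natDegree :=
  natDegree_prod_of_monic _ _ fun a ha => (hS a ha).1

theorem IsPrimeSet.prod_dvd {S : Finset F[X]} (hS : IsPrimeSet S) {f : F[X]}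
    (h : ∀ l ∈ S, l ∣ f) : ∏ a ∈ S, a ∣ f :=
  Finset.prod_dvd_of_coprime (fun a ha b hb hab => isCoprime_of_monic_irreducible (hS a ha).1
    (hS b hb).1 (hS a ha).2 (hS b hb).2 hab) h

/-- Functions periodic modulo distinct primes are independent. -/
theorem polyAvg_prod {S : Finset F[X]} (hS : IsPrimeSet S) {n : ℕ}
    (hn : ∑ a ∈ S, a.natDegree ≤ n) {h : F[X] → F[X] → ℂ}
    (hh : ∀ l ∈ S, ∀ f g, l ∣ f - g → h l f = h l g) :
    polyAvg n (fun f => ∏ l ∈ S, h l f) = ∏ l ∈ S, polyAvg l.natDegree (h l) := by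
  induction S using Finset.induction_on with
  | empty => simpa using polyAvg_one n
  | insert l S hl ih =>
    simp only [Finset.prod_insert hl]
    rw [Finset.sum_insert hl] at hn
    have hS' := hS.mono (Finset.subset_insert l S)
    obtain ⟨h1, h2⟩ := hS l (Finset.mem_insert_self _ _)
    rw [polyAvg_mul h1.ne_zero hS'.monic_prod.ne_zero (hS.isCoprime_prod hl)
      (by rw [hS'.natDegree_prod]; exact hn) (hh l (Finset.mem_insert_self _ _)),
      polyAvg_eq_polyAvg h1.ne_zero (by omega) (hh l (Finset.mem_insert_self _ _)),
      ih hS' (by omega) fun a ha => hh a (Finset.mem_insert_of_mem ha)]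
    intro f g hfg
    refine Finset.prod_congr rfl fun a ha => hh a (Finset.mem_insert_of_mem ha) f g ?_
    exact (Finset.dvd_prod_of_mem (fun a => a) ha).trans hfg

end Averages

section LocalWeights

variable {F : Type*} [Field F] [Fintype F]

/-- The cardinality of the residue ring modulo `l`. -/
def absNorm (l : F[X]) : ℝ := (Fintype.card F : ℝ) ^ l.natDegree

theorem absNorm_pos (l : F[X]) : 0 < absNorm l :=
  pow_pos (by exact_mod_cast Fintype.card_pos) _

theorem two_le_absNorm {l : F[X]} (hl : Irreducible l) : 2 ≤ absNorm l := by
  have h2 : (2 : ℝ) ≤ Fintype.card F := by exact_mod_cast (Fintype.one_lt_card : 1 < Fintype.card F)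
  refine h2.trans (le_self_pow₀ (by linarith) hl.natDegree_pos.ne')

variable (F) in
/-- The weight of the residue class of `2` in the local factors. -/
def twist : ℝ := if (2 : F) = 0 then 0 else 1

variable (F) in
theorem twist_nonneg : 0 ≤ twist F := by
  rw [twist]
  split_ifs <;> norm_num

variable (F) in
theorem twist_le_one : twist F ≤ 1 := by
  rw [twist]
  split_ifs <;> norm_num

/-- The local factor at `l` of the weights of the primes. -/
def locWeight (l f : F[X]) : ℝ :=
  (absNorm l - 1) * ((1 + twist F) * (if l ∣ f - 1 then 1 else 0) -
    twist F * (if l ∣ f - 2 then 1 else 0))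

/-- The local density at `l` of the primes. -/
def locDensity (l f : F[X]) : ℝ := if l ∣ f then 0 else absNorm l / (absNorm l - 1)

theorem polyAvg_ite_dvd {l : F[X]} (hl : l.Monic) {h : F[X] → ℂ}
    (hh : ∀ f g, l ∣ f - g → h f = h g) (c : F[X]) :
    polyAvg l.natDegree (fun f => if l ∣ f - c then h f else 0) = h c / absNorm l := by
  rw [polyAvg, absNorm]
  push_cast
  congr 1
  rw [Finset.sum_eq_single (c %ₘ l)]
  · have h1 : l ∣ c %ₘ l - c := by
      refine ⟨-(c /ₘ l), ?_⟩
      have := modByMonic_add_div c l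
      linear_combination this
    rw [if_pos h1]
    exact hh _ _ h1
  · intro f hf hne
    rw [if_neg]
    intro hd
    refine hne ?_
    have h2 := modByMonic_eq_of_dvd_sub hl hd
    rw [← h2, (modByMonic_eq_self_iff hl).2]
    rw [mem_polyLT] at hf
    rwa [degree_eq_natDegree hl.ne_zero]
  · intro hn
    refine absurd ?_ hn
    rw [mem_polyLT]
    exact (degree_modByMonic_lt c hl).trans_le degree_le_natDegree

theorem not_dvd_one_of_irreducible {l : F[X]} (hl : Irreducible l) : ¬ l ∣ 1 :=
  fun h => hl.not_isUnit (isUnit_of_dvd_one h)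

theorem locDensity_mul_locWeight {l : F[X]} (hl : Irreducible l) (f : F[X]) :
    locDensity l f * locWeight l f = absNorm l * ((1 + twist F) * (if l ∣ f - 1 then 1 else 0) -
      twist F * (if l ∣ f - 2 then 1 else 0)) := by
  have hL := two_le_absNorm hl
  rw [locDensity, locWeight]
  by_cases h : l ∣ f
  · rw [if_pos h, zero_mul, if_neg]
    · rw [twist]
      split_ifs with h2 h3 h3
      · simp
      · simp
      · exfalso
        have h4 : l ∣ C (2 : F) := by
          have := dvd_sub h h3
          rw [sub_sub_cancel] at this
          have h5 : l ∣ (2 : F[X]) := by convert this using 1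
          rwa [← map_ofNat C 2] at h5
        exact hl.not_isUnit (isUnit_of_dvd_unit h4 (isUnit_C.2 (isUnit_iff_ne_zero.2 h2)))
      · simp
    · intro h1
      have := dvd_sub h h1
      rw [sub_sub_cancel] at this
      exact not_dvd_one_of_irreducible hl this
  · rw [if_neg h, ← mul_assoc, div_mul_cancel₀]
    linarith

theorem abs_locWeight_le {l : F[X]} (hl : Irreducible l) (f : F[X]) :
    |locWeight l f| ≤ 3 * absNorm l := by
  have hL := two_le_absNorm hl
  have h0 := twist_nonneg F
  have h1 := twist_le_one F
  rw [locWeight, abs_mul, abs_of_nonneg (by linarith : 0 ≤ absNorm l - 1), mul_comm]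
  refine mul_le_mul ?_ (by linarith) (by linarith) (by norm_num)
  rw [abs_le]
  split_ifs <;> constructor <;> linarith

theorem locDensity_nonneg {l : F[X]} (hl : Irreducible l) (f : F[X]) : 0 ≤ locDensity l f := by
  have hL := two_le_absNorm hl
  rw [locDensity]
  split_ifs
  · exact le_rfl
  · exact div_nonneg (by linarith) (by linarith)

theorem locDensity_le {l : F[X]} (hl : Irreducible l) (f : F[X]) : locDensity l f ≤ 2 := by
  have hL := two_le_absNorm hl
  rw [locDensity]
  split_ifs
  · norm_num
  · rw [div_le_iff₀ (by linarith)]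
    linarith

theorem locDensity_congr {l f g : F[X]} (h : l ∣ f - g) : locDensity l f = locDensity l g := by
  have : l ∣ f ↔ l ∣ g := dvd_iff_dvd_of_dvd_sub h
  rw [locDensity, locDensity, if_congr this rfl rfl]

theorem locWeight_congr {l f g : F[X]} (h : l ∣ f - g) : locWeight l f = locWeight l g := by
  have : ∀ c, l ∣ f - c ↔ l ∣ g - c := by
    intro c
    refine dvd_iff_dvd_of_dvd_sub ?_
    rwa [sub_sub_sub_cancel_right]
  rw [locWeight, locWeight, if_congr (this 1) rfl rfl, if_congr (this 2) rfl rfl]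

/-- The local factor at `l` of the model for the primes. -/
def locModel (g l f : F[X]) : ℝ := locDensity l f * (if l ∣ g then locWeight l f else 1)

theorem locModel_congr (g : F[X]) {l f f' : F[X]} (h : l ∣ f - f') :
    locModel g l f = locModel g l f' := by
  rw [locModel, locModel, locDensity_congr h, locWeight_congr h]

theorem polyAvg_locModel_mul_of_dvd {g l : F[X]} (hl : Irreducible l) (hm : l.Monic) (hg : l ∣ g)
    {h : F[X] → ℂ} (hh : ∀ f f', l ∣ f - f' → h f = h f') :
    polyAvg l.natDegree (fun f => locModel g l f * h f) =
      (1 + twist F) * h 1 - twist F * h 2 := by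
  have hL : (absNorm l : ℂ) ≠ 0 := by exact_mod_cast (absNorm_pos l).ne'
  have e : (fun f => (locModel g l f : ℂ) * h f) = fun f =>
      (absNorm l * (1 + twist F) : ℂ) * (if l ∣ f - 1 then h f else 0) -
        (absNorm l * twist F : ℂ) * (if l ∣ f - 2 then h f else 0) := by
    funext f
    rw [locModel, if_pos hg, locDensity_mul_locWeight hl]
    split_ifs <;> push_cast <;> ring
  rw [e, polyAvg_sub, polyAvg_const_mul, polyAvg_const_mul, polyAvg_ite_dvd hm hh,
    polyAvg_ite_dvd hm hh]
  field_simp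

theorem polyAvg_locModel_mul_of_not_dvd {g l : F[X]} (hm : l.Monic)
    (hg : ¬ l ∣ g) {h : F[X] → ℂ} (hh : ∀ f f', l ∣ f - f' → h f = h f') :
    polyAvg l.natDegree (fun f => locModel g l f * h f) =
      absNorm l / (absNorm l - 1) * (polyAvg l.natDegree h - h 0 / absNorm l) := by
  have e : (fun f => (locModel g l f : ℂ) * h f) = fun f =>
      (absNorm l / (absNorm l - 1) : ℂ) * (h f - (if l ∣ f - 0 then h f else 0)) := by
    funext f
    rw [locModel, if_neg hg, locDensity, sub_zero]
    split_ifs <;> push_cast <;> ring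
  rw [e, polyAvg_const_mul, polyAvg_sub, polyAvg_ite_dvd hm hh]

theorem polyAvg_locModel {g l : F[X]} (hl : Irreducible l) (hm : l.Monic) :
    polyAvg l.natDegree (fun f => (locModel g l f : ℂ)) = 1 := by
  have e : (fun f => (locModel g l f : ℂ)) = fun f => (locModel g l f : ℂ) * (fun _ => 1) f := by
    simp
  have hL := two_le_absNorm hl
  by_cases hg : l ∣ g
  · rw [e, polyAvg_locModel_mul_of_dvd hl hm hg (h := fun _ => 1) fun _ _ _ => rfl]
    ring
  · rw [e, polyAvg_locModel_mul_of_not_dvd hm hg (h := fun _ => 1) fun _ _ _ => rfl, polyAvg_one]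
    have h0 : (absNorm l : ℂ) ≠ 0 := by exact_mod_cast (absNorm_pos l).ne'
    have h1 : (absNorm l : ℂ) - 1 ≠ 0 := by
      intro h
      have : absNorm l - 1 = 0 := by exact_mod_cast h
      linarith
    field_simp

end LocalWeights

section Functionals

variable {F : Type*} [Field F] [Fintype F]

theorem degree_C_mul_le' (a : F) (f : F[X]) : (C a * f).degree ≤ f.degree := by
  by_cases h : a = 0
  · simp [h]
  · rw [degree_C_mul h]

theorem sum_polyLT_mul_addChar_eq_zero {η : AddChar F ℂ} (hη : η ≠ 0) (θ : F[X] →ₗ[F] F) {n : ℕ}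
    {v : F[X]} (hv : v ∈ polyLT F n) (hθ : θ v ≠ 0) {H : F[X] → ℂ}
    (hH : ∀ (a : F) f, H (f + C a * v) = H f) :
    ∑ f ∈ polyLT F n, H f * η (θ f) = 0 := by
  obtain ⟨b, hb⟩ := AddChar.ne_zero_iff.1 hη
  set w := C (b / θ v) * v with hw
  have hwm : w ∈ polyLT F n := by
    rw [mem_polyLT] at hv ⊢
    refine (degree_C_mul_le' _ _).trans_lt hv
  have hwθ : θ w = b := by
    rw [hw, ← smul_eq_C_mul, map_smul, smul_eq_mul, div_mul_cancel₀ _ hθ]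
  have h1 : ∑ f ∈ polyLT F n, H f * η (θ f) = ∑ f ∈ polyLT F n, H f * η (θ f) * η b := by
    symm
    refine Finset.sum_bij (fun f _ => f + w) (fun f hf => add_mem_polyLT f hf w hwm)
      (fun f _ g _ e => add_right_cancel e)
      (fun f hf => ⟨f + -w, add_mem_polyLT f hf _ (neg_mem_polyLT w hwm),
        neg_add_cancel_right f w⟩) (fun f _ => ?_)
    rw [hw, hH, ← hw, map_add, AddChar.map_add_eq_mul, hwθ, mul_assoc]
  rw [← Finset.sum_mul] at h1
  have h2 : (∑ f ∈ polyLT F n, H f * η (θ f)) * (1 - η b) = 0 := by linear_combination h1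
  exact (mul_eq_zero.1 h2).resolve_right (sub_ne_zero.2 (Ne.symm hb))

/-- A functional vanishing on the multiples of a product of distinct primes is a sum of functionals
vanishing on the multiples of these primes. -/
theorem IsPrimeSet.exists_sum_eq {S : Finset F[X]} (hS : IsPrimeSet S) (θ : F[X] →ₗ[F] F)
    (hθ : ∀ w, θ ((∏ l ∈ S, l) * w) = 0) :
    ∃ θl : F[X] → F[X] →ₗ[F] F, (∀ l ∈ S, ∀ w, θl l (l * w) = 0) ∧
      ∀ f, θ f = ∑ l ∈ S, θl l f := by
  induction S using Finset.induction_on generalizing θ with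
  | empty => exact ⟨fun _ => 0, by simp, fun f => by simpa using hθ f⟩
  | insert l S hl ih =>
    obtain ⟨a, b, hab⟩ := hS.isCoprime_prod hl
    rw [Finset.prod_insert hl] at hθ
    obtain ⟨θl, h1, h2⟩ := ih (hS.mono (Finset.subset_insert l S))
      (θ ∘ₗ LinearMap.mulLeft F (a * l)) (by
        intro w
        rw [LinearMap.comp_apply, LinearMap.mulLeft_apply]
        convert hθ (a * w) using 2
        ring)
    refine ⟨Function.update θl l (θ ∘ₗ LinearMap.mulLeft F (b * ∏ l ∈ S, l)), ?_, ?_⟩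
    · intro x hx w
      by_cases hxl : x = l
      · subst hxl
        rw [Function.update_self, LinearMap.comp_apply, LinearMap.mulLeft_apply]
        convert hθ (b * w) using 2
        ring
      · rw [Function.update_of_ne hxl]
        exact h1 x ((Finset.mem_insert.1 hx).resolve_left hxl) w
    · intro f
      rw [Finset.sum_insert hl, Function.update_self]
      have e : ∑ x ∈ S, Function.update θl l (θ ∘ₗ LinearMap.mulLeft F (b * ∏ l ∈ S, l)) x f =
          ∑ x ∈ S, θl x f := by
        refine Finset.sum_congr rfl fun x hx => ?_
        rw [Function.update_of_ne]
        rintro rfl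
        exact hl hx
      rw [e, ← h2, LinearMap.comp_apply, LinearMap.mulLeft_apply, LinearMap.comp_apply,
        LinearMap.mulLeft_apply, ← map_add]
      congr 1
      linear_combination -f * hab

/-- A functional vanishing on the multiples of `R` of degree less than `n` agrees in degree less
than `n` with a functional vanishing on all multiples of `R`. -/
theorem exists_functional_extension {R : F[X]} (hR : R.Monic) (θ : F[X] →ₗ[F] F) {n : ℕ}
    (hn : R.natDegree ≤ n) (h : ∀ w, R * w ∈ polyLT F n → θ (R * w) = 0) :
    ∃ θ' : F[X] →ₗ[F] F, (∀ w, θ' (R * w) = 0) ∧ ∀ f ∈ polyLT F n, θ' f = θ f := by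
  refine ⟨θ ∘ₗ modByMonicHom R, fun w => ?_, fun f hf => ?_⟩
  · rw [LinearMap.comp_apply, modByMonicHom_apply,
      (modByMonic_eq_zero_iff_dvd hR).2 (dvd_mul_right _ _), map_zero]
  · rw [LinearMap.comp_apply, modByMonicHom_apply]
    have e := modByMonic_add_div f R
    have hm : f %ₘ R ∈ polyLT F n := by
      rw [mem_polyLT]
      refine (degree_modByMonic_lt f hR).trans_le (degree_le_natDegree.trans ?_)
      exact_mod_cast hn
    have h2 : R * (f /ₘ R) ∈ polyLT F n := by
      have : R * (f /ₘ R) = f + -(f %ₘ R) := by linear_combination e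
      rw [this]
      exact add_mem_polyLT f hf _ (neg_mem_polyLT _ hm)
    conv_rhs => rw [← e, map_add, h _ h2, add_zero]

/-- Dirichlet's approximation theorem. -/
theorem exists_monic_functional_eq_zero (θ : F[X] →ₗ[F] F) (D : ℕ) :
    ∃ Q : F[X], Q.Monic ∧ Q.natDegree ≤ D ∧ ∀ w, w ∈ polyLT F D → θ (Q * w) = 0 := by
  set L : degreeLT F (D + 1) →ₗ[F] (Fin D → F) :=
    LinearMap.pi fun i => θ ∘ₗ LinearMap.mulRight F (X ^ (i : ℕ)) ∘ₗ (degreeLT F (D + 1)).subtype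
    with hL
  have hrank : Module.finrank F (Fin D → F) < Module.finrank F (degreeLT F (D + 1)) := by
    rw [Module.finrank_fin_fun, (degreeLTEquiv F (D + 1)).finrank_eq, Module.finrank_fin_fun]
    exact D.lt_succ_self
  have : Module.Finite F (degreeLT F (D + 1)) :=
    Module.Finite.equiv (degreeLTEquiv F (D + 1)).symm
  have hker := LinearMap.ker_ne_bot_of_finrank_lt (f := L) hrank
  obtain ⟨⟨Q, hQd⟩, hQ, hQ0⟩ := (Submodule.ne_bot_iff _).1 hker
  have hQ0' : Q ≠ 0 := fun h => hQ0 (Subtype.ext h)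
  have hX : ∀ i < D, θ (Q * X ^ i) = 0 := by
    intro i hi
    exact congrFun (LinearMap.mem_ker.1 hQ) ⟨i, hi⟩
  refine ⟨Q * C Q.leadingCoeff⁻¹, monic_mul_leadingCoeff_inv hQ0', ?_, fun w hw => ?_⟩
  · rw [natDegree_mul_leadingCoeff_inv _ hQ0']
    rw [mem_degreeLT, degree_eq_natDegree hQ0'] at hQd
    exact Nat.le_of_lt_succ (by exact_mod_cast hQd)
  · rw [mem_polyLT] at hw
    have hwD : C Q.leadingCoeff⁻¹ * w = ∑ i ∈ Finset.range D,
        C ((C Q.leadingCoeff⁻¹ * w).coeff i) * X ^ i := by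
      by_cases h0 : C Q.leadingCoeff⁻¹ * w = 0
      · simp [h0]
      · refine as_sum_range_C_mul_X_pow' _ ?_
        have := (degree_C_mul_le' Q.leadingCoeff⁻¹ w).trans_lt hw
        rw [degree_eq_natDegree h0] at this
        exact_mod_cast this
    rw [mul_assoc, hwD, Finset.mul_sum, map_sum]
    refine Finset.sum_eq_zero fun i hi => ?_
    rw [mul_left_comm, ← smul_eq_C_mul, map_smul, hX i (Finset.mem_range.1 hi), smul_zero]

end Functionals

section Models

variable {F : Type*} [Field F] [Fintype F]

/-- The monic irreducible divisors of a nonzero polynomial. -/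
def primesOf (M : F[X]) : Finset F[X] :=
  (polyLT F (M.natDegree + 1)).filter fun l => l.Monic ∧ Irreducible l ∧ l ∣ M

theorem isPrimeSet_primesOf (M : F[X]) : IsPrimeSet (primesOf M) := by
  intro l hl
  rw [primesOf, Finset.mem_filter] at hl
  exact ⟨hl.2.1, hl.2.2.1⟩

theorem mem_primesOf {M l : F[X]} (hM : M ≠ 0) :
    l ∈ primesOf M ↔ l.Monic ∧ Irreducible l ∧ l ∣ M := by
  rw [primesOf, Finset.mem_filter, and_iff_right_iff_imp, mem_polyLT]
  intro h
  refine (degree_le_of_dvd h.2.2 hM).trans_lt (degree_le_natDegree.trans_lt ?_)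
  exact_mod_cast M.natDegree.lt_succ_self

theorem dvd_of_mem_primesOf {M l : F[X]} (hl : l ∈ primesOf M) : l ∣ M := by
  rw [primesOf, Finset.mem_filter] at hl
  exact hl.2.2.2

theorem prod_primesOf_dvd (M : F[X]) : ∏ l ∈ primesOf M, l ∣ M :=
  (isPrimeSet_primesOf M).prod_dvd fun _ hl => dvd_of_mem_primesOf hl

theorem sum_natDegree_primesOf_le {M : F[X]} (hM : M ≠ 0) :
    ∑ l ∈ primesOf M, l.natDegree ≤ M.natDegree := by
  rw [← (isPrimeSet_primesOf M).natDegree_prod]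
  exact natDegree_le_of_dvd (prod_primesOf_dvd M) hM

theorem exists_mem_primesOf_of_irreducible {M l : F[X]} (hM : M ≠ 0) (hl : Irreducible l)
    (h : l ∣ M) : ∃ l' ∈ primesOf M, Associated l' l := by
  have ha : Associated (normalize l) l := normalize_associated l
  refine ⟨normalize l, (mem_primesOf hM).2 ⟨monic_normalize hl.ne_zero, ha.symm.irreducible hl,
    ha.dvd.trans h⟩, ha⟩

theorem isCoprime_iff_primesOf {M f : F[X]} (hM : M ≠ 0) :
    IsCoprime f M ↔ ∀ l ∈ primesOf M, ¬ l ∣ f := by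
  constructor
  · intro h l hl hf
    exact ((isPrimeSet_primesOf M) l hl).2.not_isUnit
      (h.isUnit_of_dvd' hf (dvd_of_mem_primesOf hl))
  · intro h
    refine isCoprime_of_irreducible_dvd (fun h0 => hM h0.2) fun z hz hzf hzM => ?_
    obtain ⟨l, hl, hlz⟩ := exists_mem_primesOf_of_irreducible hM hz hzM
    exact h l hl (hlz.dvd.trans hzf)

theorem primesOf_eq_filter {M g : F[X]} (hM : M ≠ 0) (h : g ∣ M) :
    primesOf g = (primesOf M).filter fun l => l ∣ g := by
  ext l
  have hg : g ≠ 0 := ne_zero_of_dvd_ne_zero hM h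
  rw [Finset.mem_filter, mem_primesOf hg, mem_primesOf hM]
  exact ⟨fun ⟨h1, h2, h3⟩ => ⟨⟨h1, h2, h3.trans h⟩, h3⟩, fun ⟨⟨h1, h2, _⟩, h3⟩ => ⟨h1, h2, h3⟩⟩

theorem prod_absNorm_primesOf_le {M : F[X]} (hM : M ≠ 0) :
    ∏ l ∈ primesOf M, absNorm l ≤ (Fintype.card F : ℝ) ^ M.natDegree := by
  simp only [absNorm]
  rw [Finset.prod_pow_eq_pow_sum]
  refine pow_le_pow_right₀ ?_ (sum_natDegree_primesOf_le hM)
  exact_mod_cast Fintype.card_pos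

/-- The weight attached to the polynomial `g`. -/
def primeWeight (g f : F[X]) : ℝ := ∏ l ∈ primesOf g, locWeight l f

theorem primeWeight_congr {g f f' : F[X]} (h : g ∣ f - f') :
    primeWeight g f = primeWeight g f' :=
  Finset.prod_congr rfl fun _ hl => locWeight_congr ((dvd_of_mem_primesOf hl).trans h)

theorem abs_primeWeight_le {g : F[X]} (hg : g ≠ 0) (f : F[X]) :
    |primeWeight g f| ≤ 3 ^ (primesOf g).card * (Fintype.card F : ℝ) ^ g.natDegree := by
  rw [primeWeight, Finset.abs_prod]
  calc ∏ l ∈ primesOf g, |locWeight l f| ≤ ∏ l ∈ primesOf g, (3 * absNorm l) :=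
        Finset.prod_le_prod (fun _ _ => abs_nonneg _) fun l hl =>
          abs_locWeight_le ((isPrimeSet_primesOf g) l hl).2 f
    _ = 3 ^ (primesOf g).card * ∏ l ∈ primesOf g, absNorm l := by
        rw [Finset.prod_mul_distrib, Finset.prod_const]
    _ ≤ _ := by
        gcongr
        exact prod_absNorm_primesOf_le hg

/-- The density of the primes in the residue classes modulo `M` prime to `M`. -/
def primeDensity (M : F[X]) : ℝ := ∏ l ∈ primesOf M, absNorm l / (absNorm l - 1)

theorem prod_locDensity_of_isCoprime {M f : F[X]} (hM : M ≠ 0) (h : IsCoprime f M) :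
    ∏ l ∈ primesOf M, locDensity l f = primeDensity M := by
  rw [isCoprime_iff_primesOf hM] at h
  refine Finset.prod_congr rfl fun l hl => ?_
  rw [locDensity, if_neg (h l hl)]

theorem prod_locDensity_of_not_isCoprime {M f : F[X]} (hM : M ≠ 0) (h : ¬ IsCoprime f M) :
    ∏ l ∈ primesOf M, locDensity l f = 0 := by
  rw [isCoprime_iff_primesOf hM] at h
  push Not at h
  obtain ⟨l, hl, hlf⟩ := h
  refine Finset.prod_eq_zero hl ?_
  rw [locDensity, if_pos hlf]

theorem polyAvg_prod_locDensity {M : F[X]} (hM : M ≠ 0) {n : ℕ} (hn : M.natDegree ≤ n) :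
    polyAvg n (fun f => ∏ l ∈ primesOf M, (locDensity l f : ℂ)) = 1 := by
  rw [polyAvg_prod (isPrimeSet_primesOf M) ((sum_natDegree_primesOf_le hM).trans hn)]
  · refine Finset.prod_eq_one fun l hl => ?_
    obtain ⟨h1, h2⟩ := isPrimeSet_primesOf M l hl
    rw [← polyAvg_locModel (g := 1) h2 h1]
    simp only [locModel, if_neg (not_dvd_one_of_irreducible h2), mul_one]
  · intro l _ f g h
    rw [locDensity_congr h]

theorem sum_polyLT_succ (n : ℕ) (h : F[X] → ℂ) :
    ∑ f ∈ polyLT F (n + 1), h f = ∑ f ∈ polyLT F n, h f + ∑ f ∈ degFinset F n, h f := by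
  rw [degFinset, ← Finset.sum_filter_not_add_sum_filter (polyLT F (n + 1)) (fun f => f.degree = n)]
  congr 1
  refine Finset.sum_congr ?_ fun _ _ => rfl
  ext f
  rw [Finset.mem_filter, mem_polyLT]
  constructor
  · intro h
    exact mem_polyLT.2 (lt_of_le_of_ne (degree_le_of_mem_polyLT (mem_polyLT.2 h.1)) h.2)
  · intro h
    rw [mem_polyLT] at h
    refine ⟨h.trans ?_, h.ne⟩
    exact_mod_cast n.lt_succ_self

theorem primeDensity_mul_card_copFinset {M : F[X]} (hM : M ≠ 0) {n : ℕ} (hn : M.natDegree ≤ n) :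
    (primeDensity M : ℂ) * (copFinset M n).card =
      ((Fintype.card F : ℂ) - 1) * (Fintype.card F : ℂ) ^ n := by
  have h := sum_polyLT_succ n fun f : F[X] => ∏ l ∈ primesOf M, (locDensity l f : ℂ)
  rw [sum_polyLT_eq, sum_polyLT_eq, polyAvg_prod_locDensity hM hn,
    polyAvg_prod_locDensity hM (hn.trans n.le_succ)] at h
  have h2 : ∑ f ∈ degFinset F n, ∏ l ∈ primesOf M, (locDensity l f : ℂ) =
      ∑ f ∈ copFinset M n, (primeDensity M : ℂ) := by
    rw [copFinset, Finset.sum_filter]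
    refine Finset.sum_congr rfl fun f _ => ?_
    split_ifs with hc
    · rw [← prod_locDensity_of_isCoprime hM hc, Complex.ofReal_prod]
    · rw [← Complex.ofReal_prod, prod_locDensity_of_not_isCoprime hM hc, Complex.ofReal_zero]
  rw [h2, Finset.sum_const, nsmul_eq_mul] at h
  linear_combination -h

/-- The model for the primes with the weight attached to `g`, relative to the modulus `Q * g`. -/
def primeModel (Q g f : F[X]) : ℝ := ∏ l ∈ primesOf (Q * g), locModel g l f

theorem primeModel_eq {Q g : F[X]} (h : Q * g ≠ 0) (f : F[X]) :
    primeModel Q g f = (∏ l ∈ primesOf (Q * g), locDensity l f) * primeWeight g f := by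
  simp only [primeModel, locModel]
  rw [Finset.prod_mul_distrib, primeWeight, primesOf_eq_filter h (dvd_mul_left g Q),
    Finset.prod_filter]

theorem primeModel_of_isCoprime {Q g f : F[X]} (h : Q * g ≠ 0) (hf : IsCoprime f (Q * g)) :
    primeModel Q g f = primeDensity (Q * g) * primeWeight g f := by
  rw [primeModel_eq h, prod_locDensity_of_isCoprime h hf]

theorem primeModel_of_not_isCoprime {Q g f : F[X]} (h : Q * g ≠ 0) (hf : ¬ IsCoprime f (Q * g)) :
    primeModel Q g f = 0 := by
  rw [primeModel_eq h, prod_locDensity_of_not_isCoprime h hf, zero_mul]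

theorem card_primesOf_le_of_dvd {M g : F[X]} (hM : M ≠ 0) (h : g ∣ M) :
    (primesOf g).card ≤ (primesOf M).card := by
  rw [primesOf_eq_filter hM h]
  exact Finset.card_filter_le _ _

theorem abs_primeModel_le {Q g : F[X]} (h : Q * g ≠ 0) (f : F[X]) :
    |primeModel Q g f| ≤
      6 ^ (primesOf (Q * g)).card * (Fintype.card F : ℝ) ^ g.natDegree := by
  have h1 : |∏ l ∈ primesOf (Q * g), locDensity l f| ≤ 2 ^ (primesOf (Q * g)).card := by
    rw [Finset.abs_prod, ← Finset.prod_const]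
    refine Finset.prod_le_prod (fun _ _ => abs_nonneg _) fun l hl => ?_
    have hi := ((isPrimeSet_primesOf _) l hl).2
    rw [abs_of_nonneg (locDensity_nonneg hi f)]
    exact locDensity_le hi f
  have h2 := abs_primeWeight_le (right_ne_zero_of_mul h) f
  have h3 : (3 : ℝ) ^ (primesOf g).card ≤ 3 ^ (primesOf (Q * g)).card :=
    pow_le_pow_right₀ (by norm_num) (card_primesOf_le_of_dvd h (dvd_mul_left g Q))
  rw [primeModel_eq h, abs_mul, show (6 : ℝ) = 2 * 3 by norm_num, mul_pow, mul_assoc]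
  refine mul_le_mul h1 (h2.trans ?_) (abs_nonneg _) (by positivity)
  gcongr

end Models

section MainTerm

variable {F : Type*} [Field F] [Fintype F]

/-- The exponential sum of the model for the primes. -/
def modelSum (η : AddChar F ℂ) (θ : F[X] →ₗ[F] F) (Q g : F[X]) (n : ℕ) : ℂ :=
  ∑ f ∈ polyLT F n, (primeModel Q g f : ℂ) * η (θ (f - 1))

theorem modelSum_eq_zero {η : AddChar F ℂ} (hη : η ≠ 0) {θ : F[X] →ₗ[F] F} {Q g : F[X]} {n : ℕ}
    {w : F[X]} (hw : (∏ l ∈ primesOf (Q * g), l) * w ∈ polyLT F n)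
    (hθ : θ ((∏ l ∈ primesOf (Q * g), l) * w) ≠ 0) : modelSum η θ Q g n = 0 := by
  have h := sum_polyLT_mul_addChar_eq_zero hη θ hw hθ (H := fun f => (primeModel Q g f : ℂ)) (by
    intro a f
    congr 1
    refine Finset.prod_congr rfl fun l hl => locModel_congr g ?_
    rw [add_sub_cancel_left]
    exact ((Finset.dvd_prod_of_mem (fun l => l) hl).trans (dvd_mul_right _ w)).mul_left _)
  have e : modelSum η θ Q g n =
      (∑ f ∈ polyLT F n, (primeModel Q g f : ℂ) * η (θ f)) * η (-θ 1) := by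
    rw [modelSum, Finset.sum_mul]
    refine Finset.sum_congr rfl fun f _ => ?_
    rw [map_sub, sub_eq_add_neg, AddChar.map_add_eq_mul, mul_assoc]
  rw [e, h, zero_mul]

theorem exists_functional_extension_of_mul {θ : F[X] →ₗ[F] F} {Q g : F[X]} (hQ : Q.Monic)
    (hg : g.Monic) {n : ℕ} (hn : Q.natDegree + g.natDegree ≤ n)
    (hθ : ∀ w ∈ polyLT F g.natDegree, θ (Q * w) = 0)
    (h : ∀ w, (∏ l ∈ primesOf (Q * g), l) * w ∈ polyLT F n →
      θ ((∏ l ∈ primesOf (Q * g), l) * w) = 0) :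
    ∃ θ' : F[X] →ₗ[F] F, (∀ w, θ' ((∏ l ∈ primesOf Q, l) * w) = 0) ∧
      ∀ f ∈ polyLT F n, θ' f = θ f := by
  have hQg : Q * g ≠ 0 := mul_ne_zero hQ.ne_zero hg.ne_zero
  have hP := isPrimeSet_primesOf (Q * g)
  obtain ⟨θ', h1, h2⟩ := exists_functional_extension hP.monic_prod θ (n := n) (by
    rw [hP.natDegree_prod]
    refine (sum_natDegree_primesOf_le hQg).trans ?_
    rwa [hQ.natDegree_mul hg]) h
  refine ⟨θ', ?_, h2⟩
  set R := ∏ l ∈ primesOf Q, l with hR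
  set S' := (primesOf (Q * g)).filter fun l => ¬ l ∣ Q with hS'
  have hS'P : IsPrimeSet S' := hP.mono (Finset.filter_subset _ _)
  have hprod : ∏ l ∈ primesOf (Q * g), l = R * ∏ l ∈ S', l := by
    rw [hR, primesOf_eq_filter hQg (dvd_mul_right Q g), hS', Finset.prod_filter_mul_prod_filter_not]
  have hcop : ∀ l ∈ S', IsCoprime l Q := by
    intro l hl
    exact ((hS'P l hl).2.coprime_iff_not_dvd).2 (Finset.mem_filter.1 hl).2
  have hdvd : ∏ l ∈ S', l ∣ g := by
    refine hS'P.prod_dvd fun l hl => ?_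
    exact (hcop l hl).dvd_of_dvd_mul_left (dvd_of_mem_primesOf (Finset.mem_filter.1 hl).1)
  have hcopQ : IsCoprime (∏ l ∈ S', l) Q := IsCoprime.prod_left hcop
  obtain ⟨Q', hQ'⟩ := prod_primesOf_dvd Q
  rw [← hR] at hQ'
  have hkillQ : ∀ w, θ' (Q * w) = 0 := by
    intro w
    have e := modByMonic_add_div w (∏ l ∈ S', l)
    have e1 : Q * w = Q * (w %ₘ (∏ l ∈ S', l)) + (∏ l ∈ primesOf (Q * g), l) *
        (Q' * (w /ₘ (∏ l ∈ S', l))) := by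
      rw [hprod]
      conv_lhs => rw [← e]
      rw [hQ']
      ring
    have hd : w %ₘ (∏ l ∈ S', l) ∈ polyLT F g.natDegree := by
      rw [mem_polyLT]
      refine (degree_modByMonic_lt w hS'P.monic_prod).trans_le (degree_le_natDegree.trans ?_)
      exact_mod_cast natDegree_le_of_dvd hdvd hg.ne_zero
    rw [e1, map_add, h1, add_zero, h2, hθ _ hd]
    rw [mem_polyLT] at hd ⊢
    by_cases h0 : w %ₘ (∏ l ∈ S', l) = 0
    · rw [h0, mul_zero, degree_zero]
      exact WithBot.bot_lt_coe n
    · rw [degree_eq_natDegree h0] at hd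
      rw [degree_mul, degree_eq_natDegree h0, degree_eq_natDegree hQ.ne_zero]
      have : (w %ₘ (∏ l ∈ S', l)).natDegree < g.natDegree := by exact_mod_cast hd
      norm_cast
      omega
  intro w
  rw [hQ'] at hcopQ
  obtain ⟨a, b, hab⟩ := hcopQ.of_mul_right_right
  have e2 : R * w = Q * (b * w) + (∏ l ∈ primesOf (Q * g), l) * (a * w) := by
    rw [hprod]
    linear_combination (-R * w) * hab - b * w * hQ'
  rw [e2, map_add, hkillQ, h1, add_zero]

theorem addChar_map_sum {ι : Type*} (η : AddChar F ℂ) (s : Finset ι) (f : ι → F) :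
    η (∑ i ∈ s, f i) = ∏ i ∈ s, η (f i) := by
  induction s using Finset.induction_on with
  | empty => simp
  | insert i s hi ih => rw [Finset.sum_insert hi, Finset.prod_insert hi, η.map_add_eq_mul, ih]

/-- The local factors of the exponential sums of the model. -/
def locFactor (η : AddChar F ℂ) (z : F) (g l : F[X]) : ℂ :=
  if l ∣ g then 1 + twist F - twist F * η z else -η (-z) / (absNorm l - 1)

theorem polyAvg_addChar_eq_zero {η : AddChar F ℂ} (hη : η ≠ 0) {θ : F[X] →ₗ[F] F} {l : F[X]}
    (hl : l.Monic) (hθl : ∀ w, θ (l * w) = 0) (hθ : θ ≠ 0) :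
    polyAvg l.natDegree (fun f => η (θ (f - 1))) = 0 := by
  obtain ⟨w, hw⟩ : ∃ w, θ w ≠ 0 := by
    by_contra! h
    exact hθ (LinearMap.ext h)
  have hw' : θ (w %ₘ l) ≠ 0 := by
    rw [← modByMonic_add_div w l, map_add, hθl, add_zero] at hw
    exact hw
  have hm : w %ₘ l ∈ polyLT F l.natDegree := by
    rw [mem_polyLT]
    exact (degree_modByMonic_lt w hl).trans_le degree_le_natDegree
  have h := sum_polyLT_mul_addChar_eq_zero hη θ hm hw' (H := fun _ => η (-θ 1)) fun _ _ => rfl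
  rw [polyAvg]
  have e : ∀ f, η (θ (f - 1)) = η (-θ 1) * η (θ f) := by
    intro f
    rw [map_sub, sub_eq_neg_add, AddChar.map_add_eq_mul]
  simp only [e]
  rw [h, zero_div]

theorem polyAvg_locModel_mul_addChar {η : AddChar F ℂ} (hη : η ≠ 0) {θ : F[X] →ₗ[F] F}
    {l : F[X]} (hl : l.Monic) (hi : Irreducible l) (hθl : ∀ w, θ (l * w) = 0) (hθ : θ ≠ 0)
    (g : F[X]) :
    polyAvg l.natDegree (fun f => locModel g l f * η (θ (f - 1))) = locFactor η (θ 1) g l := by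
  have hper : ∀ f f', l ∣ f - f' → η (θ (f - 1)) = η (θ (f' - 1)) := by
    rintro f f' ⟨w, hw⟩
    have : f - 1 = l * w + (f' - 1) := by rw [← hw]; ring
    rw [this, map_add, hθl, zero_add]
  rw [locFactor]
  split_ifs with hg
  · rw [polyAvg_locModel_mul_of_dvd hi hl hg hper, sub_self, map_zero, AddChar.map_zero_eq_one,
      show (2 : F[X]) - 1 = 1 by norm_num, mul_one]
  · rw [polyAvg_locModel_mul_of_not_dvd hl hg hper, polyAvg_addChar_eq_zero hη hl hθl hθ, zero_sub,
      zero_sub, map_neg θ 1]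
    have h0 : (absNorm l : ℂ) ≠ 0 := by exact_mod_cast (absNorm_pos l).ne'
    have h1 : (absNorm l : ℂ) - 1 ≠ 0 := by
      have hL := two_le_absNorm hi
      intro h
      have : absNorm l - 1 = 0 := by exact_mod_cast h
      linarith
    field_simp

theorem modelSum_eq {η : AddChar F ℂ} (hη : η ≠ 0) {θ : F[X] →ₗ[F] F} {Q g : F[X]} (hQ : Q.Monic)
    (hg : g.Monic) {n : ℕ} (hn : Q.natDegree + g.natDegree ≤ n) {θl : F[X] → F[X] →ₗ[F] F}
    (h1 : ∀ l ∈ primesOf Q, ∀ w, θl l (l * w) = 0)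
    (h2 : ∀ f ∈ polyLT F n, θ (f - 1) = ∑ l ∈ primesOf Q, θl l (f - 1)) :
    modelSum η θ Q g n = (Fintype.card F : ℂ) ^ n *
      ∏ l ∈ (primesOf Q).filter (fun l => θl l ≠ 0), locFactor η (θl l 1) g l := by
  have hQg : Q * g ≠ 0 := mul_ne_zero hQ.ne_zero hg.ne_zero
  set H : F[X] → F[X] → ℂ := fun l f =>
    locModel g l f * (if l ∣ Q then η (θl l (f - 1)) else 1) with hH
  have hker : ∀ l ∈ primesOf (Q * g), l ∣ Q → ∀ w, θl l (l * w) = 0 := by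
    intro l hl hlQ
    refine h1 l ?_
    rw [primesOf_eq_filter hQg (dvd_mul_right Q g)]
    exact Finset.mem_filter.2 ⟨hl, hlQ⟩
  have e : modelSum η θ Q g n = ∑ f ∈ polyLT F n, ∏ l ∈ primesOf (Q * g), H l f := by
    refine Finset.sum_congr rfl fun f hf => ?_
    rw [h2 f hf, hH]
    dsimp only
    rw [Finset.prod_mul_distrib, primeModel, Complex.ofReal_prod, ← Finset.prod_filter,
      ← primesOf_eq_filter hQg (dvd_mul_right Q g)]
    congr 1
    exact addChar_map_sum η _ _
  have hQn : ∑ l ∈ primesOf (Q * g), l.natDegree ≤ n := by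
    refine (sum_natDegree_primesOf_le hQg).trans ?_
    rwa [hQ.natDegree_mul hg]
  rw [e, sum_polyLT_eq, polyAvg_prod (isPrimeSet_primesOf (Q * g)) hQn]
  · congr 1
    rw [Finset.prod_filter, primesOf_eq_filter hQg (dvd_mul_right Q g), Finset.prod_filter]
    refine Finset.prod_congr rfl fun l hl => ?_
    obtain ⟨hm, hi⟩ := isPrimeSet_primesOf _ l hl
    rw [hH]
    dsimp only
    split_ifs with h3 h4
    · exact polyAvg_locModel_mul_addChar hη hm hi (hker l hl h3) h4 g
    · rw [not_not] at h4
      simp only [h4, LinearMap.zero_apply, AddChar.map_zero_eq_one, mul_one]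
      exact polyAvg_locModel hi hm
    · simp only [mul_one]
      exact polyAvg_locModel hi hm
  · intro l hl f f' hff
    rw [hH]
    dsimp only
    rw [locModel_congr g hff]
    split_ifs with h3
    · obtain ⟨w, hw⟩ := hff
      have : f - 1 = l * w + (f' - 1) := by rw [← hw]; ring
      rw [this, map_add, hker l hl h3, zero_add]
    · rfl

/-- The exponential sums of the models attached to the polynomials `g` of degree `k` either all
vanish or are given by products of local factors. -/
theorem modelSum_dichotomy {η : AddChar F ℂ} (hη : η ≠ 0) {θ : F[X] →ₗ[F] F} {Q : F[X]}
    (hQ : Q.Monic) {k n : ℕ} (hn : Q.natDegree + k ≤ n) (hn0 : 1 ≤ n)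
    (hθ : ∀ w ∈ polyLT F k, θ (Q * w) = 0) :
    (∀ g ∈ monicFinset F k, modelSum η θ Q g n = 0) ∨
      ∃ S ⊆ primesOf Q, ∃ z : F[X] → F, ∀ g ∈ monicFinset F k,
        modelSum η θ Q g n = (Fintype.card F : ℂ) ^ n * ∏ l ∈ S, locFactor η (z l) g l := by
  by_cases hall : ∀ g ∈ monicFinset F k, modelSum η θ Q g n = 0
  · exact Or.inl hall
  right
  push Not at hall
  obtain ⟨g₀, hg₀, hne⟩ := hall
  rw [mem_monicFinset] at hg₀
  obtain ⟨hm, rfl⟩ := hg₀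
  obtain ⟨θ', h1, h2⟩ := exists_functional_extension_of_mul hQ hm hn hθ fun w hw => by
    by_contra hc
    exact hne (modelSum_eq_zero hη hw hc)
  obtain ⟨θl, h3, h4⟩ := (isPrimeSet_primesOf Q).exists_sum_eq θ' h1
  refine ⟨_, Finset.filter_subset (fun l => θl l ≠ 0) _, fun l => θl l 1, fun g hg => ?_⟩
  rw [mem_monicFinset] at hg
  refine modelSum_eq hη hQ hg.1 (by rw [hg.2]; exact hn) h3 fun f hf => ?_
  rw [← h4, h2]
  rw [sub_eq_add_neg]
  refine add_mem_polyLT _ hf _ (neg_mem_polyLT _ ?_)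
  rw [mem_polyLT, degree_one]
  exact_mod_cast hn0

end MainTerm

section Averaging

variable {F : Type*} [Field F] [Fintype F]

theorem sum_monicFinset (k : ℕ) (h : F[X] → ℂ) :
    ∑ g ∈ monicFinset F k, h g = ∑ f ∈ polyLT F k, h (f + X ^ k) := by
  symm
  refine Finset.sum_bij (fun f _ => f + X ^ k) (fun f hf => ?_)
    (fun f _ g _ e => add_right_cancel e)
    (fun g hg => ⟨g - X ^ k, ?_, sub_add_cancel _ _⟩) fun _ _ => rfl
  · rw [mem_polyLT] at hf
    rw [mem_monicFinset, add_comm]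
    refine ⟨monic_X_pow_add hf, ?_⟩
    rw [natDegree_add_eq_left_of_degree_lt (by rwa [degree_X_pow]), natDegree_X_pow]
  · rw [mem_monicFinset] at hg
    have hd : g.degree = (k : WithBot ℕ) := by rw [degree_eq_natDegree hg.1.ne_zero, hg.2]
    rw [mem_polyLT, ← hd]
    refine degree_sub_lt_left (by rw [hd, degree_X_pow]) hg.1.ne_zero ?_
    rw [hg.1.leadingCoeff, (monic_X_pow k).leadingCoeff]

theorem polyAvg_ite_dvd_add {l : F[X]} (hl : l.Monic) (c : F[X]) (a b : ℂ) :
    polyAvg l.natDegree (fun f => if l ∣ f + c then a else b) = b + (a - b) / absNorm l := by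
  have e : (fun f => if l ∣ f + c then a else b) =
      fun f => b * (fun _ => (1 : ℂ)) f - (if l ∣ f - (-c) then (b - a) else 0) := by
    funext f
    rw [sub_neg_eq_add]
    split_ifs <;> ring
  rw [e, polyAvg_sub, polyAvg_const_mul, polyAvg_one,
    polyAvg_ite_dvd hl (h := fun _ => b - a) fun _ _ _ => rfl]
  ring

theorem dvd_add_right_iff_of_dvd_sub {l f f' c : F[X]} (h : l ∣ f - f') :
    l ∣ f + c ↔ l ∣ f' + c := by
  refine dvd_iff_dvd_of_dvd_sub ?_
  rwa [add_sub_add_right_eq_sub]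

theorem exists_nonneg_avg_locFactor (η : AddChar F ℂ) (z : F) {l : F[X]} (hi : Irreducible l) :
    ∃ r : ℝ, 0 ≤ r ∧ (-η (-z) / (absNorm l - 1) +
      ((1 + twist F - twist F * η z) - -η (-z) / (absNorm l - 1)) / absNorm l : ℂ) = r := by
  have hL := two_le_absNorm hi
  have h0 : (absNorm l : ℂ) ≠ 0 := by exact_mod_cast (absNorm_pos l).ne'
  have h1 : (absNorm l : ℂ) - 1 ≠ 0 := by
    intro h
    have : absNorm l - 1 = 0 := by exact_mod_cast h
    linarith
  have e : (-η (-z) / (absNorm l - 1) +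
      ((1 + twist F - twist F * η z) - -η (-z) / (absNorm l - 1)) / absNorm l : ℂ) =
      (1 + twist F - twist F * η z - η (-z)) / absNorm l := by
    field_simp
    ring
  rw [e]
  have hn : ‖η z‖ = 1 := η.norm_apply z
  suffices h : ∃ r : ℝ, 0 ≤ r ∧ (1 + twist F - twist F * η z - η (-z) : ℂ) = r by
    obtain ⟨r, hr, hr'⟩ := h
    refine ⟨r / absNorm l, div_nonneg hr (absNorm_pos l).le, ?_⟩
    rw [hr', Complex.ofReal_div]
  rw [twist]
  split_ifs with h2
  · have hs : η (-z) * η (-z) = 1 := by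
      rw [← AddChar.map_add_eq_mul, ← two_mul, h2, zero_mul, AddChar.map_zero_eq_one]
    rcases mul_self_eq_one_iff.1 hs with h | h <;> rw [h]
    · exact ⟨0, le_rfl, by push_cast; ring⟩
    · exact ⟨2, by norm_num, by push_cast; ring⟩
  · refine ⟨2 - 2 * (η z).re, ?_, ?_⟩
    · have := (Complex.abs_re_le_norm (η z)).trans_eq hn
      have := (abs_le.1 this).2
      linarith
    · rw [AddChar.map_neg_eq_conj]
      have := Complex.add_conj (η z)
      push_cast at this ⊢
      linear_combination -this

theorem exists_nonneg_sum_prod_locFactor (η : AddChar F ℂ) (z : F[X] → F) {S : Finset F[X]}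
    (hS : IsPrimeSet S) {k : ℕ} (hk : ∑ l ∈ S, l.natDegree ≤ k) :
    ∃ r : ℝ, 0 ≤ r ∧ ∑ g ∈ monicFinset F k, ∏ l ∈ S, locFactor η (z l) g l = r := by
  rw [sum_monicFinset, sum_polyLT_eq]
  have e := polyAvg_prod hS hk (h := fun l f => locFactor η (z l) (f + X ^ k) l) (by
    intro l _ f f' h
    rw [locFactor, locFactor, if_congr (dvd_add_right_iff_of_dvd_sub h) rfl rfl])
  rw [e]
  have h1 : ∀ l ∈ S, ∃ r : ℝ, 0 ≤ r ∧
      polyAvg l.natDegree (fun f => locFactor η (z l) (f + X ^ k) l) = r := by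
    intro l hl
    simp only [locFactor]
    rw [polyAvg_ite_dvd_add (hS l hl).1]
    exact exists_nonneg_avg_locFactor η (z l) (hS l hl).2
  choose! r hr hr' using h1
  refine ⟨(Fintype.card F : ℝ) ^ k * ∏ l ∈ S, r l,
    mul_nonneg (by positivity) (Finset.prod_nonneg hr), ?_⟩
  rw [Finset.prod_congr rfl hr']
  push_cast
  rfl

theorem card_filter_dvd_monicFinset_mul_le {R : F[X]} (hR : R.Monic) (k : ℕ) :
    (((monicFinset F k).filter fun g => R ∣ g).card : ℝ) * absNorm R ≤
      (Fintype.card F : ℝ) ^ k := by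
  by_cases hk : R.natDegree ≤ k
  · have h1 : (((monicFinset F k).filter fun g => R ∣ g).card : ℂ) =
        ∑ f ∈ polyLT F k, if R ∣ f + X ^ k then (1 : ℂ) else 0 := by
      rw [← sum_monicFinset k (fun g => if R ∣ g then (1 : ℂ) else 0), Finset.sum_boole]
    rw [sum_polyLT_eq, polyAvg_eq_polyAvg hR.ne_zero hk, polyAvg_ite_dvd_add hR] at h1
    · have h0 : (absNorm R : ℂ) ≠ 0 := by exact_mod_cast (absNorm_pos R).ne'
      have h2 : (((monicFinset F k).filter fun g => R ∣ g).card : ℂ) * absNorm R =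
          (Fintype.card F : ℂ) ^ k := by
        rw [h1]
        field_simp
        ring
      refine le_of_eq ?_
      exact_mod_cast h2
    · intro f f' h
      rw [if_congr (dvd_add_right_iff_of_dvd_sub h) rfl rfl]
  · rw [Finset.filter_false_of_mem, Finset.card_empty, Nat.cast_zero, zero_mul]
    · positivity
    · intro g hg hd
      rw [mem_monicFinset] at hg
      exact hk (hg.2 ▸ natDegree_le_of_dvd hd hg.1.ne_zero)

theorem norm_sum_prod_locFactor_le (η : AddChar F ℂ) (z : F[X] → F) {S : Finset F[X]}
    (hS : IsPrimeSet S) {k : ℕ} (hk : k < ∑ l ∈ S, l.natDegree) :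
    ‖∑ g ∈ monicFinset F k, ∏ l ∈ S, locFactor η (z l) g l‖ ≤ 6 ^ S.card := by
  set α : F[X] → ℂ := fun l => -η (-z l) / (absNorm l - 1) with hα
  set β : F[X] → ℂ := fun l => 1 + twist F - twist F * η (z l) with hβ
  have hαn : ∀ l ∈ S, ‖α l‖ ≤ 2 / absNorm l ∧ ‖β l - α l‖ ≤ 4 := by
    intro l hl
    have hL := two_le_absNorm (hS l hl).2
    have h1 : ‖α l‖ = 1 / (absNorm l - 1) := by
      have : (absNorm l : ℂ) - 1 = ((absNorm l - 1 : ℝ) : ℂ) := by push_cast; rfl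
      rw [hα]
      dsimp only
      rw [norm_div, norm_neg, η.norm_apply, this, Complex.norm_real, Real.norm_eq_abs,
        abs_of_nonneg (by linarith)]
    have h2 : ‖α l‖ ≤ 2 / absNorm l := by
      rw [h1, div_le_div_iff₀ (by linarith) (by linarith)]
      linarith
    have h3 : ‖α l‖ ≤ 1 := h2.trans (by rw [div_le_one (by linarith)]; exact hL)
    have h4 : ‖β l‖ ≤ 3 := by
      have e0 := twist_nonneg F
      have e1 := twist_le_one F
      have ht : ‖(twist F : ℂ)‖ = twist F := by
        rw [Complex.norm_real, Real.norm_eq_abs, abs_of_nonneg e0]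
      calc ‖β l‖ ≤ ‖(1 : ℂ)‖ + ‖(twist F : ℂ)‖ + ‖(twist F : ℂ) * η (z l)‖ :=
            (norm_sub_le _ _).trans (add_le_add_left (norm_add_le _ _) _)
        _ ≤ 3 := by
            rw [norm_mul, η.norm_apply, ht, norm_one]
            linarith
    exact ⟨h2, (norm_sub_le _ _).trans (by linarith)⟩
  have e1 : ∀ g, ∏ l ∈ S, locFactor η (z l) g l =
      ∑ T ∈ S.powerset, (∏ l ∈ T, (β l - α l)) * (∏ l ∈ S \ T, α l) *
        (if ∏ l ∈ T, l ∣ g then 1 else 0) := by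
    intro g
    have : ∀ l ∈ S, locFactor η (z l) g l = (if l ∣ g then β l - α l else 0) + α l := by
      intro l _
      rw [locFactor]
      split_ifs
      · rw [sub_add_cancel]
      · rw [zero_add]
    rw [Finset.prod_congr rfl this, Finset.prod_add]
    refine Finset.sum_congr rfl fun T hT => ?_
    have hTP := hS.mono (Finset.mem_powerset.1 hT)
    have : ∏ l ∈ T, (if l ∣ g then β l - α l else 0) =
        (∏ l ∈ T, (β l - α l)) * (if ∏ l ∈ T, l ∣ g then 1 else 0) := by
      split_ifs with hd
      · rw [mul_one]
        refine Finset.prod_congr rfl fun l hl => ?_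
        rw [if_pos ((Finset.dvd_prod_of_mem (fun l => l) hl).trans hd)]
      · rw [mul_zero]
        by_contra hne
        refine hd (hTP.prod_dvd fun l hl => ?_)
        by_contra hlg
        exact hne (Finset.prod_eq_zero hl (if_neg hlg))
    rw [this]
    ring
  have e2 : ∑ g ∈ monicFinset F k, ∏ l ∈ S, locFactor η (z l) g l =
      ∑ T ∈ S.powerset, (∏ l ∈ T, (β l - α l)) * (∏ l ∈ S \ T, α l) *
        (((monicFinset F k).filter fun g => ∏ l ∈ T, l ∣ g).card : ℂ) := by
    rw [Finset.sum_congr rfl fun g _ => e1 g, Finset.sum_comm]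
    refine Finset.sum_congr rfl fun T _ => ?_
    rw [← Finset.mul_sum, Finset.sum_boole]
  have hq : (0 : ℝ) < (Fintype.card F : ℝ) ^ k := by
    have : (0 : ℝ) < Fintype.card F := by exact_mod_cast Fintype.card_pos
    positivity
  rw [e2]
  have e3 : ∀ T ∈ S.powerset, ‖(∏ l ∈ T, (β l - α l)) * (∏ l ∈ S \ T, α l) *
      (((monicFinset F k).filter fun g => ∏ l ∈ T, l ∣ g).card : ℂ)‖ ≤
      (Fintype.card F : ℝ) ^ k * ((∏ l ∈ T, 4 / absNorm l) * ∏ l ∈ S \ T, 2 / absNorm l) := by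
    intro T hT
    rw [Finset.mem_powerset] at hT
    have hTP := hS.mono hT
    have hc := card_filter_dvd_monicFinset_mul_le hTP.monic_prod k
    have hN : absNorm (∏ l ∈ T, l) = ∏ l ∈ T, absNorm l := by
      simp only [absNorm]
      rw [hTP.natDegree_prod, Finset.prod_pow_eq_pow_sum]
    rw [← le_div_iff₀ (absNorm_pos _), hN] at hc
    rw [norm_mul, norm_mul, norm_prod, norm_prod, Complex.norm_natCast]
    have h4 : ∏ l ∈ T, ‖β l - α l‖ ≤ ∏ l ∈ T, 4 :=
      Finset.prod_le_prod (fun _ _ => norm_nonneg _) fun l hl => (hαn l (hT hl)).2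
    have h2 : ∏ l ∈ S \ T, ‖α l‖ ≤ ∏ l ∈ S \ T, 2 / absNorm l :=
      Finset.prod_le_prod (fun _ _ => norm_nonneg _) fun l hl => (hαn l (Finset.sdiff_subset hl)).1
    have hp1 : 0 ≤ ∏ l ∈ T, (4 : ℝ) := Finset.prod_nonneg fun _ _ => by norm_num
    have hp2 : 0 ≤ ∏ l ∈ S \ T, 2 / absNorm l :=
      Finset.prod_nonneg fun l _ => div_nonneg (by norm_num) (absNorm_pos l).le
    calc _ ≤ (∏ l ∈ T, (4 : ℝ)) * (∏ l ∈ S \ T, 2 / absNorm l) *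
          ((Fintype.card F : ℝ) ^ k / ∏ l ∈ T, absNorm l) :=
          mul_le_mul (mul_le_mul h4 h2 (Finset.prod_nonneg fun _ _ => norm_nonneg _) hp1) hc
            (Nat.cast_nonneg _) (mul_nonneg hp1 hp2)
      _ = _ := by
          rw [Finset.prod_div_distrib (s := T)]
          ring
  refine (norm_sum_le_of_le _ e3).trans ?_
  rw [← Finset.mul_sum, ← Finset.prod_add]
  have e4 : ∏ l ∈ S, (4 / absNorm l + 2 / absNorm l) =
      6 ^ S.card / (Fintype.card F : ℝ) ^ (∑ l ∈ S, l.natDegree) := by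
    rw [← Finset.prod_pow_eq_pow_sum, ← Finset.prod_const, ← Finset.prod_div_distrib]
    refine Finset.prod_congr rfl fun l _ => ?_
    rw [← add_div, absNorm]
    norm_num
  rw [e4, mul_div_assoc', div_le_iff₀ (hq.trans_le (pow_le_pow_right₀ (by
    exact_mod_cast Fintype.card_pos) hk.le)), mul_comm]
  gcongr
  exact_mod_cast Fintype.card_pos

theorem neg_le_re_sum_prod_locFactor (η : AddChar F ℂ) (z : F[X] → F) {S : Finset F[X]}
    (hS : IsPrimeSet S) (k : ℕ) :
    -6 ^ S.card ≤ (∑ g ∈ monicFinset F k, ∏ l ∈ S, locFactor η (z l) g l).re := by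
  by_cases hk : ∑ l ∈ S, l.natDegree ≤ k
  · obtain ⟨r, hr, e⟩ := exists_nonneg_sum_prod_locFactor η z hS hk
    rw [e, Complex.ofReal_re]
    have : (0 : ℝ) ≤ 6 ^ S.card := by positivity
    linarith
  · exact (abs_le.1 ((Complex.abs_re_le_norm _).trans
      (norm_sum_prod_locFactor_le η z hS (not_le.1 hk)))).1

/-- The real part of the averaged exponential sums of the models is almost nonnegative. -/
theorem neg_le_re_sum_modelSum {η : AddChar F ℂ} (hη : η ≠ 0) {θ : F[X] →ₗ[F] F} {Q : F[X]}
    (hQ : Q.Monic) {k n : ℕ} (hn : Q.natDegree + k ≤ n) (hn0 : 1 ≤ n)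
    (hθ : ∀ w ∈ polyLT F k, θ (Q * w) = 0) :
    -(6 ^ (primesOf Q).card * (Fintype.card F : ℝ) ^ n) ≤
      (∑ g ∈ monicFinset F k, modelSum η θ Q g n).re := by
  have hq : (0 : ℝ) ≤ (Fintype.card F : ℝ) ^ n := by positivity
  rcases modelSum_dichotomy hη hQ hn hn0 hθ with h | ⟨S, hS, z, h⟩
  · rw [Finset.sum_eq_zero h, Complex.zero_re]
    have := mul_nonneg (by positivity : (0 : ℝ) ≤ 6 ^ (primesOf Q).card) hq
    linarith
  · rw [Finset.sum_congr rfl h, ← Finset.mul_sum]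
    have h1 := neg_le_re_sum_prod_locFactor η z ((isPrimeSet_primesOf Q).mono hS) k
    have e : ((Fintype.card F : ℂ) ^ n) = (((Fintype.card F : ℝ) ^ n : ℝ) : ℂ) := by push_cast; rfl
    rw [e, Complex.re_ofReal_mul]
    have h2 : (6 : ℝ) ^ S.card ≤ 6 ^ (primesOf Q).card :=
      pow_le_pow_right₀ (by norm_num) (Finset.card_le_card hS)
    nlinarith [mul_le_mul_of_nonneg_left h1 hq, mul_le_mul_of_nonneg_right h2 hq]

end Averaging

section ErrorTerm

variable {F : Type*} [Field F] [Fintype F]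

theorem sum_polyLT_eq_sum_range (N : ℕ) (h : F[X] → ℂ) :
    ∑ f ∈ polyLT F N, h f = h 0 + ∑ n ∈ Finset.range N, ∑ f ∈ degFinset F n, h f := by
  induction N with
  | zero =>
    have : polyLT F 0 = {0} := by
      ext f
      rw [mem_polyLT, Finset.mem_singleton, Nat.cast_zero]
      exact ⟨fun h => by simpa [Nat.WithBot.lt_zero_iff] using h, fun h => by simp [h]⟩
    rw [this, Finset.sum_singleton, Finset.range_zero, Finset.sum_empty, add_zero]
  | succ n ih => rw [sum_polyLT_succ, ih, Finset.sum_range_succ, add_assoc]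

/-- The exponential sum over the primes with the weight attached to `g`. -/
def weightedSum (η : AddChar F ℂ) (θ : F[X] →ₗ[F] F) (g : F[X]) (n : ℕ) : ℂ :=
  ∑ P ∈ irrFinset F n, (n : ℂ) * ((primeWeight g P : ℂ) * η (θ (P - 1)))

theorem card_degFinset_le (n : ℕ) :
    ((degFinset F n).card : ℝ) ≤ (Fintype.card F : ℝ) ^ (n + 1) := by
  have : (degFinset F n).card ≤ (polyLT F (n + 1)).card :=
    Finset.card_le_card (Finset.filter_subset _ _)
  rw [card_polyLT] at this
  exact_mod_cast this

theorem norm_primeWeight_mul_le {Q g : F[X]} (hQg : Q * g ≠ 0) (η : AddChar F ℂ) (a : F)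
    (f : F[X]) : ‖(primeWeight g f : ℂ) * η a‖ ≤
      6 ^ (primesOf (Q * g)).card * (Fintype.card F : ℝ) ^ g.natDegree := by
  rw [norm_mul, η.norm_apply, mul_one, Complex.norm_real, Real.norm_eq_abs]
  refine (abs_primeWeight_le (right_ne_zero_of_mul hQg) f).trans ?_
  have h3 : (3 : ℝ) ^ (primesOf g).card ≤ 6 ^ (primesOf (Q * g)).card :=
    (pow_le_pow_left₀ (by norm_num) (by norm_num) _).trans
      (pow_le_pow_right₀ (by norm_num) (card_primesOf_le_of_dvd hQg (dvd_mul_left g Q)))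
  gcongr

theorem norm_primeModel_mul_le {Q g : F[X]} (hQg : Q * g ≠ 0) (η : AddChar F ℂ) (a : F)
    (f : F[X]) : ‖(primeModel Q g f : ℂ) * η a‖ ≤
      6 ^ (primesOf (Q * g)).card * (Fintype.card F : ℝ) ^ g.natDegree := by
  rw [norm_mul, η.norm_apply, mul_one, Complex.norm_real, Real.norm_eq_abs]
  exact abs_primeModel_le hQg f

theorem norm_weightedSum_sub_le_of_lt {Q g : F[X]} (hQg : Q * g ≠ 0) (η : AddChar F ℂ)
    (θ : F[X] →ₗ[F] F) (n : ℕ) :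
    ‖weightedSum η θ g n - ∑ f ∈ degFinset F n, (primeModel Q g f : ℂ) * η (θ (f - 1))‖ ≤
      6 ^ (primesOf (Q * g)).card * (Fintype.card F : ℝ) ^ g.natDegree *
        ((n + 1) * (Fintype.card F : ℝ) ^ (n + 1)) := by
  set B := 6 ^ (primesOf (Q * g)).card * (Fintype.card F : ℝ) ^ g.natDegree with hB
  have hB0 : 0 ≤ B := by positivity
  have hc := card_degFinset_le (F := F) n
  have hi : ((irrFinset F n).card : ℝ) ≤ (Fintype.card F : ℝ) ^ (n + 1) := by
    refine le_trans ?_ hc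
    exact_mod_cast Finset.card_le_card (Finset.filter_subset _ _)
  have h1 : ‖weightedSum η θ g n‖ ≤ (irrFinset F n).card * (n * B) := by
    rw [← nsmul_eq_mul]
    refine Finset.sum_le_card_nsmul _ _ _ (fun P _ => ?_) |> (norm_sum_le _ _).trans
    rw [norm_mul, Complex.norm_natCast]
    exact mul_le_mul_of_nonneg_left (norm_primeWeight_mul_le hQg η _ _) (Nat.cast_nonneg _)
  have h2 : ‖∑ f ∈ degFinset F n, (primeModel Q g f : ℂ) * η (θ (f - 1))‖ ≤
      (degFinset F n).card * B := by
    rw [← nsmul_eq_mul]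
    refine Finset.sum_le_card_nsmul _ _ _ (fun P _ => ?_) |> (norm_sum_le _ _).trans
    exact norm_primeModel_mul_le hQg η _ _
  refine (norm_sub_le _ _).trans ((add_le_add h1 h2).trans ?_)
  have h3 := mul_le_mul_of_nonneg_right hi (mul_nonneg (Nat.cast_nonneg n) hB0 : 0 ≤ (n : ℝ) * B)
  have h4 := mul_le_mul_of_nonneg_right hc hB0
  linear_combination h3 + h4

theorem norm_weightedSum_sub_le_of_le {Q g : F[X]} (hQ : Q.Monic) (hg : g.Monic) (η : AddChar F ℂ)
    {θ : F[X] →ₗ[F] F} {D m n : ℕ} (hθ : ∀ w ∈ polyLT F D, θ (Q * w) = 0) (hm : 1 ≤ m)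
    (hmD : n + 1 ≤ m + Q.natDegree + D) (hn : (Q * g).natDegree + m ≤ n) :
    ‖weightedSum η θ g n - ∑ f ∈ degFinset F n, (primeModel Q g f : ℂ) * η (θ (f - 1))‖ ≤
      6 ^ (primesOf (Q * g)).card * (Fintype.card F : ℝ) ^ g.natDegree *
        √((Fintype.card F : ℝ) ^ ((Q * g).natDegree + m)) *
        (Fintype.card F * (((Q * g).natDegree + m + 2) * √(Fintype.card F) ^ n)) := by
  have hQg : Q * g ≠ 0 := mul_ne_zero hQ.ne_zero hg.ne_zero
  have e : ∑ f ∈ degFinset F n, (primeModel Q g f : ℂ) * η (θ (f - 1)) =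
      primeDensity (Q * g) * ∑ f ∈ copFinset (Q * g) n,
        ((primeWeight g f : ℂ) * η (θ (f - 1))) := by
    rw [copFinset, Finset.sum_filter, Finset.mul_sum]
    refine Finset.sum_congr rfl fun f _ => ?_
    split_ifs with hc
    · rw [primeModel_of_isCoprime hQg hc, Complex.ofReal_mul, mul_assoc]
    · rw [primeModel_of_not_isCoprime hQg hc, Complex.ofReal_zero, zero_mul, mul_zero]
  rw [e, weightedSum]
  refine norm_sum_irrFinset_class_le hQg hm hn (Φ := fun f => (primeWeight g f : ℂ) * η (θ (f - 1)))
    ?_ (fun f _ => norm_primeWeight_mul_le hQg η _ f)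
    (primeDensity_mul_card_copFinset hQg (by omega))
  rintro f - f' - ⟨w, hw⟩ hd
  have h1 : primeWeight g f = primeWeight g f' :=
    primeWeight_congr ⟨Q * w, by rw [hw]; ring⟩
  have h2 : θ (f - 1) = θ (f' - 1) := by
    have : f - 1 = Q * (g * w) + (f' - 1) := by rw [← mul_assoc, ← hw]; ring
    rw [this, map_add, hθ, zero_add]
    rw [mem_polyLT]
    by_cases h0 : g * w = 0
    · rw [h0, degree_zero]
      exact WithBot.bot_lt_coe D
    · rw [hw, mul_assoc, degree_mul, degree_eq_natDegree hQ.ne_zero, degree_eq_natDegree h0] at hd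
      rw [degree_eq_natDegree h0]
      norm_cast at hd ⊢
      omega
  rw [h1, h2]

/-- The error in the approximation of the weighted sums by the model, for a modulus of degree
at most half of `N`. -/
theorem norm_sum_weightedSum_sub_modelSum_le {Q g : F[X]} (hQ : Q.Monic) (hg : g.Monic)
    (η : AddChar F ℂ) {θ : F[X] →ₗ[F] F} {N : ℕ} (hQN : Q.natDegree ≤ N / 2)
    (hθ : ∀ w ∈ polyLT F (N / 2), θ (Q * w) = 0) :
    ‖∑ n ∈ Finset.range (N + 1), weightedSum η θ g n - modelSum η θ Q g (N + 1)‖ ≤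
      (N + 2) * (6 ^ (primesOf (Q * g)).card * (Fintype.card F : ℝ) ^ g.natDegree *
        ((N + 1) * (Fintype.card F : ℝ) ^ (N / 2 + g.natDegree + 2) +
          √((Fintype.card F : ℝ) ^ (N / 2 + g.natDegree + 2)) *
          (Fintype.card F * (((N / 2 + g.natDegree + 2 : ℕ) + 2) * √(Fintype.card F) ^ N)))) := by
  set q : ℝ := (Fintype.card F : ℝ) with hq
  have hq1 : 1 ≤ q := by
    rw [hq]
    exact_mod_cast (Fintype.card_pos : 0 < Fintype.card F)
  have hQg : Q * g ≠ 0 := mul_ne_zero hQ.ne_zero hg.ne_zero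
  set B := 6 ^ (primesOf (Q * g)).card * q ^ g.natDegree with hB
  have hB0 : 0 ≤ B := by positivity
  set n₁ := N / 2 + g.natDegree + 2 with hn₁
  set Y := (N + 1) * q ^ n₁ + √(q ^ n₁) * (q * (((n₁ : ℕ) + 2) * √q ^ N)) with hY
  have hY1 : 1 ≤ Y := by
    have h1 : 1 ≤ ((N : ℝ) + 1) * q ^ n₁ :=
      one_le_mul_of_one_le_of_one_le (by linarith [(Nat.cast_nonneg N : (0 : ℝ) ≤ N)])
        (one_le_pow₀ hq1)
    have h2 : 0 ≤ √(q ^ n₁) * (q * (((n₁ : ℕ) + 2) * √q ^ N)) := by positivity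
    linarith
  set m := max 1 (N + 1 - Q.natDegree - N / 2) with hm
  have hm1 : 1 ≤ m := le_max_left _ _
  have hm2 : N + 1 - Q.natDegree - N / 2 ≤ m := le_max_right _ _
  have hM : (Q * g).natDegree = Q.natDegree + g.natDegree := hQ.natDegree_mul hg
  have hn₀ : (Q * g).natDegree + m ≤ n₁ := by
    rw [hM, hn₁]
    rcases max_choice 1 (N + 1 - Q.natDegree - N / 2) with h | h <;> rw [hm, h] <;> omega
  have key : ∀ n ∈ Finset.range (N + 1), ‖weightedSum η θ g n -
      ∑ f ∈ degFinset F n, (primeModel Q g f : ℂ) * η (θ (f - 1))‖ ≤ B * Y := by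
    intro n hn
    rw [Finset.mem_range] at hn
    by_cases hnm : (Q * g).natDegree + m ≤ n
    · refine (norm_weightedSum_sub_le_of_le hQ hg η hθ hm1 (by omega) hnm).trans ?_
      rw [mul_assoc]
      refine mul_le_mul_of_nonneg_left ?_ hB0
      have h1 : √(q ^ ((Q * g).natDegree + m)) ≤ √(q ^ n₁) :=
        Real.sqrt_le_sqrt (pow_le_pow_right₀ hq1 hn₀)
      have h2 : ((Q * g).natDegree + m + 2 : ℝ) ≤ (n₁ : ℕ) + 2 := by
        have : (((Q * g).natDegree + m : ℕ) : ℝ) ≤ n₁ := by exact_mod_cast hn₀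
        push_cast at this ⊢
        linarith
      have h3 : √q ^ n ≤ √q ^ N :=
        pow_le_pow_right₀ (Real.one_le_sqrt.2 hq1) (Nat.lt_succ_iff.1 hn)
      have h4 : 0 ≤ ((N : ℝ) + 1) * q ^ n₁ := by positivity
      refine le_trans ?_ (le_add_of_nonneg_left h4)
      gcongr
    · refine (norm_weightedSum_sub_le_of_lt hQg η θ n).trans ?_
      refine mul_le_mul_of_nonneg_left ?_ hB0
      have h1 : ((n : ℝ) + 1) * q ^ (n + 1) ≤ (N + 1) * q ^ n₁ := by
        have : (n : ℝ) ≤ N := by exact_mod_cast Nat.lt_succ_iff.1 hn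
        have h2 : q ^ (n + 1) ≤ q ^ n₁ := pow_le_pow_right₀ hq1 (by omega)
        gcongr
      have h2 : 0 ≤ √(q ^ n₁) * (q * (((n₁ : ℕ) + 2) * √q ^ N)) := by positivity
      linarith
  rw [modelSum, sum_polyLT_eq_sum_range, sub_add_eq_sub_sub_swap, ← Finset.sum_sub_distrib]
  have h0 := norm_primeModel_mul_le hQg η (θ (0 - 1)) (0 : F[X])
  have h1 := (norm_sum_le_of_le _ key).trans_eq (by
    rw [Finset.sum_const, Finset.card_range, nsmul_eq_mul])
  refine (norm_sub_le _ _).trans ((add_le_add h1 h0).trans ?_)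
  have h2 : B ≤ B * Y := le_mul_of_one_le_right hB0 hY1
  push_cast
  linear_combination h2

end ErrorTerm

section Bounds

theorem exists_pow_card_primesOf_le (F : Type*) [Field F] [Fintype F] {c : ℝ} (hc : 1 ≤ c) {ε : ℝ}
    (hε : 0 < ε) : ∃ C : ℝ, 0 < C ∧ ∀ (M : F[X]), M ≠ 0 → ∀ N : ℕ, M.natDegree ≤ N →
      c ^ (primesOf M).card ≤ C * (Fintype.card F : ℝ) ^ (ε * N) := by
  set q : ℝ := (Fintype.card F : ℝ) with hq
  have hq1 : 1 < q := by
    rw [hq]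
    exact_mod_cast (Fintype.one_lt_card : 1 < Fintype.card F)
  have hq0 : 0 < q := by linarith
  obtain ⟨J, hJ⟩ := pow_unbounded_of_one_lt c (Real.one_lt_rpow hq1 hε)
  refine ⟨c ^ (polyLT F (J + 1)).card, by positivity, fun M hM N hN => ?_⟩
  have h1 : c ^ (primesOf M).card ≤
      c ^ (polyLT F (J + 1)).card * ∏ l ∈ primesOf M, (q ^ ε) ^ l.natDegree := by
    have hb : 1 ≤ q ^ ε := (Real.one_lt_rpow hq1 hε).le
    rw [← Finset.card_filter_add_card_filter_not (fun l => l ∈ polyLT F (J + 1)), pow_add]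
    have h2 : c ^ ((primesOf M).filter fun l => l ∈ polyLT F (J + 1)).card ≤
        c ^ (polyLT F (J + 1)).card :=
      pow_le_pow_right₀ hc (Finset.card_le_card fun l hl => (Finset.mem_filter.1 hl).2)
    have h3 : c ^ ((primesOf M).filter fun l => ¬ l ∈ polyLT F (J + 1)).card ≤
        ∏ l ∈ primesOf M, (q ^ ε) ^ l.natDegree := by
      rw [← Finset.prod_const]
      calc ∏ _l ∈ (primesOf M).filter fun l => ¬ l ∈ polyLT F (J + 1), c
          ≤ ∏ l ∈ (primesOf M).filter fun l => ¬ l ∈ polyLT F (J + 1), (q ^ ε) ^ l.natDegree := by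
            refine Finset.prod_le_prod (fun _ _ => by linarith) fun l hl => ?_
            refine hJ.le.trans (pow_le_pow_right₀ hb ?_)
            have h4 := (Finset.mem_filter.1 hl).2
            rw [mem_polyLT] at h4
            by_contra h5
            refine h4 (degree_le_natDegree.trans_lt ?_)
            exact_mod_cast (by omega : l.natDegree < J + 1)
        _ ≤ _ := by
            rw [Finset.prod_filter]
            refine Finset.prod_le_prod (fun l _ => ?_) fun l _ => ?_
            · split_ifs <;> positivity
            · split_ifs
              exacts [one_le_pow₀ hb, le_rfl]
    exact mul_le_mul h2 h3 (by positivity) (by positivity)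
  refine h1.trans ?_
  rw [Finset.prod_pow_eq_pow_sum]
  refine mul_le_mul_of_nonneg_left ?_ (by positivity)
  rw [Real.rpow_mul hq0.le, Real.rpow_natCast]
  exact pow_le_pow_right₀ (Real.one_lt_rpow hq1 hε).le ((sum_natDegree_primesOf_le hM).trans hN)

theorem exists_add_four_sq_le {q : ℝ} (hq : 1 < q) {ε : ℝ} (hε : 0 < ε) :
    ∃ C : ℝ, 0 < C ∧ ∀ N : ℕ, ((N : ℝ) + 4) ^ 2 ≤ C * q ^ (ε * N) := by
  have hl : 0 < Real.log q := Real.log_pos hq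
  set c := ε * Real.log q with hc
  have hc0 : 0 < c := mul_pos hε hl
  refine ⟨(4 + 2 / c) ^ 2, by positivity, fun N => ?_⟩
  have e : q ^ (ε * N) = Real.exp (c * N / 2) ^ 2 := by
    rw [← Real.exp_nat_mul, Real.rpow_def_of_pos (by linarith), hc]
    congr 1
    push_cast
    ring
  rw [e, ← mul_pow]
  have h1 : c * N / 2 + 1 ≤ Real.exp (c * N / 2) := Real.add_one_le_exp _
  have h2 : (N : ℝ) + 4 ≤ (4 + 2 / c) * (c * N / 2 + 1) := by
    have : (4 + 2 / c) * (c * N / 2 + 1) = N + 4 + (2 * c * N + 2 / c) := by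
      field_simp
      ring
    rw [this]
    have : 0 ≤ 2 * c * N + 2 / c := by positivity
    linarith
  have h3 : (4 + 2 / c) * (c * N / 2 + 1) ≤ (4 + 2 / c) * Real.exp (c * N / 2) := by
    gcongr
  exact pow_le_pow_left₀ (by positivity) (h2.trans h3) 2

/-- The bound for the error in the approximation of the weighted sums. -/
def errBound (q A : ℝ) (N k : ℕ) : ℝ :=
  (N + 2) * (A * q ^ k * ((N + 1) * q ^ (N / 2 + k + 2) +
    √(q ^ (N / 2 + k + 2)) * (q * (((N / 2 + k + 2 : ℕ) + 2) * √q ^ N))))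

theorem errBound_nonneg {q A : ℝ} (hq : 0 ≤ q) (hA : 0 ≤ A) (N k : ℕ) : 0 ≤ errBound q A N k := by
  rw [errBound]
  positivity

theorem errBound_mono {q A B : ℝ} (hq : 0 ≤ q) (h : A ≤ B) (N k : ℕ) :
    errBound q A N k ≤ errBound q B N k := by
  rw [errBound, errBound]
  gcongr

theorem errBound_add_le {q A : ℝ} (hq : 1 ≤ q) (hA : 0 ≤ A) (N : ℕ) :
    errBound q A N (N / 12) + A * q ^ (N + 1 - N / 12) ≤
      A * q ^ ((11 / 12 : ℝ) * N) * (3 * q ^ 2 * (N + 4) ^ 2) := by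
  have hq0 : 0 < q := by linarith
  set k := N / 12 with hk
  set y := q ^ ((11 / 12 : ℝ) * N) with hy
  have hy0 : 0 < y := Real.rpow_pos_of_pos hq0 _
  have hk1 : 12 * (k : ℝ) ≤ N := by exact_mod_cast (by omega : 12 * k ≤ N)
  have hk2 : (N : ℝ) ≤ 12 * k + 12 := by exact_mod_cast (by omega : N ≤ 12 * k + 12)
  have hN2 : 2 * ((N / 2 : ℕ) : ℝ) ≤ N := by exact_mod_cast (by omega : 2 * (N / 2) ≤ N)
  have hN0 : (0 : ℝ) ≤ N := Nat.cast_nonneg N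
  have h1 : q ^ k * q ^ (N / 2 + k + 2) ≤ q ^ 2 * y := by
    rw [hy, ← pow_add, ← Real.rpow_natCast, ← Real.rpow_natCast, ← Real.rpow_add hq0]
    refine Real.rpow_le_rpow_of_exponent_le hq ?_
    push_cast
    linarith
  have h2 : q ^ k * (√(q ^ (N / 2 + k + 2)) * (q * √q ^ N)) ≤ q ^ 2 * y := by
    rw [hy, Real.sqrt_eq_rpow, Real.sqrt_eq_rpow, ← Real.rpow_natCast, ← Real.rpow_natCast,
      ← Real.rpow_natCast, ← Real.rpow_natCast, ← Real.rpow_mul hq0.le, ← Real.rpow_mul hq0.le,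
      ← Real.rpow_add hq0, ← Real.rpow_one_add' hq0.le, ← Real.rpow_add hq0, ← Real.rpow_add hq0]
    · refine Real.rpow_le_rpow_of_exponent_le hq ?_
      push_cast
      linarith
    · positivity
  have h3 : q ^ (N + 1 - k) ≤ q ^ 2 * y := by
    rw [hy, ← Real.rpow_natCast, ← Real.rpow_natCast, ← Real.rpow_add hq0]
    refine Real.rpow_le_rpow_of_exponent_le hq ?_
    rw [Nat.cast_sub (by omega)]
    push_cast
    linarith
  have h4 : (((N / 2 + k + 2 : ℕ) : ℝ) + 2) ≤ N + 4 := by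
    push_cast
    linarith
  have hz : 0 ≤ q ^ 2 * y := by positivity
  have h5 : q ^ k * ((N + 1) * q ^ (N / 2 + k + 2) +
      √(q ^ (N / 2 + k + 2)) * (q * (((N / 2 + k + 2 : ℕ) + 2) * √q ^ N))) ≤
      (2 * N + 5) * (q ^ 2 * y) := by
    calc _ = (N + 1) * (q ^ k * q ^ (N / 2 + k + 2)) + (((N / 2 + k + 2 : ℕ) : ℝ) + 2) *
          (q ^ k * (√(q ^ (N / 2 + k + 2)) * (q * √q ^ N))) := by ring
      _ ≤ (N + 1) * (q ^ 2 * y) + (N + 4) * (q ^ 2 * y) := by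
          refine add_le_add (by gcongr) ?_
          exact mul_le_mul h4 h2 (by positivity) (by positivity)
      _ = _ := by ring
  calc errBound q A N k + A * q ^ (N + 1 - k)
      = A * ((N + 2) * (q ^ k * ((N + 1) * q ^ (N / 2 + k + 2) +
      √(q ^ (N / 2 + k + 2)) * (q * (((N / 2 + k + 2 : ℕ) + 2) * √q ^ N)))) +
      q ^ (N + 1 - k)) := by rw [errBound]; ring
    _ ≤ A * ((N + 2) * ((2 * N + 5) * (q ^ 2 * y)) + q ^ 2 * y) := by gcongr
    _ = A * (q ^ 2 * y) * ((N + 2) * (2 * N + 5) + 1) := by ring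
    _ ≤ A * (q ^ 2 * y) * (3 * (N + 4) ^ 2) := by
        refine mul_le_mul_of_nonneg_left ?_ (mul_nonneg hA hz)
        nlinarith
    _ = _ := by ring

/-- The size of the constant coefficient. -/
theorem exists_errBound_add_le {q : ℝ} (hq : 1 < q) {ε : ℝ} (hε : 0 < ε) {C₁ : ℝ} (hC₁ : 0 < C₁) :
    ∃ C : ℝ, 0 < C ∧ ∀ N : ℕ,
      errBound q (C₁ * q ^ (ε / 2 * N)) N (N / 12) +
        C₁ * q ^ (ε / 2 * N) * q ^ (N + 1 - N / 12) ≤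
      C * q ^ ((N : ℝ) * (-1 / 12 + ε)) * q ^ (N + 1) := by
  have hq0 : 0 < q := by linarith
  obtain ⟨C₂, hC₂, h⟩ := exists_add_four_sq_le hq (half_pos hε)
  refine ⟨C₁ * C₂ * (3 * q ^ 2), by positivity, fun N => ?_⟩
  refine (errBound_add_le hq.le (by positivity) N).trans ?_
  have e : q ^ (ε / 2 * N) * q ^ ((11 / 12 : ℝ) * N) * q ^ (ε / 2 * N) =
      q ^ ((N : ℝ) * (-1 / 12 + ε)) * q ^ N := by
    rw [← Real.rpow_add hq0, ← Real.rpow_add hq0, ← Real.rpow_natCast, ← Real.rpow_add hq0]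
    congr 1
    ring
  calc _ ≤ C₁ * q ^ (ε / 2 * N) * q ^ ((11 / 12 : ℝ) * N) *
        (3 * q ^ 2 * (C₂ * q ^ (ε / 2 * N))) := by
        gcongr
        exact h N
    _ = C₁ * C₂ * (3 * q ^ 2) * (q ^ (ε / 2 * N) * q ^ ((11 / 12 : ℝ) * N) * q ^ (ε / 2 * N)) := by
        ring
    _ = C₁ * C₂ * (3 * q ^ 2) * q ^ ((N : ℝ) * (-1 / 12 + ε)) * q ^ N := by
        rw [e]
        ring
    _ ≤ _ := by
        have := pow_le_pow_right₀ hq.le N.le_succ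
        gcongr

end Bounds

section Main

variable {F : Type*} [Field F] [Fintype F]

theorem card_monicFinset (k : ℕ) : (monicFinset F k).card = Fintype.card F ^ k := by
  have h := sum_monicFinset (F := F) k fun _ => 1
  rw [Finset.sum_const, Finset.sum_const, card_polyLT] at h
  exact_mod_cast (by simpa using h : ((monicFinset F k).card : ℂ) = (Fintype.card F : ℂ) ^ k)

/-- `weightedSum` summed over the primes of degree at most `N` and averaged over the monic `g` of
degree `k`. -/
def avgWeightedSum (η : AddChar F ℂ) (θ : F[X] →ₗ[F] F) (N k : ℕ) : ℝ :=
  (∑ g ∈ monicFinset F k, ∑ n ∈ Finset.range (N + 1), weightedSum η θ g n).re /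
    (Fintype.card F : ℝ) ^ k

/-- The coefficient of `η (θ (P - 1))` in `avgWeightedSum`. -/
def avgWeight (k : ℕ) (P : F[X]) : ℝ :=
  P.natDegree * (∑ g ∈ monicFinset F k, primeWeight g P) / (Fintype.card F : ℝ) ^ k

theorem avgWeightedSum_eq (η : AddChar F ℂ) (θ : F[X] →ₗ[F] F) (N k : ℕ) :
    avgWeightedSum η θ N k = ∑ n ∈ Finset.range (N + 1), ∑ P ∈ irrFinset F n,
      avgWeight k P * (η (θ (P - 1))).re := by
  have e : ∑ g ∈ monicFinset F k, ∑ n ∈ Finset.range (N + 1), weightedSum η θ g n =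
      ∑ n ∈ Finset.range (N + 1), ∑ P ∈ irrFinset F n,
        ((P.natDegree * ∑ g ∈ monicFinset F k, primeWeight g P : ℝ) : ℂ) * η (θ (P - 1)) := by
    rw [Finset.sum_comm]
    refine Finset.sum_congr rfl fun n _ => ?_
    simp only [weightedSum]
    rw [Finset.sum_comm]
    refine Finset.sum_congr rfl fun P hP => ?_
    rw [natDegree_eq_of_degree_eq_some (mem_irrFinset.1 hP).1]
    push_cast
    rw [Finset.mul_sum, Finset.sum_mul]
    exact Finset.sum_congr rfl fun g _ => by ring
  rw [avgWeightedSum, e, Complex.re_sum, Finset.sum_div]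
  refine Finset.sum_congr rfl fun n _ => ?_
  rw [Complex.re_sum, Finset.sum_div]
  refine Finset.sum_congr rfl fun P _ => ?_
  rw [Complex.re_ofReal_mul, avgWeight]
  ring

theorem abs_avgWeightedSum_sub_le (η : AddChar F ℂ) {θ : F[X] →ₗ[F] F} {Q : F[X]} (hQ : Q.Monic)
    {N k : ℕ} (hQN : Q.natDegree ≤ N / 2) (hk : N / 2 + k ≤ N)
    (hθ : ∀ w ∈ polyLT F (N / 2), θ (Q * w) = 0) {A : ℝ}
    (hA : ∀ M : F[X], M ≠ 0 → M.natDegree ≤ N → 6 ^ (primesOf M).card ≤ A) :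
    |avgWeightedSum η θ N k - (∑ g ∈ monicFinset F k, modelSum η θ Q g (N + 1)).re /
      (Fintype.card F : ℝ) ^ k| ≤ errBound (Fintype.card F) A N k := by
  have hq0 : 0 < (Fintype.card F : ℝ) ^ k := by
    have : 0 < Fintype.card F := Fintype.card_pos
    positivity
  rw [avgWeightedSum, ← sub_div, abs_div, abs_of_pos hq0, div_le_iff₀ hq0, ← Complex.sub_re,
    ← Finset.sum_sub_distrib]
  refine (Complex.abs_re_le_norm _).trans ((norm_sum_le_of_le _ fun g hg => ?_).trans_eq
    (b := ∑ _g ∈ monicFinset F k, errBound (Fintype.card F) A N k) ?_)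
  · obtain ⟨hg1, rfl⟩ := mem_monicFinset.1 hg
    refine (norm_sum_weightedSum_sub_modelSum_le hQ hg1 η hQN hθ).trans ?_
    refine errBound_mono (by positivity) (hA _ (mul_ne_zero hQ.ne_zero hg1.ne_zero) ?_) N
      g.natDegree
    exact natDegree_mul_le.trans (by omega)
  · rw [Finset.sum_const, card_monicFinset, nsmul_eq_mul, mul_comm]
    push_cast
    rfl

theorem neg_le_avgWeightedSum {η : AddChar F ℂ} (hη : η ≠ 0) (θ : F[X] →ₗ[F] F) {N k : ℕ}
    (hk : N / 2 + k ≤ N) (hk' : k ≤ N / 2) {A : ℝ}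
    (hA : ∀ M : F[X], M ≠ 0 → M.natDegree ≤ N → 6 ^ (primesOf M).card ≤ A) :
    -(errBound (Fintype.card F) A N k + A * (Fintype.card F : ℝ) ^ (N + 1 - k)) ≤
      avgWeightedSum η θ N k := by
  have hq : 0 < (Fintype.card F : ℝ) := by exact_mod_cast Fintype.card_pos
  obtain ⟨Q, hQ, hQN, hθ⟩ := exists_monic_functional_eq_zero θ (N / 2)
  have h1 := (abs_le.1 (abs_avgWeightedSum_sub_le η hQ hQN hk hθ hA)).1
  have h2 := neg_le_re_sum_modelSum hη hQ (k := k) (n := N + 1) (by omega) (by omega)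
    fun w hw => hθ w (mem_polyLT.2 ((mem_polyLT.1 hw).trans_le (by exact_mod_cast hk')))
  have h3 := hA Q hQ.ne_zero (by omega)
  have h4 : -(A * (Fintype.card F : ℝ) ^ (N + 1 - k)) ≤
      (∑ g ∈ monicFinset F k, modelSum η θ Q g (N + 1)).re / (Fintype.card F : ℝ) ^ k := by
    rw [le_div_iff₀ (by positivity), neg_mul, mul_assoc, ← pow_add,
      Nat.sub_add_cancel (by omega)]
    refine le_trans (neg_le_neg ?_) h2
    gcongr
  linarith

theorem le_avgWeightedSum_zero {η : AddChar F ℂ} (hη : η ≠ 0) {N k : ℕ}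
    (hk : N / 2 + k ≤ N) {A : ℝ}
    (hA : ∀ M : F[X], M ≠ 0 → M.natDegree ≤ N → 6 ^ (primesOf M).card ≤ A) :
    (Fintype.card F : ℝ) ^ (N + 1) - errBound (Fintype.card F) A N k ≤
      avgWeightedSum η (0 : F[X] →ₗ[F] F) N k := by
  have hq : 0 < (Fintype.card F : ℝ) := by exact_mod_cast Fintype.card_pos
  have h1 := (abs_le.1 (abs_avgWeightedSum_sub_le η (θ := 0) monic_one (k := k) (N := N) (by simp)
    hk (fun _ _ => rfl) hA)).1
  have h2 : ∀ g ∈ monicFinset F k, modelSum η 0 1 g (N + 1) = (Fintype.card F : ℂ) ^ (N + 1) := by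
    intro g hg
    obtain ⟨hg1, hgk⟩ := mem_monicFinset.1 hg
    rw [modelSum_eq hη monic_one hg1 (by rw [natDegree_one, hgk]; omega) (θl := fun _ => 0)
      (fun _ _ _ => rfl) (fun f _ => by simp)]
    simp
  rw [Finset.sum_congr rfl h2, Finset.sum_const, card_monicFinset, nsmul_eq_mul] at h1
  have e : (((Fintype.card F ^ k : ℕ) : ℂ) * (Fintype.card F : ℂ) ^ (N + 1)).re =
      (Fintype.card F : ℝ) ^ (N + 1) * (Fintype.card F : ℝ) ^ k := by
    rw [mul_comm ((Fintype.card F : ℝ) ^ (N + 1))]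
    exact_mod_cast Complex.ofReal_re ((Fintype.card F : ℝ) ^ k * (Fintype.card F : ℝ) ^ (N + 1))
  rw [e, mul_div_cancel_right₀ _ (by positivity)] at h1
  linarith

theorem exists_nonneg_cosine_polynomial {η : AddChar F ℂ} (hη : η ≠ 0) {ε : ℝ} (hε : 0 < ε) :
    ∃ C : ℝ, 0 < C ∧ ∀ N : ℕ, ∃ (a₀ : ℝ) (a : F[X] → ℝ),
      a₀ + ∑ n ∈ Finset.range (N + 1), ∑ P ∈ irrFinset F n, a P = 1 ∧
      (∀ θ : F[X] →ₗ[F] F, 0 ≤ a₀ + ∑ n ∈ Finset.range (N + 1), ∑ P ∈ irrFinset F n,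
        a P * (η (θ (P - 1))).re) ∧
      0 < a₀ ∧ a₀ ≤ C * (Fintype.card F : ℝ) ^ ((N : ℝ) * (-1 / 12 + ε)) := by
  set q : ℝ := (Fintype.card F : ℝ) with hq
  have hq1 : 1 < q := by
    rw [hq]
    exact_mod_cast (Fintype.one_lt_card : 1 < Fintype.card F)
  have hq0 : 0 < q := by linarith
  obtain ⟨C₁, hC₁, h₁⟩ := exists_pow_card_primesOf_le F (c := 6) (by norm_num) (half_pos hε)
  obtain ⟨C, hC, h₂⟩ := exists_errBound_add_le hq1 hε hC₁
  refine ⟨C, hC, fun N => ?_⟩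
  set A := C₁ * q ^ (ε / 2 * N) with hAdef
  have hA0 : 0 < A := by positivity
  have hA : ∀ M : F[X], M ≠ 0 → M.natDegree ≤ N → 6 ^ (primesOf M).card ≤ A :=
    fun M hM hN => h₁ M hM N hN
  have hE := errBound_nonneg hq0.le hA0.le N (N / 12)
  set δ := errBound q A N (N / 12) + A * q ^ (N + 1 - N / 12) with hδ
  have hA1 : 0 < A * q ^ (N + 1 - N / 12) := by positivity
  have hδ0 : 0 < δ := by linarith
  set S := fun θ : F[X] →ₗ[F] F => avgWeightedSum η θ N (N / 12) with hS
  have hlow : ∀ θ, 0 ≤ δ + S θ := fun θ => by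
    have := neg_le_avgWeightedSum hη θ (N := N) (k := N / 12) (by omega) (by omega) hA
    linarith
  have hzero : q ^ (N + 1) ≤ δ + S 0 := by
    have := le_avgWeightedSum_zero hη (N := N) (k := N / 12) (by omega) hA
    linarith
  have hpos : 0 < δ + S 0 := lt_of_lt_of_le (by positivity) hzero
  have key : ∀ θ : F[X] →ₗ[F] F, δ / (δ + S 0) + ∑ n ∈ Finset.range (N + 1), ∑ P ∈ irrFinset F n,
      avgWeight (N / 12) P / (δ + S 0) * (η (θ (P - 1))).re = (δ + S θ) / (δ + S 0) := by
    intro θ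
    simp only [hS, add_div δ]
    rw [avgWeightedSum_eq η θ, Finset.sum_div]
    congr 1
    refine Finset.sum_congr rfl fun n _ => ?_
    rw [Finset.sum_div]
    exact Finset.sum_congr rfl fun P _ => by ring
  refine ⟨δ / (δ + S 0), fun P => avgWeight (N / 12) P / (δ + S 0), ?_, fun θ => ?_,
    div_pos hδ0 hpos, ?_⟩
  · have := key 0
    simpa [hpos.ne'] using this
  · rw [key]
    exact div_nonneg (hlow θ) hpos.le
  · rw [div_le_iff₀ hpos]
    refine (h₂ N).trans ?_
    gcongr

end Main

section Translation

/-- The additive character of `Fq` underlying `eC`. -/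
def traceChar : AddChar Fq ℂ :=
  (ZMod.stdAddChar (N := p)).compAddMonoidHom (Algebra.trace (ZMod p) Fq).toAddMonoidHom

theorem traceChar_ne_zero : traceChar p Fq ≠ 0 := by
  have := Module.Finite.of_finite (R := ZMod p) (M := Fq)
  obtain ⟨a, ha⟩ := Algebra.trace_surjective (ZMod p) Fq 1
  intro h
  have h1 : ZMod.stdAddChar (N := p) 1 = ZMod.stdAddChar (N := p) 0 := by
    rw [AddChar.map_zero_eq_one, ← ha]
    exact DFunLike.congr_fun h a
  exact one_ne_zero (ZMod.injective_stdAddChar h1)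

theorem eC_eq_traceChar (x : LaurentSeries Fq) : eC p Fq x = traceChar p Fq (x.coeff 1) := by
  rw [eC, ← ZMod.toCircle_apply, ← ZMod.stdAddChar_apply]
  rfl

/-- The functional `f ↦ res (x f)` on polynomials. -/
def resFunctional (x : LaurentSeries Fq) : Fq[X] →ₗ[Fq] Fq where
  toFun f := (x * toK Fq f).coeff 1
  map_add' f g := by
    rw [toK, map_add, mul_add]
    rfl
  map_smul' c f := by
    have e : algebraMap Fq (LaurentSeries Fq) c = HahnSeries.C c := by
      simp [HahnSeries.algebraMap_apply']
    rw [toK, smul_eq_C_mul, map_mul, aeval_C, e, mul_left_comm, HahnSeries.C_mul_eq_smul]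
    rfl

theorem finsum_irreducible_eq_sum (N : ℕ) (h : Fq[X] → ℝ) :
    ∑ᶠ P ∈ {P : Fq[X] | Irreducible P ∧ P.degree ≤ (N : ℕ)}, h P =
      ∑ n ∈ Finset.range (N + 1), ∑ P ∈ irrFinset Fq n, h P := by
  rw [← Finset.sum_biUnion, ← finsum_mem_coe_finset]
  · refine finsum_mem_congr (Set.ext fun P => ?_) fun _ _ => rfl
    simp only [Set.mem_ofPred_eq, Finset.coe_biUnion, Finset.mem_coe, Finset.mem_range,
      Set.mem_iUnion, mem_irrFinset, exists_prop]
    constructor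
    · rintro ⟨hP, hd⟩
      have e := degree_eq_natDegree hP.ne_zero
      refine ⟨P.natDegree, ?_, e, hP⟩
      rw [e] at hd
      exact Nat.lt_succ_iff.2 (by exact_mod_cast hd)
    · rintro ⟨n, hn, e, hP⟩
      rw [e]
      exact ⟨hP, by exact_mod_cast Nat.lt_succ_iff.1 hn⟩
  · intro m _ n _ hmn
    refine Finset.disjoint_left.2 fun P h1 h2 => hmn ?_
    have e := (mem_irrFinset.1 h1).1.symm.trans (mem_irrFinset.1 h2).1
    exact_mod_cast e

end Translation

/-- The van der Corput property of shifted irreducibles: there is a nonnegative cosine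
polynomial `T(x) = a₀ + Σ_{P irreducible, deg P ≤ N} a_{P-1}·Re(e(x(P−1)))` with `T(0) = 1`
and `0 < a₀ ≤ C(q,ε)·q^(N(−1/12+ε))`. -/
theorem van_der_Corput_property (ε : ℝ) (hε : 0 < ε) :
    ∃ C : ℝ, 0 < C ∧ ∀ N : ℕ,
      ∃ (a₀ : ℝ) (a : Polynomial Fq → ℝ),
        (a₀ + ∑ᶠ P ∈ {P : Polynomial Fq | Irreducible P ∧ P.degree ≤ (N : ℕ)},
            a P * (eC p Fq ((0 : LaurentSeries Fq) * toK Fq (P - 1))).re) = 1 ∧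
        (∀ x : LaurentSeries Fq,
          0 ≤ a₀ + ∑ᶠ P ∈ {P : Polynomial Fq | Irreducible P ∧ P.degree ≤ (N : ℕ)},
            a P * (eC p Fq (x * toK Fq (P - 1))).re) ∧
        0 < a₀ ∧
        a₀ ≤ C * (Fintype.card Fq : ℝ) ^ ((N : ℝ) * (-1 / 12 + ε)) := by
  obtain ⟨C, hC, h⟩ := exists_nonneg_cosine_polynomial (traceChar_ne_zero p Fq) hε
  refine ⟨C, hC, fun N => ?_⟩
  obtain ⟨a₀, a, h1, h2, h3, h4⟩ := h N
  refine ⟨a₀, a, ?_, fun x => ?_, h3, h4⟩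
  · rw [finsum_irreducible_eq_sum, ← h1]
    simp only [zero_mul, eC_eq_traceChar, HahnSeries.coeff_zero, AddChar.map_zero_eq_one,
      Complex.one_re, mul_one]
  · rw [finsum_irreducible_eq_sum]
    simp only [eC_eq_traceChar]
    exact h2 (resFunctional Fq x)

end
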